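/- arXiv:2308.09143 — 2 statements merged into one kernel-verified Lean document; each statement's English description precedes it below -/
import Mathlib

section
/- Let Ω ⊂ ℂ^N be a bounded strongly pseudoconvex domain with C^{2,α}-smooth boundary, α ∈ (0,1]. Then there exists a constant c > 0, depending only on Ω, such that for all z, w ∈ Ω and every real Kobayashi geodesic γ : I → Ω joining z to w: D_Ω(γ)^{1/2} ≥ c·ℓ(γ), where D_Ω(γ) := max{δ_Ω(γ(t)) : t ∈ I} is the maximal boundary distance along γ and ℓ(γ) denotes the Euclidean length of the curve γ. -/
open Metric Set Filter Topology MeasureTheory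

noncomputable section

namespace InvDist

/-- Complex Euclidean `N`-space. -/
abbrev E (N : ℕ) := EuclideanSpace ℂ (Fin N)

variable {N : ℕ}

/-- The paper's Hermitian product `⟨a,b⟩ = ∑ a_j * conj (b_j)`. -/
def herm (a b : E N) : ℂ := ∑ j, a j * (starRingEnd ℂ) (b j)

/-- Euclidean distance to the boundary of `Ω`. -/
def bdist (Ω : Set (E N)) (x : E N) : ℝ := Metric.infDist x (frontier Ω)

/-- `π` selects, for each point of `Ω`, a closest point on the boundary. -/
def IsClosestPointSelection (Ω : Set (E N)) (π : E N → E N) : Prop :=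
  ∀ z ∈ Ω, π z ∈ frontier Ω ∧ dist z (π z) = bdist Ω z

/-- `‖v_z‖`: modulus of the complex normal component of `v` with respect to the
closest boundary point `π z`; the outer unit normal at `π z` is `(π z - z)/‖π z - z‖`. -/
def ncomp (Ω : Set (E N)) (π : E N → E N) (z v : E N) : ℝ :=
  ‖herm v (π z - z)‖ / bdist Ω z

/-- `‖v_z^ℝ‖`: modulus of the real normal component of `v` at `π z`. -/
def ncompR (Ω : Set (E N)) (π : E N → E N) (z v : E N) : ℝ :=
  |(herm v (π z - z)).re| / bdist Ω z

/-- The quantity `A_Ω(z,w)`. -/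
def Afun (Ω : Set (E N)) (π : E N → E N) (z w : E N) : ℝ :=
  (ncomp Ω π z (z - w) + ‖z - w‖ ^ 2 + ‖z - w‖ * Real.sqrt (bdist Ω z)) /
    (Real.sqrt (bdist Ω z) * Real.sqrt (bdist Ω w))

/-- `h_Ω(z,w) = ‖(z-w)_z‖ + ‖z-w‖ δ_Ω(z)^{1/2}`. -/
def hfun (Ω : Set (E N)) (π : E N → E N) (z w : E N) : ℝ :=
  ncomp Ω π z (z - w) + ‖z - w‖ * Real.sqrt (bdist Ω z)

/-- real analogue of `h_Ω`. -/
def hfunR (Ω : Set (E N)) (π : E N → E N) (z w : E N) : ℝ :=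
  ncompR Ω π z (z - w) + ‖z - w‖ * Real.sqrt (bdist Ω z)

/-- inverse hyperbolic tangent -/
def artanh (x : ℝ) : ℝ := Real.log ((1 + x) / (1 - x)) / 2

/-- The Lempert function of `Ω`. -/
def lempert (Ω : Set (E N)) (z w : E N) : ℝ :=
  artanh (sInf { r : ℝ | ∃ φ : ℂ → E N, DifferentiableOn ℂ φ (ball 0 1) ∧
    MapsTo φ (ball (0:ℂ) 1) Ω ∧ φ 0 = z ∧ ∃ a ∈ ball (0:ℂ) 1, φ a = w ∧ r = ‖a‖ })

/-- The Carathéodory distance of `Ω`. -/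
def caratheodory (Ω : Set (E N)) (z w : E N) : ℝ :=
  artanh (sSup { r : ℝ | ∃ f : E N → ℂ, DifferentiableOn ℂ f Ω ∧
    MapsTo f Ω (ball (0:ℂ) 1) ∧ f z = 0 ∧ r = ‖f w‖ })

/-- The Kobayashi distance: the largest pseudodistance not exceeding the Lempert
function, given as an infimum over chains. -/
def kobayashi (Ω : Set (E N)) (z w : E N) : ℝ :=
  sInf { r : ℝ | ∃ (n : ℕ) (p : Fin (n + 1) → E N), p 0 = z ∧ p (Fin.last n) = w ∧
    (∀ i, p i ∈ Ω) ∧ r = ∑ i : Fin n, lempert Ω (p i.castSucc) (p i.succ) }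

/-- The Poincaré distance on the unit disc. -/
def poincare (ζ ξ : ℂ) : ℝ := artanh ‖(ζ - ξ) / (1 - (starRingEnd ℂ) ζ * ξ)‖

/-- A complex geodesic of `Ω`. -/
def IsComplexGeodesic (Ω : Set (E N)) (φ : ℂ → E N) : Prop :=
  DifferentiableOn ℂ φ (ball 0 1) ∧ MapsTo φ (ball (0:ℂ) 1) Ω ∧
    ∀ ζ ∈ ball (0:ℂ) 1, ∀ ξ ∈ ball (0:ℂ) 1, kobayashi Ω (φ ζ) (φ ξ) = poincare ζ ξ

/-- `ρ` is `C^k` on `U` with `α`-Hölder `k`-th derivative. -/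
def IsCkHolderOn (k : ℕ) (α : ℝ) (ρ : E N → ℝ) (U : Set (E N)) : Prop :=
  ContDiffOn ℝ k ρ U ∧ ∃ M : ℝ, ∀ x ∈ U, ∀ y ∈ U,
    ‖iteratedFDeriv ℝ k ρ x - iteratedFDeriv ℝ k ρ y‖ ≤ M * ‖x - y‖ ^ α

/-- The Levi form of `ρ` at `p` evaluated at `v`. -/
def levi (ρ : E N → ℝ) (p v : E N) : ℝ :=
  (iteratedFDeriv ℝ 2 ρ p ![v, v] +
    iteratedFDeriv ℝ 2 ρ p ![(Complex.I : ℂ) • v, (Complex.I : ℂ) • v]) / 4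

/-- Bounded strongly pseudoconvex domain with `C^{k,α}`-smooth boundary. -/
def IsStronglyPseudoconvexDomain (k : ℕ) (α : ℝ) (Ω : Set (E N)) : Prop :=
  IsOpen Ω ∧ IsConnected Ω ∧ Bornology.IsBounded Ω ∧
  ∃ (U : Set (E N)) (ρ : E N → ℝ), IsOpen U ∧ closure Ω ⊆ U ∧
    IsCkHolderOn k α ρ U ∧ Ω = {x ∈ U | ρ x < 0} ∧
    (∀ p ∈ frontier Ω, fderiv ℝ ρ p ≠ 0) ∧
    ∀ p ∈ frontier Ω, ∀ v : E N, v ≠ 0 → fderiv ℝ ρ p v = 0 →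
      fderiv ℝ ρ p ((Complex.I : ℂ) • v) = 0 → 0 < levi ρ p v

/-- `η` is the outer unit normal of `Ω` at the boundary point `p`. -/
def IsOuterUnitNormalAt (Ω : Set (E N)) (p η : E N) : Prop :=
  ‖η‖ = 1 ∧ p ∈ frontier Ω ∧ ∃ ε > 0, ∀ t : ℝ, 0 < t → t < ε →
    p - t • η ∈ Ω ∧ bdist Ω (p - t • η) = t

open Classical in
/-- signed boundary distance -/
def signedDist (Ω : Set (E N)) (x : E N) : ℝ :=
  if x ∈ closure Ω then -(bdist Ω x) else bdist Ω x

/-- Hessian quadratic form of the signed boundary distance. -/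
def hessSD (Ω : Set (E N)) (p v : E N) : ℝ :=
  iteratedFDeriv ℝ 2 (signedDist Ω) p ![v, v]

/-- strict linear convexity at `p` (with outer unit normal `η`). -/
def StrictlyLinearlyConvexAt (Ω : Set (E N)) (p η : E N) : Prop :=
  ∀ v : E N, v ≠ 0 → herm v η = 0 → 0 < hessSD Ω p v

/-- strong convexity at `p` (with outer unit normal `η`). -/
def StronglyConvexAt (Ω : Set (E N)) (p η : E N) : Prop :=
  ∀ v : E N, v ≠ 0 → (herm v η).re = 0 → 0 < hessSD Ω p v

/-- `p` is a `C^k`-smooth boundary point of `Ω`. -/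
def IsCkBoundaryPoint (k : ℕ) (Ω : Set (E N)) (p : E N) : Prop :=
  p ∈ frontier Ω ∧ ∃ (U : Set (E N)) (ρ : E N → ℝ), IsOpen U ∧ p ∈ U ∧
    ContDiffOn ℝ k ρ U ∧ (∀ x ∈ U, (x ∈ Ω ↔ ρ x < 0)) ∧
    ∀ x ∈ U ∩ frontier Ω, fderiv ℝ ρ x ≠ 0

/-- bounded domain with `C^k`-smooth boundary. -/
def IsCkDomain (k : ℕ) (Ω : Set (E N)) : Prop :=
  IsOpen Ω ∧ IsConnected Ω ∧ Bornology.IsBounded Ω ∧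
    ∀ p ∈ frontier Ω, IsCkBoundaryPoint k Ω p

/-- bounded domain with `C^{1,1}`-smooth boundary. -/
def IsC11Domain (Ω : Set (E N)) : Prop :=
  IsOpen Ω ∧ IsConnected Ω ∧ Bornology.IsBounded Ω ∧
  ∀ p ∈ frontier Ω, ∃ (U : Set (E N)) (ρ : E N → ℝ), IsOpen U ∧ p ∈ U ∧
    IsCkHolderOn 1 1 ρ U ∧ (∀ x ∈ U, (x ∈ Ω ↔ ρ x < 0)) ∧
    ∀ x ∈ U ∩ frontier Ω, fderiv ℝ ρ x ≠ 0

/-- `p` is a `C^{2,α}`-smooth strongly pseudoconvex boundary point of `Ω`. -/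
def IsSPSCBoundaryPoint (α : ℝ) (Ω : Set (E N)) (p : E N) : Prop :=
  p ∈ frontier Ω ∧ ∃ (U : Set (E N)) (ρ : E N → ℝ), IsOpen U ∧ p ∈ U ∧
    IsCkHolderOn 2 α ρ U ∧ (∀ x ∈ U, (x ∈ Ω ↔ ρ x < 0)) ∧
    (∀ x ∈ U ∩ frontier Ω, fderiv ℝ ρ x ≠ 0) ∧
    ∀ x ∈ U ∩ frontier Ω, ∀ v : E N, v ≠ 0 → fderiv ℝ ρ x v = 0 →
      fderiv ℝ ρ x ((Complex.I : ℂ) • v) = 0 → 0 < levi ρ x v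

instance (N : ℕ) : MeasurableSpace (E N) := borel _

instance (N : ℕ) : BorelSpace (E N) := ⟨rfl⟩

/-- Lebesgue measure on `E N`. -/
def vol (N : ℕ) : Measure (E N) :=
  letI : InnerProductSpace ℝ (E N) := InnerProductSpace.rclikeToReal ℂ (E N)
  letI : MeasureSpace (E N) := measureSpaceOfInnerProductSpace
  volume

/-- Bergman kernel on the diagonal. -/
def bergmanKernelDiag (Ω : Set (E N)) (z : E N) : ℝ :=
  sSup { r : ℝ | ∃ f : E N → ℂ, DifferentiableOn ℂ f Ω ∧
    (∫ x in Ω, ‖f x‖ ^ 2 ∂(vol N)) ≤ 1 ∧ r = ‖f z‖ ^ 2 }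

/-- `M_Ω(z;v)`. -/
def bergmanM (Ω : Set (E N)) (z v : E N) : ℝ :=
  sSup { r : ℝ | ∃ f : E N → ℂ, DifferentiableOn ℂ f Ω ∧
    (∫ x in Ω, ‖f x‖ ^ 2 ∂(vol N)) ≤ 1 ∧ f z = 0 ∧ r = ‖fderiv ℂ f z v‖ }

/-- The Bergman metric. -/
def bergmanMetric (Ω : Set (E N)) (z v : E N) : ℝ :=
  bergmanM Ω z v / Real.sqrt (bergmanKernelDiag Ω z)

/-- The Bergman distance: inner distance of the Bergman metric. -/
def bergmanDist (Ω : Set (E N)) (z w : E N) : ℝ :=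
  sInf { r : ℝ | ∃ γ : ℝ → E N, ContDiffOn ℝ 1 γ (Icc 0 1) ∧ γ 0 = z ∧ γ 1 = w ∧
    (∀ t ∈ Icc (0:ℝ) 1, γ t ∈ Ω) ∧
    r = ∫ t in (0:ℝ)..(1:ℝ), bergmanMetric Ω (γ t) (derivWithin γ (Icc 0 1) t) }

/-- A maximum principle for functions which locally dominate the modulus of a holomorphic function,
with equality at the given point. -/
theorem le_of_le_on_sphere_of_holomorphic_minorant {H : ℂ → ℝ} {r m : ℝ} (hr : 0 < r)
    (hm0 : 0 ≤ m) (hc : ContinuousOn H (closedBall 0 r))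
    (hG : ∀ ζ₀ ∈ ball (0 : ℂ) r, 0 < H ζ₀ → ∃ G : ℂ → ℂ,
      (∀ᶠ ζ in 𝓝 ζ₀, DifferentiableAt ℂ G ζ) ∧ ‖G ζ₀‖ = H ζ₀ ∧ ∀ᶠ ζ in 𝓝 ζ₀, ‖G ζ‖ ≤ H ζ)
    (hm : ∀ ζ ∈ sphere (0 : ℂ) r, H ζ ≤ m) : H 0 ≤ m := by
  by_contra! hlt
  have hcomp : IsCompact (closedBall (0 : ℂ) r) := isCompact_closedBall 0 r
  obtain ⟨ζ₁, hζ₁, hmax⟩ := hcomp.exists_isMaxOn ⟨0, by simp [hr.le]⟩ hc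
  have hmax' : ∀ ζ ∈ closedBall (0 : ℂ) r, H ζ ≤ H ζ₁ := fun ζ hζ => hmax hζ
  have hMc : IsCompact (closedBall (0 : ℂ) r ∩ H ⁻¹' {H ζ₁}) :=
    hcomp.of_isClosed_subset
      (hc.preimage_isClosed_of_isClosed isClosed_closedBall isClosed_singleton) inter_subset_left
  obtain ⟨ζ₀, ⟨hζ₀, hζ₀H⟩, hre⟩ := hMc.exists_isMaxOn ⟨ζ₁, hζ₁, rfl⟩
    Complex.continuous_re.continuousOn
  have hζ₀H : H ζ₀ = H ζ₁ := hζ₀H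
  have hpos : m < H ζ₀ := by
    rw [hζ₀H]; exact hlt.trans_le (hmax' 0 (by simp [hr.le]))
  have hball : ζ₀ ∈ ball (0 : ℂ) r := by
    rcases (mem_closedBall.1 hζ₀).lt_or_eq with h | h
    · exact h
    · exact absurd (hm ζ₀ h) (not_le.2 hpos)
  obtain ⟨G, hGd, hG0, hGle⟩ := hG ζ₀ hball (hm0.trans_lt hpos)
  have hnear : ∀ᶠ ζ in 𝓝 ζ₀, ζ ∈ closedBall (0 : ℂ) r :=
    Filter.mem_of_superset (isOpen_ball.mem_nhds hball) ball_subset_closedBall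
  have hloc : IsLocalMax (norm ∘ G) ζ₀ := by
    filter_upwards [hGle, hnear] with ζ h1 h2
    simp only [Function.comp]
    rw [hG0, hζ₀H]
    exact h1.trans (hmax' ζ h2)
  have hev := Complex.norm_eventually_eq_of_isLocalMax hGd hloc
  have hre' : ∀ᶠ ζ in 𝓝 ζ₀, ζ.re ≤ ζ₀.re := by
    filter_upwards [hev, hGle, hnear] with ζ h1 h2 h3
    refine hre ⟨h3, le_antisymm (hmax' ζ h3) ?_⟩
    rw [← hζ₀H, ← hG0, ← h1]; exact h2
  obtain ⟨ε, hε, hball'⟩ := Metric.eventually_nhds_iff.1 hre'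
  have := @hball' (ζ₀ + ((ε / 2 : ℝ) : ℂ)) (by
    simp [abs_of_pos hε]; linarith)
  rw [Complex.add_re, Complex.ofReal_re] at this
  linarith

/-- `ψ` is strictly plurisubharmonic with constant `c`, in the sense of local holomorphic
supporting functions. -/
def StrictPshOn (Ω : Set (E N)) (ψ : E N → ℝ) (c : ℝ) : Prop :=
  ∀ x₀ ∈ Ω, ∃ P : E N → ℂ, Differentiable ℂ P ∧ P x₀ = 0 ∧
    ∀ᶠ x in 𝓝 x₀, ψ x₀ + (P x).re + c * ‖x - x₀‖ ^ 2 ≤ ψ x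

theorem inv_ge_mul_exp {s s₀ : ℝ} (hs : 0 < s) (hs₀ : 0 < s₀) :
    s₀⁻¹ * Real.exp (-((s - s₀) / s₀)) ≤ s⁻¹ := by
  have h1 : s / s₀ ≤ Real.exp ((s - s₀) / s₀) := by
    have := Real.add_one_le_exp ((s - s₀) / s₀)
    have h2 : (s - s₀) / s₀ + 1 = s / s₀ := by field_simp; ring
    linarith
  rw [Real.exp_neg, ← mul_inv]
  apply inv_anti₀ hs
  calc s = s₀ * (s / s₀) := by field_simp
    _ ≤ _ := by gcongr

theorem norm_sub_sq_expand (x x₀ z : E N) :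
    ‖x - z‖ ^ 2 = ‖x₀ - z‖ ^ 2 + 2 * (inner ℂ (x₀ - z) (x - x₀)).re + ‖x - x₀‖ ^ 2 := by
  have := @norm_add_sq ℂ (E N) _ _ _ (x₀ - z) (x - x₀)
  rwa [sub_add_sub_cancel'] at this

/-- Sibony-type estimate: holomorphic discs move by at most the square root of the size of a
negative strictly plurisubharmonic function. -/
theorem disc_norm_sq_le {Ω : Set (E N)} {ψ : E N → ℝ} {c d : ℝ} (hc : 0 < c) (hd : 0 < d)
    (hψ : StrictPshOn Ω ψ c) (hψc : ContinuousOn ψ Ω) (hneg : ∀ x ∈ Ω, ψ x ≤ 0)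
    {φ : ℂ → E N} (hφ : DifferentiableOn ℂ φ (ball 0 1)) (hmaps : MapsTo φ (ball (0 : ℂ) 1) Ω)
    {a : ℂ} (ha : ‖a‖ ≤ 1 / 4) (hx : -d ≤ ψ (φ 0)) :
    ‖φ a - φ 0‖ ^ 2 ≤ 16 * Real.exp (1 / c) * ‖a‖ ^ 2 * (d + ‖φ a - φ 0‖ ^ 2) := by
  set z := φ a with hz
  have haball : a ∈ ball (0 : ℂ) 1 := by
    rw [mem_ball_zero_iff]; linarith
  have hg : DifferentiableOn ℂ (dslope φ a) (ball 0 1) :=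
    (Complex.differentiableOn_dslope (isOpen_ball.mem_nhds haball)).2 hφ
  have hgz : ∀ ζ, ‖φ ζ - z‖ = ‖ζ - a‖ * ‖dslope φ a ζ‖ := fun ζ => by
    rw [hz, ← sub_smul_dslope φ a ζ, norm_smul]
  set H : ℂ → ℝ := fun ζ =>
    ‖dslope φ a ζ‖ ^ 2 * (d + ‖φ ζ - z‖ ^ 2)⁻¹ * Real.exp (ψ (φ ζ) / (c * d)) with hH
  have hsub : closedBall (0 : ℂ) (1 / 2) ⊆ ball 0 1 := closedBall_subset_ball (by norm_num)
  have hpos : ∀ ζ, 0 < d + ‖φ ζ - z‖ ^ 2 := fun ζ => by positivity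
  have key : H 0 ≤ 16 := by
    refine le_of_le_on_sphere_of_holomorphic_minorant (r := 1 / 2) (by norm_num) (by norm_num)
      ?_ ?_ ?_
    · have h1 : ContinuousOn φ (closedBall (0 : ℂ) (1 / 2)) := hφ.continuousOn.mono hsub
      have h2 : ContinuousOn (dslope φ a) (closedBall (0 : ℂ) (1 / 2)) := hg.continuousOn.mono hsub
      have h3 : ContinuousOn (fun ζ => ψ (φ ζ)) (closedBall (0 : ℂ) (1 / 2)) :=
        hψc.comp h1 (hmaps.mono_left hsub)
      refine ((h2.norm.pow 2).mul (ContinuousOn.inv₀ ?_ fun ζ _ => (hpos ζ).ne')).mul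
        (Real.continuous_exp.comp_continuousOn (h3.div_const _))
      exact continuousOn_const.add ((h1.sub continuousOn_const).norm.pow 2)
    · intro ζ₀ hζ₀ hH0
      have hζ₀' : ζ₀ ∈ ball (0 : ℂ) 1 := ball_subset_ball (by norm_num) hζ₀
      set g₀ := dslope φ a ζ₀ with hg₀
      have hg₀ne : g₀ ≠ 0 := by
        intro h0
        simp only [hH, ← hg₀, h0] at hH0
        simp at hH0
      obtain ⟨P, hPd, hP0, hP⟩ := hψ (φ ζ₀) (hmaps hζ₀')
      set s₀ := d + ‖φ ζ₀ - z‖ ^ 2 with hs₀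
      set u : E N := (‖g₀‖⁻¹ : ℂ) • g₀ with hu
      have hun : ‖u‖ = 1 := by
        rw [hu, norm_smul]; simp [hg₀ne]
      have huin : ‖inner ℂ u g₀‖ = ‖g₀‖ := by
        rw [hu, inner_smul_left, inner_self_eq_norm_sq_to_K]
        simp only [norm_mul, map_inv₀, norm_inv, norm_pow, RCLike.norm_conj, Complex.norm_real,
          Complex.coe_algebraMap, norm_norm]
        field_simp
      refine ⟨fun ζ => (inner ℂ u (dslope φ a ζ)) ^ 2 * (s₀⁻¹ : ℝ) *
        Complex.exp (-(2 * inner ℂ (φ ζ₀ - z) (φ ζ - φ ζ₀) / s₀)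
          + (ψ (φ ζ₀) + P (φ ζ)) / (c * d)), ?_, ?_, ?_⟩
      · filter_upwards [isOpen_ball.mem_nhds hζ₀'] with ζ hζ
        have h1 : DifferentiableAt ℂ φ ζ := hφ.differentiableAt (isOpen_ball.mem_nhds hζ)
        have h2 : DifferentiableAt ℂ (dslope φ a) ζ :=
          hg.differentiableAt (isOpen_ball.mem_nhds hζ)
        have h3 : ∀ (w : E N) (f : ℂ → E N), DifferentiableAt ℂ f ζ →
            DifferentiableAt ℂ (fun ζ => inner ℂ w (f ζ)) ζ := fun w f hf =>
          ((innerSL ℂ w).differentiableAt (x := f ζ)).comp ζ hf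
        have h4 := h3 u _ h2
        have h5 := h3 (φ ζ₀ - z) (fun ζ => φ ζ - φ ζ₀) (h1.sub_const _)
        have h6 : DifferentiableAt ℂ (fun ζ => P (φ ζ)) ζ := (hPd (φ ζ)).comp ζ h1
        fun_prop
      · simp only [hH, norm_mul, norm_pow, ← hg₀, huin, Complex.norm_exp, hP0, sub_self,
          inner_zero_right, mul_zero, zero_div, neg_zero, zero_add, add_zero, Complex.norm_real,
          ← hs₀]
        rw [Real.norm_of_nonneg (inv_pos.2 (hpos ζ₀)).le]
        congr 2
        rw [← Complex.ofReal_mul, ← Complex.ofReal_div, Complex.ofReal_re]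
      · have hcont : ContinuousAt φ ζ₀ :=
          (hφ.differentiableAt (isOpen_ball.mem_nhds hζ₀')).continuousAt
        filter_upwards [hcont.eventually hP] with ζ hζ
        have e1 : ‖inner ℂ u (dslope φ a ζ)‖ ^ 2 ≤ ‖dslope φ a ζ‖ ^ 2 := by
          gcongr
          calc _ ≤ ‖u‖ * ‖dslope φ a ζ‖ := norm_inner_le_norm _ _
            _ = _ := by rw [hun, one_mul]
        have e2 := inv_ge_mul_exp (hpos ζ) (hpos ζ₀)
        simp only [hH, norm_mul, norm_pow, Complex.norm_real]
        rw [Real.norm_of_nonneg (inv_pos.2 (hpos ζ₀)).le, Complex.norm_exp]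
        set A : ℝ := (inner ℂ (φ ζ₀ - z) (φ ζ - φ ζ₀) : ℂ).re with hA
        have e3 : (-(2 * inner ℂ (φ ζ₀ - z) (φ ζ - φ ζ₀) / (s₀ : ℂ))
          + (ψ (φ ζ₀) + P (φ ζ)) / (c * d) : ℂ).re =
            -(2 * A / s₀) + (ψ (φ ζ₀) + (P (φ ζ)).re) / (c * d) := by
          rw [← Complex.ofReal_mul c d, Complex.add_re, Complex.neg_re, Complex.div_ofReal_re,
            Complex.div_ofReal_re, Complex.add_re, Complex.ofReal_re]
          simp [hA]
        rw [e3]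
        have e4 : s₀⁻¹ * Real.exp (-(2 * A / s₀) + (ψ (φ ζ₀) + (P (φ ζ)).re) / (c * d)) ≤
            (d + ‖φ ζ - z‖ ^ 2)⁻¹ * Real.exp (ψ (φ ζ) / (c * d)) := by
          set q := ‖φ ζ - φ ζ₀‖ ^ 2 with hq
          have hq0 : 0 ≤ q := by positivity
          have e5 : (d + ‖φ ζ - z‖ ^ 2) - s₀ = 2 * A + q := by
            rw [norm_sub_sq_expand (φ ζ) (φ ζ₀) z, hs₀]; ring
          rw [e5] at e2
          have e6 : (ψ (φ ζ₀) + (P (φ ζ)).re) / (c * d) + q / d ≤ ψ (φ ζ) / (c * d) := by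
            rw [show q / d = (c * q) / (c * d) by field_simp, ← add_div]
            gcongr
          have e7 : q / s₀ ≤ q / d := by
            gcongr
            rw [hs₀]; nlinarith [sq_nonneg ‖φ ζ₀ - z‖]
          calc s₀⁻¹ * Real.exp (-(2 * A / s₀) + (ψ (φ ζ₀) + (P (φ ζ)).re) / (c * d))
              ≤ s₀⁻¹ * Real.exp (-((2 * A + q) / s₀) + ψ (φ ζ) / (c * d)) := by
                have : 0 < s₀ := hpos ζ₀
                refine mul_le_mul_of_nonneg_left (Real.exp_le_exp.2 ?_) (by positivity)
                rw [add_div (2 * A)]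
                linarith
            _ = s₀⁻¹ * Real.exp (-((2 * A + q) / s₀)) * Real.exp (ψ (φ ζ) / (c * d)) := by
                rw [Real.exp_add]; ring
            _ ≤ _ := by gcongr
        have : 0 < s₀ := hpos ζ₀
        calc _ = ‖inner ℂ u (dslope φ a ζ)‖ ^ 2 * (s₀⁻¹ *
              Real.exp (-(2 * A / s₀) + (ψ (φ ζ₀) + (P (φ ζ)).re) / (c * d))) := by ring
          _ ≤ ‖dslope φ a ζ‖ ^ 2 * ((d + ‖φ ζ - z‖ ^ 2)⁻¹ * Real.exp (ψ (φ ζ) / (c * d))) := by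
            gcongr
          _ = _ := by ring
    · intro ζ hζ
      have hζn : ‖ζ‖ = 1 / 2 := by simpa using hζ
      have h1 : 1 / 4 ≤ ‖ζ - a‖ := by
        have := norm_sub_norm_le ζ a
        linarith
      have h2 : ‖dslope φ a ζ‖ ^ 2 ≤ 16 * ‖φ ζ - z‖ ^ 2 := by
        rw [hgz ζ]
        have : ‖dslope φ a ζ‖ ≤ 4 * (‖ζ - a‖ * ‖dslope φ a ζ‖) := by
          nlinarith [norm_nonneg (dslope φ a ζ)]
        calc _ ≤ (4 * (‖ζ - a‖ * ‖dslope φ a ζ‖)) ^ 2 := by gcongr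
          _ = _ := by ring
      have h3 : Real.exp (ψ (φ ζ) / (c * d)) ≤ 1 := by
        rw [Real.exp_le_one_iff]
        exact div_nonpos_of_nonpos_of_nonneg
          (hneg _ (hmaps (hsub (sphere_subset_closedBall hζ)))) (by positivity)
      have h4 : ‖dslope φ a ζ‖ ^ 2 * (d + ‖φ ζ - z‖ ^ 2)⁻¹ ≤ 16 := by
        rw [← div_eq_mul_inv, div_le_iff₀ (hpos ζ)]
        linarith
      calc H ζ ≤ 16 * 1 := by
            simp only [hH]
            gcongr
        _ = 16 := by norm_num
  have h0 : ‖z - φ 0‖ = ‖a‖ * ‖dslope φ a 0‖ := by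
    rw [norm_sub_rev, hgz 0]; simp
  have hexp : Real.exp (-(1 / c)) ≤ Real.exp (ψ (φ 0) / (c * d)) := by
    apply Real.exp_le_exp.2
    rw [show -(1 / c) = -d / (c * d) by field_simp]
    gcongr
  have key2 : ‖dslope φ a 0‖ ^ 2 * Real.exp (-(1 / c)) ≤ 16 * (d + ‖z - φ 0‖ ^ 2) := by
    have h5 : ‖dslope φ a 0‖ ^ 2 * (d + ‖φ 0 - z‖ ^ 2)⁻¹ * Real.exp (-(1 / c)) ≤ 16 := by
      refine le_trans ?_ key
      simp only [hH]
      have := hpos 0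
      gcongr
    have h6 := mul_le_mul_of_nonneg_right h5 (hpos 0).le
    rw [norm_sub_rev z]
    calc _ = ‖dslope φ a 0‖ ^ 2 * (d + ‖φ 0 - z‖ ^ 2)⁻¹ * Real.exp (-(1 / c))
          * (d + ‖φ 0 - z‖ ^ 2) := by
          field_simp [(hpos 0).ne']
      _ ≤ _ := h6
  calc ‖z - φ 0‖ ^ 2 = ‖a‖ ^ 2 * Real.exp (1 / c)
        * (‖dslope φ a 0‖ ^ 2 * Real.exp (-(1 / c))) := by
        rw [h0, Real.exp_neg]
        field_simp
    _ ≤ ‖a‖ ^ 2 * Real.exp (1 / c) * (16 * (d + ‖z - φ 0‖ ^ 2)) := by gcongr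
    _ = _ := by ring

/-- Quantitative control of a domain `Ω = {d > 0}`: `ℓ x` is (minus) the complex differential of `d`
at `x`, and `ψ` is a negative strictly plurisubharmonic function bounded below by `-d`. -/
structure Controlled (Ω : Set (E N)) (d : E N → ℝ) (ℓ : E N → E N →L[ℂ] ℂ) (ψ : E N → ℝ)
    (C r c d₀ g₀ : ℝ) : Prop where
  one_le : 1 ≤ C
  r_pos : 0 < r
  c_pos : 0 < c
  d₀_pos : 0 < d₀
  g₀_pos : 0 < g₀
  isOpen : IsOpen Ω
  isConnected : IsConnected Ω
  d_pos : ∀ x ∈ Ω, 0 < d x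
  d_le : ∀ x ∈ Ω, d x ≤ C
  mem_of_lt : ∀ x ∈ Ω, ∀ y, ‖y - x‖ ≤ r → C * ‖y - x‖ ^ 2 < d x - (ℓ x (y - x)).re → y ∈ Ω
  taylor : ∀ x ∈ Ω, ∀ y ∈ Ω, |d y - d x + (ℓ x (y - x)).re| ≤ C * ‖y - x‖ ^ 2
  lipschitz : ∀ x ∈ Ω, ∀ y ∈ Ω, ‖ℓ x - ℓ y‖ ≤ C * ‖x - y‖
  norm_le : ∀ x ∈ Ω, ‖ℓ x‖ ≤ C
  le_norm : ∀ x ∈ Ω, d x ≤ d₀ → g₀ ≤ ‖ℓ x‖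
  isCompact_level : ∀ ε, 0 < ε → IsCompact {x | x ∈ Ω ∧ ε ≤ d x}
  psh : StrictPshOn Ω ψ c
  psh_continuousOn : ContinuousOn ψ Ω
  psh_nonpos : ∀ x ∈ Ω, ψ x ≤ 0
  neg_le_psh : ∀ x ∈ Ω, -d x ≤ ψ x

variable {Ω : Set (E N)} {d : E N → ℝ} {ℓ : E N → E N →L[ℂ] ℂ} {ψ : E N → ℝ} {C r c d₀ g₀ : ℝ}

/-- Small parts of holomorphic discs move at most `√d` in all directions and at most `d` in
the complex normal direction. -/
theorem Controlled.disc_estimates (h : Controlled Ω d ℓ ψ C r c d₀ g₀) :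
    ∃ a₁ K : ℝ, 0 < a₁ ∧ a₁ ≤ 1 ∧ 1 ≤ K ∧ ∀ φ : ℂ → E N, DifferentiableOn ℂ φ (ball 0 1) →
      MapsTo φ (ball (0 : ℂ) 1) Ω → ∀ a : ℂ, ‖a‖ ≤ a₁ →
      ‖φ a - φ 0‖ ^ 2 ≤ K * ‖a‖ ^ 2 * d (φ 0) ∧ ‖ℓ (φ 0) (φ a - φ 0)‖ ≤ K * ‖a‖ * d (φ 0) := by
  set e := Real.exp (1 / c) with he
  have hc := h.c_pos
  have hC := h.one_le
  have he1 : 1 ≤ e := Real.one_le_exp (by positivity)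
  set a₀ := 1 / (8 * e) with ha₀
  have ha₀pos : 0 < a₀ := by positivity
  have ha₀e : a₀ * e = 1 / 8 := by rw [ha₀]; field_simp
  have ha₀le : a₀ ≤ 1 / 8 := by nlinarith
  refine ⟨a₀ / 2, 32 * e * (1 + C), by positivity, by linarith, by nlinarith, ?_⟩
  intro φ hφ hmaps
  have h0 : φ 0 ∈ Ω := hmaps (by simp)
  have hd := h.d_pos _ h0
  have key : ∀ a : ℂ, ‖a‖ ≤ a₀ → ‖φ a - φ 0‖ ^ 2 ≤ 32 * e * ‖a‖ ^ 2 * d (φ 0) := by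
    intro a ha
    have := disc_norm_sq_le hc hd h.psh h.psh_continuousOn h.psh_nonpos hφ hmaps
      (a := a) (by linarith) (h.neg_le_psh _ h0)
    rw [← he] at this
    have h1 : 16 * e * ‖a‖ ^ 2 ≤ 1 / 2 := by
      have : ‖a‖ ^ 2 ≤ a₀ ^ 2 := by gcongr
      nlinarith
    nlinarith [sq_nonneg ‖φ a - φ 0‖]
  intro a ha
  have haa : ‖a‖ < a₀ := by linarith
  refine ⟨(key a haa.le).trans ?_, ?_⟩
  · have : 0 ≤ 32 * e * ‖a‖ ^ 2 * d (φ 0) := by positivity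
    nlinarith
  · have hsub : ball (0 : ℂ) a₀ ⊆ ball 0 1 := ball_subset_ball (by linarith)
    have hM : 0 < (1 + C) * d (φ 0) := by positivity
    have hB := Complex.borelCaratheodory_zero (f := fun ζ => ℓ (φ 0) (φ ζ - φ 0)) (R := a₀)
      (z := a) hM
      ((ℓ (φ 0)).differentiable.comp_differentiableOn ((hφ.mono hsub).sub_const _)) ?_ ha₀pos
      (by simpa using haa) (by simp)
    · refine hB.trans ?_
      rw [div_le_iff₀ (by linarith)]
      have h2 : a₀ / 2 ≤ a₀ - ‖a‖ := by linarith
      calc 2 * ((1 + C) * d (φ 0)) * ‖a‖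
          = 32 * e * (1 + C) * ‖a‖ * d (φ 0) * (a₀ / 2) := by
            linear_combination (-(16 * (1 + C) * d (φ 0) * ‖a‖)) * ha₀e
        _ ≤ _ := by gcongr
    · intro ζ hζ
      have hζn : ‖ζ‖ < a₀ := by simpa using hζ
      have h3 := key ζ hζn.le
      have h4 : 32 * e * ‖ζ‖ ^ 2 ≤ 1 := by
        have : ‖ζ‖ ^ 2 ≤ a₀ ^ 2 := by gcongr
        nlinarith
      have h5 : ‖φ ζ - φ 0‖ ^ 2 ≤ d (φ 0) := by nlinarith
      have h6 := (abs_le.1 (h.taylor _ h0 _ (hmaps (hsub hζ)))).2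
      have h7 := h.d_pos _ (hmaps (hsub hζ))
      change (ℓ (φ 0) (φ ζ - φ 0)).re ≤ (1 + C) * d (φ 0)
      nlinarith

/-- The polynomial curve with complex parameter extending the `n`-th Bernstein approximation. -/
def bernsteinCurve (n : ℕ) (f : C(unitInterval, E N)) (ζ : ℂ) : E N :=
  ∑ k : Fin (n + 1), ((n.choose k : ℂ) * ζ ^ (k : ℕ) * (1 - ζ) ^ (n - k)) •
    f (bernstein.z k)

theorem differentiable_bernsteinCurve (n : ℕ) (f : C(unitInterval, E N)) :
    Differentiable ℂ (bernsteinCurve n f) := by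
  unfold bernsteinCurve
  fun_prop

theorem bernsteinCurve_ofReal (n : ℕ) (f : C(unitInterval, E N)) (t : unitInterval) :
    bernsteinCurve n f ((t : ℝ) : ℂ) = bernsteinApproximation n f t := by
  rw [bernsteinApproximation.apply, bernsteinCurve]
  refine Finset.sum_congr rfl fun k _ => ?_
  rw [bernstein_apply]
  ext i
  simp

theorem exists_strip_sin_sq (δ : ℝ) (hδ : 0 < δ) : ∃ η : ℝ, 0 < η ∧ ∀ w : ℂ, |w.im| < η →
    ∃ t : unitInterval, ‖Complex.sin w ^ 2 - ((t : ℝ) : ℂ)‖ < δ := by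
  have hcont : Continuous fun y : ℝ => |Real.cosh (2 * y) - 1| + |Real.sinh (2 * y)| := by
    fun_prop
  have h0 : ∀ᶠ y in 𝓝 (0 : ℝ), |Real.cosh (2 * y) - 1| + |Real.sinh (2 * y)| < δ :=
    hcont.continuousAt.eventually (gt_mem_nhds (by simpa using hδ))
  obtain ⟨η, hη, hball⟩ := Metric.eventually_nhds_iff.1 h0
  refine ⟨η, hη, fun w hw => ⟨⟨Real.sin w.re ^ 2, sq_nonneg _, Real.sin_sq_le_one _⟩, ?_⟩⟩
  have h1 := @hball w.im (by simpa using hw)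
  have h2 : Complex.sin w ^ 2 - ((Real.sin w.re ^ 2 : ℝ) : ℂ) =
      -(((Real.cos (2 * w.re) * (Real.cosh (2 * w.im) - 1) : ℝ) : ℂ) -
        ((Real.sin (2 * w.re) * Real.sinh (2 * w.im) : ℝ) : ℂ) * Complex.I) / 2 := by
    have h3 : Complex.cos (2 * w) = Complex.cos (2 * w.re) * Complex.cosh (2 * w.im) -
        Complex.sin (2 * w.re) * Complex.sinh (2 * w.im) * Complex.I := by
      rw [← Complex.cos_add_mul_I]
      congr 1
      conv_lhs => rw [← Complex.re_add_im w]
      ring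
    have h4 : Complex.sin w ^ 2 = (1 - Complex.cos (2 * w)) / 2 := by
      rw [Complex.cos_two_mul, Complex.sin_sq]; ring
    have h5 : Complex.sin w.re ^ 2 = (1 - Complex.cos (2 * w.re)) / 2 := by
      rw [Complex.cos_two_mul, Complex.sin_sq]; ring
    push_cast
    rw [h4, h5, h3]
    ring
  change ‖Complex.sin w ^ 2 - ((Real.sin w.re ^ 2 : ℝ) : ℂ)‖ < δ
  rw [h2, norm_div, norm_neg]
  have h6 : ‖(((Real.cos (2 * w.re) * (Real.cosh (2 * w.im) - 1) : ℝ) : ℂ) -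
        ((Real.sin (2 * w.re) * Real.sinh (2 * w.im) : ℝ) : ℂ) * Complex.I)‖ ≤
      |Real.cosh (2 * w.im) - 1| + |Real.sinh (2 * w.im)| := by
    refine (norm_sub_le _ _).trans ?_
    rw [norm_mul, Complex.norm_I, mul_one, Complex.norm_real, Complex.norm_real, Real.norm_eq_abs,
      Real.norm_eq_abs, abs_mul, abs_mul]
    have := Real.abs_cos_le_one (2 * w.re)
    have := Real.abs_sin_le_one (2 * w.re)
    gcongr
    · exact mul_le_of_le_one_left (abs_nonneg _) (by assumption)
    · exact mul_le_of_le_one_left (abs_nonneg _) (by assumption)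
  have h7 : ‖(2 : ℂ)‖ = 2 := by simp
  rw [h7]
  have := norm_nonneg (((Real.cos (2 * w.re) * (Real.cosh (2 * w.im) - 1) : ℝ) : ℂ) -
        ((Real.sin (2 * w.re) * Real.sinh (2 * w.im) : ℝ) : ℂ) * Complex.I)
  linarith

/-- Any two points of a domain lie on a holomorphic disc. -/
theorem exists_disc (hΩ : IsOpen Ω) (hc : IsConnected Ω) {x y : E N} (hx : x ∈ Ω) (hy : y ∈ Ω) :
    ∃ φ : ℂ → E N, DifferentiableOn ℂ φ (ball 0 1) ∧ MapsTo φ (ball (0 : ℂ) 1) Ω ∧ φ 0 = x ∧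
      ∃ a ∈ ball (0 : ℂ) 1, φ a = y := by
  have hpc : IsPathConnected Ω := (hΩ.isConnected_iff_isPathConnected).1 hc
  obtain ⟨p, hp⟩ := hpc.joinedIn x hx y hy
  let f : C(unitInterval, E N) := p.toContinuousMap
  have hK : IsCompact (range f) := isCompact_range f.continuous
  have hKΩ : range f ⊆ Ω := by rintro _ ⟨t, rfl⟩; exact hp t
  obtain ⟨ε, hε, hεΩ⟩ := hK.exists_thickening_subset_open hΩ hKΩ
  obtain ⟨n, hn0, hn⟩ : ∃ n : ℕ, n ≠ 0 ∧ dist (bernsteinApproximation n f) f < ε :=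
    ((eventually_ne_atTop 0).and
      ((bernsteinApproximation_uniform f).eventually (ball_mem_nhds f hε))).exists
  set Q := bernsteinCurve n f with hQ
  have hQd : Differentiable ℂ Q := differentiable_bernsteinCurve n f
  have hQ0 : Q 0 = x := by
    have := bernsteinCurve_ofReal n f 0
    simp only [Set.Icc.coe_zero, Complex.ofReal_zero] at this
    rw [hQ, this, bernsteinApproximation.apply_zero]
    exact p.source
  have hQ1 : Q 1 = y := by
    have := bernsteinCurve_ofReal n f 1
    simp only [Set.Icc.coe_one, Complex.ofReal_one] at this
    rw [hQ, this, bernsteinApproximation.apply_one hn0]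
    exact p.target
  have hV : IsOpen (Q ⁻¹' Ω) := hΩ.preimage hQd.continuous
  have hI : IsCompact (range fun t : unitInterval => ((t : ℝ) : ℂ)) :=
    isCompact_range (by fun_prop)
  have hIV : (range fun t : unitInterval => ((t : ℝ) : ℂ)) ⊆ Q ⁻¹' Ω := by
    rintro _ ⟨t, rfl⟩
    refine hεΩ (mem_thickening_iff.2 ⟨f t, ⟨t, rfl⟩, ?_⟩)
    rw [hQ, bernsteinCurve_ofReal]
    exact (ContinuousMap.dist_apply_le_dist t).trans_lt hn
  obtain ⟨δ, hδ, hδV⟩ := hI.exists_thickening_subset_open hV hIV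
  obtain ⟨η, hη, hstrip⟩ := exists_strip_sin_sq δ hδ
  set η' := η / 4 with hη'
  have hη'pos : 0 < η' := by positivity
  set L : ℂ → ℂ := fun ζ => Complex.log ((1 + ζ) / (1 - ζ)) with hL
  have hne : ∀ ζ ∈ ball (0 : ℂ) 1, 1 - ζ ≠ 0 := by
    intro ζ hζ h0
    rw [sub_eq_zero] at h0
    simp [← h0] at hζ
  have hre : ∀ ζ ∈ ball (0 : ℂ) 1, 0 < ((1 + ζ) / (1 - ζ)).re := by
    intro ζ hζ
    have h1 : ‖ζ‖ < 1 := by simpa using hζ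
    have h2 : 0 < Complex.normSq (1 - ζ) := Complex.normSq_pos.2 (hne ζ hζ)
    have h3 : ζ.re * ζ.re + ζ.im * ζ.im < 1 := by
      have := Complex.sq_norm ζ
      rw [Complex.normSq_apply] at this
      nlinarith [norm_nonneg ζ]
    rw [Complex.div_re, ← add_div]
    apply div_pos _ h2
    simp
    nlinarith
  have hLd : DifferentiableOn ℂ L (ball 0 1) := by
    intro ζ hζ
    have h1 := hne ζ hζ
    refine DifferentiableAt.differentiableWithinAt ?_
    refine DifferentiableAt.clog (DifferentiableAt.div (by fun_prop) (by fun_prop) h1) ?_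
    exact Complex.mem_slitPlane_iff.2 (Or.inl (hre ζ hζ))
  have hLim : ∀ ζ ∈ ball (0 : ℂ) 1, |((η' : ℂ) * L ζ).im| < η := by
    intro ζ hζ
    have h1 : |(L ζ).im| < Real.pi / 2 := by
      rw [hL, Complex.log_im]
      exact Complex.abs_arg_lt_pi_div_two_iff.2 (Or.inl (hre ζ hζ))
    rw [Complex.im_ofReal_mul, abs_mul, abs_of_pos hη'pos, hη']
    have := Real.pi_lt_four
    nlinarith [abs_nonneg (L ζ).im]
  refine ⟨fun ζ => Q (Complex.sin (η' * L ζ) ^ 2), ?_, ?_, ?_, ?_⟩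
  · exact hQd.comp_differentiableOn (((hLd.const_mul _).csin).pow 2)
  · intro ζ hζ
    obtain ⟨t, ht⟩ := hstrip _ (hLim ζ hζ)
    refine hδV (mem_thickening_iff.2 ⟨_, ⟨t, rfl⟩, ?_⟩)
    rw [dist_eq_norm]
    exact ht
  · simp [hL, hQ0]
  · set s := Real.pi / (2 * η') with hs
    set es := Real.exp s with hes
    have hes1 : 0 < es := Real.exp_pos s
    refine ⟨(((es - 1) / (es + 1) : ℝ) : ℂ), ?_, ?_⟩
    · rw [mem_ball_zero_iff, Complex.norm_real, Real.norm_eq_abs, abs_lt]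
      constructor
      · rw [lt_div_iff₀ (by positivity)]; linarith
      · rw [div_lt_one (by positivity)]; linarith
    · have h1 : L (((es - 1) / (es + 1) : ℝ) : ℂ) = (s : ℂ) := by
        have h2 : (1 + (((es - 1) / (es + 1) : ℝ) : ℂ)) / (1 - (((es - 1) / (es + 1) : ℝ) : ℂ)) =
            (es : ℂ) := by
          rw [← Complex.ofReal_one, ← Complex.ofReal_add, ← Complex.ofReal_sub,
            ← Complex.ofReal_div]
          congr 1
          field_simp
          ring
        simp only [hL]
        rw [h2, ← Complex.ofReal_log hes1.le, hes, Real.log_exp]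
      have h3 : (η' : ℂ) * (s : ℂ) = ((Real.pi / 2 : ℝ) : ℂ) := by
        rw [← Complex.ofReal_mul, hs]
        congr 1
        field_simp
      simp only
      rw [h1, h3, ← Complex.ofReal_sin, Real.sin_pi_div_two]
      simpa using hQ1

theorem artanh_le_artanh {x y : ℝ} (hx : -1 < x) (hxy : x ≤ y) (hy : y < 1) :
    artanh x ≤ artanh y := by
  unfold artanh
  have : (1 + x) / (1 - x) ≤ (1 + y) / (1 - y) := by
    rw [div_le_div_iff₀ (by linarith) (by linarith)]
    nlinarith
  have h2 : 0 < (1 + x) / (1 - x) := div_pos (by linarith) (by linarith)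
  linarith [Real.log_le_log h2 this]

theorem artanh_zero : artanh 0 = 0 := by simp [artanh]

theorem le_artanh {x : ℝ} (h0 : 0 ≤ x) (h1 : x < 1) : x ≤ artanh x := by
  unfold artanh
  have h2 : Real.exp (2 * x) ≤ (1 + x) / (1 - x) := by
    have h3 : Real.exp x * (1 - x) ≤ 1 := by
      have h4 := Real.one_sub_le_exp_neg x
      have h5 : Real.exp x * Real.exp (-x) = 1 := by rw [← Real.exp_add]; simp
      have h6 := Real.exp_pos x
      nlinarith
    have hmono : MonotoneOn (fun t : ℝ => (1 + t) - (1 - t) * Real.exp (2 * t)) (Icc 0 1) := by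
      have hd : ∀ t : ℝ, HasDerivAt (fun t : ℝ => (1 + t) - (1 - t) * Real.exp (2 * t))
          (1 - ((-1) * Real.exp (2 * t) + (1 - t) * (Real.exp (2 * t) * 2))) t := by
        intro t
        have e1 : HasDerivAt (fun t : ℝ => Real.exp (2 * t)) (Real.exp (2 * t) * 2) t := by
          simpa using ((hasDerivAt_id t).const_mul 2).exp
        have e2 : HasDerivAt (fun t : ℝ => 1 - t) (-1) t := by
          simpa using (hasDerivAt_id t).const_sub 1
        have e3 : HasDerivAt (fun t : ℝ => 1 + t) 1 t := by
          simpa using (hasDerivAt_id t).const_add 1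
        exact e3.sub (e2.mul e1)
      refine monotoneOn_of_deriv_nonneg (convex_Icc 0 1)
        (fun t _ => (hd t).continuousAt.continuousWithinAt)
        (fun t _ => (hd t).differentiableAt.differentiableWithinAt) fun t ht => ?_
      rw [(hd t).deriv]
      have h4 := Real.one_sub_le_exp_neg (2 * t)
      have h5 : Real.exp (2 * t) * Real.exp (-(2 * t)) = 1 := by rw [← Real.exp_add]; simp
      have h6 := Real.exp_pos (2 * t)
      nlinarith
    have := hmono ⟨le_rfl, zero_le_one⟩ ⟨h0, h1.le⟩ h0
    simp at this
    rw [le_div_iff₀ (by linarith)]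
    linarith
  have h3 := Real.log_le_log (Real.exp_pos _) h2
  rw [Real.log_exp] at h3
  linarith

/-- The parameters of holomorphic discs in `Ω` through `z` and `w`. -/
def discParams (Ω : Set (E N)) (z w : E N) : Set ℝ :=
  { r : ℝ | ∃ φ : ℂ → E N, DifferentiableOn ℂ φ (ball 0 1) ∧
    MapsTo φ (ball (0:ℂ) 1) Ω ∧ φ 0 = z ∧ ∃ a ∈ ball (0:ℂ) 1, φ a = w ∧ r = ‖a‖ }

theorem lempert_eq (Ω : Set (E N)) (z w : E N) : lempert Ω z w = artanh (sInf (discParams Ω z w)) :=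
  rfl

theorem discParams_bddBelow (Ω : Set (E N)) (z w : E N) : BddBelow (discParams Ω z w) := by
  refine ⟨0, ?_⟩
  rintro _ ⟨φ, -, -, -, a, -, -, rfl⟩
  exact norm_nonneg a

theorem sInf_discParams_nonneg (Ω : Set (E N)) (z w : E N) : 0 ≤ sInf (discParams Ω z w) := by
  apply Real.sInf_nonneg
  rintro _ ⟨φ, -, -, -, a, -, -, rfl⟩
  exact norm_nonneg a

theorem sInf_discParams_lt_one (Ω : Set (E N)) (z w : E N) : sInf (discParams Ω z w) < 1 := by
  rcases (discParams Ω z w).eq_empty_or_nonempty with h | ⟨r, hr⟩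
  · rw [h]; simp
  · refine (csInf_le (discParams_bddBelow Ω z w) hr).trans_lt ?_
    obtain ⟨φ, -, -, -, a, ha, -, rfl⟩ := hr
    simpa using ha

theorem lempert_nonneg (Ω : Set (E N)) (z w : E N) : 0 ≤ lempert Ω z w := by
  rw [lempert_eq, ← artanh_zero]
  exact artanh_le_artanh (by norm_num) (sInf_discParams_nonneg Ω z w) (sInf_discParams_lt_one Ω z w)

theorem lempert_le_artanh {φ : ℂ → E N} (hφ : DifferentiableOn ℂ φ (ball 0 1))
    (hmaps : MapsTo φ (ball (0:ℂ) 1) Ω) {a : ℂ} (ha : ‖a‖ < 1) :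
    lempert Ω (φ 0) (φ a) ≤ artanh ‖a‖ := by
  rw [lempert_eq]
  refine artanh_le_artanh (by linarith [sInf_discParams_nonneg Ω (φ 0) (φ a)])
    (csInf_le (discParams_bddBelow _ _ _) ?_) ha
  exact ⟨φ, hφ, hmaps, rfl, a, by simpa using ha, rfl, rfl⟩

theorem discParams_nonempty (hΩ : IsOpen Ω) (hc : IsConnected Ω) {x y : E N} (hx : x ∈ Ω)
    (hy : y ∈ Ω) : (discParams Ω x y).Nonempty := by
  obtain ⟨φ, h1, h2, h3, a, ha, h4⟩ := exists_disc hΩ hc hx hy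
  exact ⟨‖a‖, φ, h1, h2, h3, a, ha, h4, rfl⟩

theorem exists_disc_norm_lt (hΩ : IsOpen Ω) (hc : IsConnected Ω) {x y : E N} (hx : x ∈ Ω)
    (hy : y ∈ Ω) {t : ℝ} (ht : lempert Ω x y < t) :
    ∃ φ : ℂ → E N, DifferentiableOn ℂ φ (ball 0 1) ∧ MapsTo φ (ball (0 : ℂ) 1) Ω ∧ φ 0 = x ∧
      ∃ a, ‖a‖ < t ∧ φ a = y := by
  have h1 : sInf (discParams Ω x y) < t :=
    (le_artanh (sInf_discParams_nonneg Ω x y) (sInf_discParams_lt_one Ω x y)).trans_lt ht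
  obtain ⟨_, ⟨φ, h2, h3, h4, a, -, h5, rfl⟩, h6⟩ :=
    exists_lt_of_csInf_lt (discParams_nonempty hΩ hc hx hy) h1
  exact ⟨φ, h2, h3, h4, a, h6, h5⟩

theorem moebius_norm_lt_one {a ζ : ℂ} (ha : ‖a‖ < 1) (hζ : ‖ζ‖ < 1) :
    1 - (starRingEnd ℂ) a * ζ ≠ 0 ∧ ‖(a - ζ) / (1 - (starRingEnd ℂ) a * ζ)‖ < 1 := by
  have h0 : ‖(starRingEnd ℂ) a * ζ‖ < 1 := by
    rw [norm_mul, RCLike.norm_conj]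
    nlinarith [norm_nonneg a, norm_nonneg ζ]
  have h1 : 1 - (starRingEnd ℂ) a * ζ ≠ 0 := by
    intro h
    rw [sub_eq_zero] at h
    rw [← h] at h0
    simp at h0
  refine ⟨h1, ?_⟩
  rw [norm_div, div_lt_one (norm_pos_iff.2 h1)]
  refine lt_of_pow_lt_pow_left₀ 2 (norm_nonneg _) ?_
  have e : ∀ z : ℂ, ‖z‖ ^ 2 = z.re * z.re + z.im * z.im := fun z => by
    rw [Complex.sq_norm, Complex.normSq_apply]
  have h2 : ‖a‖ ^ 2 < 1 := by nlinarith [norm_nonneg a]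
  have h3 : ‖ζ‖ ^ 2 < 1 := by nlinarith [norm_nonneg ζ]
  have h4 : ‖1 - (starRingEnd ℂ) a * ζ‖ ^ 2 - ‖a - ζ‖ ^ 2 = (1 - ‖a‖ ^ 2) * (1 - ‖ζ‖ ^ 2) := by
    simp only [e]
    simp
    ring
  nlinarith

theorem lempert_comm (Ω : Set (E N)) (z w : E N) : lempert Ω z w = lempert Ω w z := by
  have key : ∀ z w : E N, discParams Ω z w ⊆ discParams Ω w z := by
    rintro z w _ ⟨φ, h1, h2, h3, a, ha, h4, rfl⟩
    have ha' : ‖a‖ < 1 := by simpa using ha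
    have hm : MapsTo (fun ζ => (a - ζ) / (1 - (starRingEnd ℂ) a * ζ)) (ball (0 : ℂ) 1)
        (ball 0 1) := fun ζ hζ => by
      simpa using (moebius_norm_lt_one ha' (by simpa using hζ)).2
    refine ⟨fun ζ => φ ((a - ζ) / (1 - (starRingEnd ℂ) a * ζ)), h1.comp ?_ hm, h2.comp hm, ?_, a, ha,
      ?_, rfl⟩
    · intro ζ hζ
      exact (DifferentiableAt.div (c := fun ζ => a - ζ)
        (d := fun ζ => 1 - (starRingEnd ℂ) a * ζ) (by fun_prop) (by fun_prop)
        (moebius_norm_lt_one ha' (by simpa using hζ)).1).differentiableWithinAt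
    · simpa using h4
    · simpa using h3
  rw [lempert_eq, lempert_eq, (key z w).antisymm (key w z)]

/-- The lengths of chains in `Ω` from `z` to `w`. -/
def chainLengths (Ω : Set (E N)) (z w : E N) : Set ℝ :=
  { r : ℝ | ∃ (n : ℕ) (p : Fin (n + 1) → E N), p 0 = z ∧ p (Fin.last n) = w ∧
    (∀ i, p i ∈ Ω) ∧ r = ∑ i : Fin n, lempert Ω (p i.castSucc) (p i.succ) }

theorem chainLengths_nonneg {z w : E N} {r : ℝ} (hr : r ∈ chainLengths Ω z w) : 0 ≤ r := by
  obtain ⟨n, p, -, -, -, rfl⟩ := hr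
  exact Finset.sum_nonneg fun i _ => lempert_nonneg _ _ _

theorem kobayashi_nonneg (Ω : Set (E N)) (z w : E N) : 0 ≤ kobayashi Ω z w :=
  Real.sInf_nonneg fun _ hr => chainLengths_nonneg (Ω := Ω) (z := z) (w := w) hr

theorem kobayashi_le_of_mem {z w : E N} {r : ℝ} (hr : r ∈ chainLengths Ω z w) :
    kobayashi Ω z w ≤ r :=
  csInf_le ⟨0, fun _ h => chainLengths_nonneg (Ω := Ω) (z := z) (w := w) h⟩ hr

theorem lempert_mem_chainLengths {z w : E N} (hz : z ∈ Ω) (hw : w ∈ Ω) :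
    lempert Ω z w ∈ chainLengths Ω z w := by
  refine ⟨1, ![z, w], rfl, rfl, fun i => ?_, by simp⟩
  fin_cases i
  · exact hz
  · exact hw

theorem kobayashi_le_lempert {z w : E N} (hz : z ∈ Ω) (hw : w ∈ Ω) :
    kobayashi Ω z w ≤ lempert Ω z w :=
  kobayashi_le_of_mem (lempert_mem_chainLengths hz hw)

theorem kobayashi_self {z : E N} (hz : z ∈ Ω) : kobayashi Ω z z = 0 :=
  le_antisymm (kobayashi_le_of_mem ⟨0, fun _ => z, rfl, rfl, fun _ => hz, by simp⟩)
    (kobayashi_nonneg _ _ _)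

theorem exists_chain_lt {z w : E N} (hz : z ∈ Ω) (hw : w ∈ Ω) {t : ℝ}
    (ht : kobayashi Ω z w < t) : ∃ r ∈ chainLengths Ω z w, r < t :=
  exists_lt_of_csInf_lt ⟨_, lempert_mem_chainLengths hz hw⟩ ht

theorem kobayashi_le_lempert_add {x y z : E N} (hx : x ∈ Ω) (hy : y ∈ Ω) (hz : z ∈ Ω) :
    kobayashi Ω x z ≤ lempert Ω x y + kobayashi Ω y z := by
  refine le_of_forall_pos_le_add fun ε hε => ?_
  obtain ⟨_, ⟨n, p, h1, h2, h3, rfl⟩, h⟩ := exists_chain_lt hy hz (lt_add_of_pos_right _ hε)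
  have : kobayashi Ω x z ≤ lempert Ω x y + ∑ i : Fin n, lempert Ω (p i.castSucc) (p i.succ) := by
    refine kobayashi_le_of_mem ⟨n + 1, Fin.cons x p, by simp, ?_, ?_, ?_⟩
    · rw [← Fin.succ_last, Fin.cons_succ, h2]
    · exact Fin.cases (by simpa using hx) (by simpa using h3)
    · rw [Fin.sum_univ_succ]
      congr 1
      simp [h1]
  linarith

theorem kobayashi_le_sum_add (n : ℕ) (p : Fin (n + 1) → E N) (hp : ∀ i, p i ∈ Ω) {z : E N}
    (hz : z ∈ Ω) : kobayashi Ω (p 0) z ≤ ∑ i : Fin n, lempert Ω (p i.castSucc) (p i.succ) +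
      kobayashi Ω (p (Fin.last n)) z := by
  induction n with
  | zero => simp
  | succ n ih =>
    have h1 := ih (fun i => p i.succ) fun i => hp _
    have h2 := kobayashi_le_lempert_add (hp 0) (hp (Fin.succ 0)) hz
    rw [Fin.sum_univ_succ]
    simp only [Fin.succ_last, Fin.castSucc_zero, Fin.succ_castSucc] at h1 h2 ⊢
    linarith

theorem kobayashi_triangle {x y z : E N} (hx : x ∈ Ω) (hy : y ∈ Ω) (hz : z ∈ Ω) :
    kobayashi Ω x z ≤ kobayashi Ω x y + kobayashi Ω y z := by
  refine le_of_forall_pos_le_add fun ε hε => ?_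
  obtain ⟨_, ⟨n, p, h1, h2, h3, rfl⟩, h⟩ := exists_chain_lt hx hy (lt_add_of_pos_right _ hε)
  have := kobayashi_le_sum_add n p h3 hz
  rw [h1, h2] at this
  linarith

theorem kobayashi_le_swap {x y : E N} (hx : x ∈ Ω) (hy : y ∈ Ω) :
    kobayashi Ω y x ≤ kobayashi Ω x y := by
  refine le_of_forall_pos_le_add fun ε hε => ?_
  obtain ⟨_, ⟨n, p, h1, h2, h3, rfl⟩, h⟩ := exists_chain_lt hx hy (lt_add_of_pos_right _ hε)
  refine le_trans (kobayashi_le_of_mem ⟨n, fun i => p i.rev, by simpa using h2, by simpa using h1,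
    fun i => h3 _, ?_⟩) h.le
  rw [← Equiv.sum_comp Fin.revPerm]
  refine Finset.sum_congr rfl fun i _ => ?_
  rw [lempert_comm]
  simp [Fin.rev_castSucc, Fin.rev_succ]

theorem kobayashi_comm {x y : E N} (hx : x ∈ Ω) (hy : y ∈ Ω) :
    kobayashi Ω x y = kobayashi Ω y x :=
  (kobayashi_le_swap hy hx).antisymm (kobayashi_le_swap hx hy)

theorem Controlled.lempert_estimates (h : Controlled Ω d ℓ ψ C r c d₀ g₀) :
    ∃ a₁ K : ℝ, 0 < a₁ ∧ a₁ ≤ 1 ∧ 1 ≤ K ∧ ∀ x ∈ Ω, ∀ y ∈ Ω, lempert Ω x y < a₁ →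
      ‖y - x‖ ^ 2 ≤ K * lempert Ω x y ^ 2 * d x ∧ ‖ℓ x (y - x)‖ ≤ K * lempert Ω x y * d x := by
  obtain ⟨a₁, K, h1, h2, h3, H⟩ := h.disc_estimates
  refine ⟨a₁, K, h1, h2, h3, fun x hx y hy hl => ?_⟩
  have hd := h.d_pos x hx
  have key : ∀ t ∈ Ioo (lempert Ω x y) a₁,
      ‖y - x‖ ^ 2 ≤ K * t ^ 2 * d x ∧ ‖ℓ x (y - x)‖ ≤ K * t * d x := by
    rintro t ⟨ht1, ht2⟩
    obtain ⟨φ, g1, g2, rfl, a, ha, rfl⟩ := exists_disc_norm_lt h.isOpen h.isConnected hx hy ht1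
    obtain ⟨k1, k2⟩ := H φ g1 g2 a (ha.le.trans ht2.le)
    constructor
    · refine k1.trans ?_
      gcongr
    · refine k2.trans ?_
      gcongr
  have hev : ∀ᶠ t in 𝓝[>] lempert Ω x y, t ∈ Ioo (lempert Ω x y) a₁ := Ioo_mem_nhdsGT hl
  constructor
  · refine ge_of_tendsto (x := 𝓝[>] lempert Ω x y) (f := fun t => K * t ^ 2 * d x) ?_
      (hev.mono fun t ht => (key t ht).1)
    exact (Continuous.tendsto (by fun_prop) _).mono_left nhdsWithin_le_nhds
  · refine ge_of_tendsto (x := 𝓝[>] lempert Ω x y) (f := fun t => K * t * d x) ?_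
      (hev.mono fun t ht => (key t ht).2)
    exact (Continuous.tendsto (by fun_prop) _).mono_left nhdsWithin_le_nhds

theorem Controlled.kobayashi_estimates (h : Controlled Ω d ℓ ψ C r c d₀ g₀) :
    ∃ a₁ B : ℝ, 0 < a₁ ∧ 1 ≤ B ∧ ∀ x ∈ Ω, ∀ y ∈ Ω, kobayashi Ω x y < a₁ →
      ‖y - x‖ ≤ B * kobayashi Ω x y * √(d x) ∧ ‖ℓ x (y - x)‖ ≤ B * kobayashi Ω x y * d x := by
  obtain ⟨a₁, K, h1, h2, h3, H⟩ := h.lempert_estimates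
  have hC := h.one_le
  set C' := K * (1 + C) with hC'
  have hC'pos : 0 ≤ C' := by positivity
  set M := Real.exp C' with hM
  have hM1 : 1 ≤ M := Real.one_le_exp hC'pos
  have hM0 : 0 < M := by linarith
  set B := K * M * (1 + C) with hB
  have hKM : 1 ≤ K * M := one_le_mul_of_one_le_of_one_le h3 hM1
  have hB1 : 1 ≤ B := one_le_mul_of_one_le_of_one_le hKM (by linarith)
  have chain : ∀ (n : ℕ) (p : Fin (n + 1) → E N), (∀ i, p i ∈ Ω) →
      ∑ i : Fin n, lempert Ω (p i.castSucc) (p i.succ) < a₁ →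
      d (p (Fin.last n)) ≤
        d (p 0) * Real.exp (C' * ∑ i : Fin n, lempert Ω (p i.castSucc) (p i.succ)) ∧
      ‖p (Fin.last n) - p 0‖ ≤
        K * M * √(d (p 0)) * ∑ i : Fin n, lempert Ω (p i.castSucc) (p i.succ) ∧
      ‖ℓ (p 0) (p (Fin.last n) - p 0)‖ ≤
        K * M * (1 + C * (K * M)) * d (p 0) *
          ∑ i : Fin n, lempert Ω (p i.castSucc) (p i.succ) := by
    intro n
    induction n with
    | zero => intro p hp _; simp
    | succ n ih =>
      intro p hp hs
      rw [Fin.sum_univ_castSucc] at hs ⊢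
      have ih' := ih (fun i => p i.castSucc) fun i => hp _
      simp only [Fin.castSucc_zero, Fin.succ_last, Fin.succ_castSucc] at ih' hs ⊢
      set σ := ∑ i : Fin n, lempert Ω (p i.castSucc.castSucc) (p i.succ.castSucc) with hσ
      set q := p (Fin.last n).castSucc with hq
      set y := p (Fin.last (n + 1)) with hy
      set x := p 0 with hx
      set l := lempert Ω q y with hl
      have hl0 : 0 ≤ l := lempert_nonneg _ _ _
      have hσ0 : 0 ≤ σ := Finset.sum_nonneg fun i _ => lempert_nonneg _ _ _
      obtain ⟨i1, i2, i3⟩ := ih' (by linarith)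
      obtain ⟨j1, j2⟩ := H q (hp _) y (hp _) (by linarith)
      have hdx := h.d_pos x (hp _)
      have hdq := h.d_pos q (hp _)
      have hdy := h.d_pos y (hp _)
      have hdq' : d q ≤ M * d x := by
        have : Real.exp (C' * σ) ≤ M := Real.exp_le_exp.2 (by nlinarith)
        nlinarith
      have hstep : ‖y - q‖ ≤ K * M * √(d x) * l := by
        refine le_of_sq_le_sq ?_ (by positivity)
        have e1 : (K * M * √(d x) * l) ^ 2 = K * M * (K * M) * l ^ 2 * d x := by
          rw [mul_pow, mul_pow, Real.sq_sqrt hdx.le]; ring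
        rw [e1]
        refine j1.trans ?_
        calc K * l ^ 2 * d q ≤ K * l ^ 2 * (M * d x) := by gcongr
          _ = 1 * (K * M * l ^ 2 * d x) := by ring
          _ ≤ (K * M) * (K * M * l ^ 2 * d x) := by gcongr
          _ = _ := by ring
      have h2' : ‖y - x‖ ≤ K * M * √(d x) * (σ + l) := by
        have : y - x = (q - x) + (y - q) := by abel
        rw [this]
        refine (norm_add_le _ _).trans ?_
        linarith
      refine ⟨?_, h2', ?_⟩
      · have ht := (abs_le.1 (h.taylor q (hp _) y (hp _))).2
        have hre : -(ℓ q (y - q)).re ≤ ‖ℓ q (y - q)‖ :=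
          (neg_le_abs _).trans (Complex.abs_re_le_norm _)
        have hll : l ^ 2 ≤ l := by nlinarith
        have : d y ≤ d q * (1 + C' * l) := by
          have e6 : C * ‖y - q‖ ^ 2 ≤ C * (K * l * d q) := by
            gcongr
            refine j1.trans ?_
            gcongr
          have e7 : d q * (1 + C' * l) = d q + K * l * d q + C * (K * l * d q) := by
            rw [hC']; ring
          rw [e7]
          linarith
        calc d y ≤ d q * (1 + C' * l) := this
          _ ≤ (d x * Real.exp (C' * σ)) * Real.exp (C' * l) := by
            gcongr
            linarith [Real.add_one_le_exp (C' * l)]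
          _ = _ := by rw [mul_add, Real.exp_add]; ring
      · have e1 : ℓ x (y - x) = ℓ x (q - x) + (ℓ q (y - q) + (ℓ x - ℓ q) (y - q)) := by
          simp only [map_sub, _root_.sub_apply]; ring
        have e2 : ‖(ℓ x - ℓ q) (y - q)‖ ≤ C * (K * M * √(d x)) * (K * M * √(d x) * l) := by
          refine ((ℓ x - ℓ q).le_opNorm _).trans ?_
          gcongr
          refine (h.lipschitz x (hp _) q (hp _)).trans ?_
          gcongr
          rw [norm_sub_rev]
          refine i2.trans ?_
          refine mul_le_of_le_one_right (by positivity) (by linarith)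
        have e3 : ‖ℓ q (y - q)‖ ≤ K * l * (M * d x) := j2.trans (by gcongr)
        have e4 : C * (K * M * √(d x)) * (K * M * √(d x) * l) = C * (K * M) * (K * M) * l * d x := by
          have := Real.mul_self_sqrt hdx.le
          linear_combination (C * (K * M) * (K * M) * l) * this
        rw [e1]
        refine (norm_add_le _ _).trans ?_
        have := norm_add_le (ℓ q (y - q)) ((ℓ x - ℓ q) (y - q))
        rw [e4] at e2
        have e5 : K * M * (1 + C * (K * M)) * d x * (σ + l) = K * M * (1 + C * (K * M)) * d x * σ +
          (K * l * (M * d x) + C * (K * M) * (K * M) * l * d x) := by ring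
        rw [e5]
        linarith
  refine ⟨a₁, K * M * (1 + C * (K * M)), h1, ?_, fun x hx y hy hk => ?_⟩
  · have : 0 ≤ C * (K * M) := by positivity
    nlinarith
  have hd := h.d_pos x hx
  have hCKM : 0 ≤ C * (K * M) := by positivity
  have key : ∀ t ∈ Ioo (kobayashi Ω x y) a₁,
      ‖y - x‖ ≤ K * M * (1 + C * (K * M)) * t * √(d x) ∧
        ‖ℓ x (y - x)‖ ≤ K * M * (1 + C * (K * M)) * t * d x := by
    rintro t ⟨ht1, ht2⟩
    obtain ⟨_, ⟨n, p, rfl, rfl, hp, rfl⟩, hlt⟩ := exists_chain_lt hx hy ht1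
    obtain ⟨-, k1, k2⟩ := chain n p hp (hlt.trans ht2)
    have ht0 : 0 ≤ t := (kobayashi_nonneg _ _ _).trans ht1.le
    constructor
    · refine k1.trans ?_
      calc K * M * √(d (p 0)) * ∑ i : Fin n, lempert Ω (p i.castSucc) (p i.succ)
          ≤ K * M * √(d (p 0)) * t := by gcongr
        _ = K * M * 1 * t * √(d (p 0)) := by ring
        _ ≤ _ := by gcongr; linarith
    · refine k2.trans ?_
      calc _ ≤ K * M * (1 + C * (K * M)) * d (p 0) * t := by gcongr
        _ = _ := by ring
  have hev : ∀ᶠ t in 𝓝[>] kobayashi Ω x y, t ∈ Ioo (kobayashi Ω x y) a₁ := Ioo_mem_nhdsGT hk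
  constructor
  · refine ge_of_tendsto (x := 𝓝[>] kobayashi Ω x y)
      (f := fun t => K * M * (1 + C * (K * M)) * t * √(d x)) ?_ (hev.mono fun t ht => (key t ht).1)
    exact (Continuous.tendsto (by fun_prop) _).mono_left nhdsWithin_le_nhds
  · refine ge_of_tendsto (x := 𝓝[>] kobayashi Ω x y)
      (f := fun t => K * M * (1 + C * (K * M)) * t * d x) ?_ (hev.mono fun t ht => (key t ht).2)
    exact (Continuous.tendsto (by fun_prop) _).mono_left nhdsWithin_le_nhds

theorem Controlled.kobayashi_le_one (h : Controlled Ω d ℓ ψ C r c d₀ g₀) :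
    ∃ ε₁ : ℝ, 0 < ε₁ ∧ ∀ x ∈ Ω, ∀ y, ‖y - x‖ ^ 2 ≤ ε₁ * d x → ‖ℓ x (y - x)‖ ≤ ε₁ * d x →
      y ∈ Ω ∧ kobayashi Ω x y ≤ 1 := by
  have hC := h.one_le
  have hr := h.r_pos
  set ε₁ := min (1 / (8 * C)) (r ^ 2 / (4 * C)) with hε₁
  have e1 : ε₁ * (8 * C) ≤ 1 := (le_div_iff₀ (by positivity)).1 (min_le_left _ _)
  have e2 : ε₁ * (4 * C) ≤ r ^ 2 := (le_div_iff₀ (by positivity)).1 (min_le_right _ _)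
  have hε₁pos : 0 < ε₁ := by rw [hε₁]; positivity
  refine ⟨ε₁, hε₁pos, fun x hx y h1 h2 => ?_⟩
  have hd := h.d_pos x hx
  have hmaps : MapsTo (fun ζ : ℂ => x + ζ • ((2 : ℂ) • (y - x))) (ball (0 : ℂ) 1) Ω := by
    intro ζ hζ
    have hζ1 : ‖ζ‖ < 1 := by simpa using hζ
    have n1 : ‖x + ζ • ((2 : ℂ) • (y - x)) - x‖ ≤ 2 * ‖y - x‖ := by
      rw [add_sub_cancel_left, norm_smul, norm_smul]
      simp only [Complex.norm_ofNat]
      nlinarith [norm_nonneg (y - x)]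
    have n2 : ‖x + ζ • ((2 : ℂ) • (y - x)) - x‖ ^ 2 ≤ 4 * (ε₁ * d x) := by
      calc _ ≤ (2 * ‖y - x‖) ^ 2 := by gcongr
        _ = 4 * ‖y - x‖ ^ 2 := by ring
        _ ≤ _ := by gcongr
    refine h.mem_of_lt x hx _ ?_ ?_
    · refine le_of_sq_le_sq (n2.trans ?_) hr.le
      have := h.d_le x hx
      nlinarith
    · have n3 : (ℓ x (x + ζ • ((2 : ℂ) • (y - x)) - x)).re ≤ 2 * (ε₁ * d x) := by
        refine (Complex.re_le_norm _).trans ?_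
        rw [add_sub_cancel_left, map_smul, map_smul, norm_smul, norm_smul]
        simp only [Complex.norm_ofNat]
        nlinarith [norm_nonneg (ℓ x (y - x))]
      have n4 : C * (4 * (ε₁ * d x)) + 2 * (ε₁ * d x) < d x := by
        have : ε₁ ≤ ε₁ * C := le_mul_of_one_le_right hε₁pos.le hC
        nlinarith
      have n5 := mul_le_mul_of_nonneg_left n2 (by linarith : 0 ≤ C)
      linarith
  have hhalf : x + (1 / 2 : ℂ) • ((2 : ℂ) • (y - x)) = y := by
    rw [smul_smul]; norm_num
  have hn : ‖(1 / 2 : ℂ)‖ = 1 / 2 := by norm_num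
  have hy : y ∈ Ω := by
    rw [← hhalf]
    exact hmaps (by rw [mem_ball_zero_iff, hn]; norm_num)
  refine ⟨hy, (kobayashi_le_lempert hx hy).trans ?_⟩
  have := lempert_le_artanh (φ := fun ζ : ℂ => x + ζ • ((2 : ℂ) • (y - x))) (Ω := Ω)
    (a := (1 / 2 : ℂ)) (by fun_prop) hmaps (by rw [hn]; norm_num)
  rw [hhalf, hn, zero_smul, add_zero] at this
  refine this.trans ?_
  unfold artanh
  have h3 : Real.log ((1 + 1 / 2) / (1 - 1 / 2)) ≤ (1 + 1 / 2) / (1 - 1 / 2) - 1 :=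
    Real.log_le_sub_one_of_pos (by norm_num)
  norm_num at h3 ⊢
  linarith

/-- The vector representing a continuous linear functional. -/
def repVec (f : E N →L[ℂ] ℂ) : E N := (InnerProductSpace.toDual ℂ (E N)).symm f

theorem norm_repVec (f : E N →L[ℂ] ℂ) : ‖repVec f‖ = ‖f‖ :=
  (InnerProductSpace.toDual ℂ (E N)).symm.norm_map f

theorem norm_repVec_sub (f g : E N →L[ℂ] ℂ) : ‖repVec f - repVec g‖ = ‖f - g‖ := by
  rw [repVec, repVec, ← map_sub]
  exact (InnerProductSpace.toDual ℂ (E N)).symm.norm_map _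

theorem apply_repVec (f : E N →L[ℂ] ℂ) : f (repVec f) = ((‖f‖ ^ 2 : ℝ) : ℂ) := by
  rw [← InnerProductSpace.toDual_symm_apply (𝕜 := ℂ) (E := E N)]
  rw [← norm_repVec f]
  have := inner_self_eq_norm_sq_to_K (𝕜 := ℂ) (repVec f)
  rw [repVec] at this ⊢
  rw [this]
  simp

theorem log_one_add_le_add {b u v : ℝ} (hb : 0 ≤ b) (hu : 0 ≤ u) (hv : 0 ≤ v) (h : u ≤ b * v) :
    Real.log (1 + u) ≤ Real.log (1 + b) + Real.log (1 + v) := by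
  rw [← Real.log_mul (by positivity) (by positivity)]
  exact Real.log_le_log (by positivity) (by nlinarith)

theorem normal_disc_bound {C t s D W p q : ℝ} (hC : 1 ≤ C) (ht : 0 ≤ t) (htC : t * (2 * C) ≤ 1)
    (hs : 0 < s) (hsD : s * (4 * C ^ 3) ≤ D) (hDC : D ≤ C) (hW : 0 ≤ W) (hWC : W ≤ C) (hp : p ≤ 1)
    (hq : q ≤ 1) :
    C * (((t + s) ^ 2 * q - 2 * t * ((t + s) * p) + t ^ 2) * W ^ 2) <
      D - ((t + s) * p - t) * W ^ 2 := by
  obtain ⟨u, hu⟩ : ∃ u, u = t - (t + s) * p := ⟨_, rfl⟩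
  have hus : -s ≤ u := by rw [hu]; nlinarith
  have n4 : (t + s) ^ 2 * q ≤ (t + s) ^ 2 := mul_le_of_le_one_right (sq_nonneg _) hq
  have n5 : (t + s) ^ 2 * q - 2 * t * ((t + s) * p) + t ^ 2 ≤ 2 * t * s + s ^ 2 + 2 * t * u := by
    have : (t + s) ^ 2 - 2 * t * ((t + s) * p) + t ^ 2 = 2 * t * s + s ^ 2 + 2 * t * u := by
      rw [hu]; ring
    linarith
  have n6 : C * (2 * t * s + s ^ 2 + 2 * t * u) ≤ u + s + C * s ^ 2 := by
    have h1 : 0 ≤ (1 - t * (2 * C)) * (u + s) :=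
      mul_nonneg (by linarith) (by linarith)
    have h2 : u + s + C * s ^ 2 - C * (2 * t * s + s ^ 2 + 2 * t * u) =
        (1 - t * (2 * C)) * (u + s) := by ring
    linarith
  have hC2 : 1 ≤ C ^ 2 := one_le_pow₀ hC
  have m2 : C * s ≤ 1 := by
    have h1 : s * (4 * C ^ 2) * C ≤ 1 * C := by
      calc s * (4 * C ^ 2) * C = s * (4 * C ^ 3) := by ring
        _ ≤ 1 * C := by linarith
    have h2 := le_of_mul_le_mul_right h1 (by linarith)
    have h3 : C ≤ 4 * C ^ 2 := by nlinarith
    calc C * s ≤ (4 * C ^ 2) * s := by gcongr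
      _ ≤ 1 := by linarith
  have n7 : (s + C * s ^ 2) * W ^ 2 < D := by
    calc (s + C * s ^ 2) * W ^ 2 = (1 + C * s) * s * W ^ 2 := by ring
      _ ≤ (1 + 1) * s * C ^ 2 := by gcongr
      _ = s * (2 * C ^ 2) := by ring
      _ < s * (4 * C ^ 3) := by
        have : 2 * C ^ 2 < 4 * C ^ 3 := by
          have : C ^ 2 * 1 ≤ C ^ 2 * C := by gcongr
          nlinarith
        gcongr
      _ ≤ D := hsD
  have n9 := mul_le_mul_of_nonneg_right
    ((mul_le_mul_of_nonneg_left n5 (by linarith : 0 ≤ C)).trans n6) (sq_nonneg W)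
  have n10 : (t + s) * p - t = -u := by rw [hu]; ring
  rw [n10]
  calc _ = C * ((t + s) ^ 2 * q - 2 * t * ((t + s) * p) + t ^ 2) * W ^ 2 := by ring
    _ ≤ (u + s + C * s ^ 2) * W ^ 2 := n9
    _ = u * W ^ 2 + (s + C * s ^ 2) * W ^ 2 := by ring
    _ < u * W ^ 2 + D := by linarith
    _ = _ := by ring

/-- Moving away from the boundary in the normal direction. -/
theorem Controlled.exists_rise (h : Controlled Ω d ℓ ψ C r c d₀ g₀) :
    ∃ t₁ κ σ : ℝ, 0 < t₁ ∧ t₁ * C ≤ 1 / 2 ∧ 0 < κ ∧ 0 < σ ∧ ∀ x ∈ Ω, d x ≤ d₀ →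
      ∀ t : ℝ, 0 < t → t ≤ t₁ → x - (t : ℂ) • repVec (ℓ x) ∈ Ω ∧
        κ * t ≤ d (x - (t : ℂ) • repVec (ℓ x)) ∧
        kobayashi Ω (x - (t : ℂ) • repVec (ℓ x)) x ≤ Real.log (1 + 2 * t / (σ * d x)) := by
  have hC := h.one_le
  have hr := h.r_pos
  have hg := h.g₀_pos
  set σ := min (1 / (4 * C ^ 3)) (r / (2 * C ^ 2)) with hσ
  have s1 : σ * (4 * C ^ 3) ≤ 1 := (le_div_iff₀ (by positivity)).1 (min_le_left _ _)
  have s2 : σ * (2 * C ^ 2) ≤ r := (le_div_iff₀ (by positivity)).1 (min_le_right _ _)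
  have hσpos : 0 < σ := by rw [hσ]; positivity
  set t₁ := min (1 / (2 * C)) (r / (4 * C)) with ht₁
  have u1 : t₁ * (2 * C) ≤ 1 := (le_div_iff₀ (by positivity)).1 (min_le_left _ _)
  have u2 : t₁ * (4 * C) ≤ r := (le_div_iff₀ (by positivity)).1 (min_le_right _ _)
  have ht₁pos : 0 < t₁ := by rw [ht₁]; positivity
  refine ⟨t₁, g₀ ^ 2 / 2, σ, ht₁pos, by linarith, by positivity, hσpos, ?_⟩
  intro x hx hdx t ht htt
  have hd := h.d_pos x hx
  have hdC := h.d_le x hx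
  set w := repVec (ℓ x) with hw
  have hwC : ‖w‖ ≤ C := by rw [hw, norm_repVec]; exact h.norm_le x hx
  have hwg : g₀ ≤ ‖w‖ := by rw [hw, norm_repVec]; exact h.le_norm x hx hdx
  have hℓw : ∀ a : ℂ, ℓ x (a • w) = a * ((‖w‖ ^ 2 : ℝ) : ℂ) := by
    intro a
    rw [map_smul, hw, apply_repVec, norm_repVec, smul_eq_mul]
  set s := σ * d x with hs
  have hspos : 0 < s := by positivity
  set R := t + s with hR
  have hRpos : 0 < R := by positivity
  have hmaps : MapsTo (fun ζ : ℂ => (x - (t : ℂ) • w) + ζ • ((R : ℂ) • w)) (ball (0 : ℂ) 1) Ω := by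
    intro ζ hζ
    have hζ1 : ‖ζ‖ < 1 := by simpa using hζ
    have hy : (x - (t : ℂ) • w) + ζ • ((R : ℂ) • w) - x = (ζ * R - t) • w := by
      rw [sub_smul, mul_smul]; abel
    refine h.mem_of_lt x hx _ ?_ ?_
    · rw [hy, norm_smul]
      have n1 : ‖ζ * R - t‖ ≤ R + t := by
        refine (norm_sub_le _ _).trans ?_
        rw [norm_mul, Complex.norm_real, Complex.norm_real, Real.norm_of_nonneg hRpos.le,
          Real.norm_of_nonneg ht.le]
        nlinarith
      calc ‖ζ * R - t‖ * ‖w‖ ≤ (R + t) * C := by gcongr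
        _ ≤ r := by
          have : s * C ≤ r / 2 := by
            rw [hs]
            have : σ * C * d x ≤ σ * C * C := by gcongr
            nlinarith
          have : t * C ≤ t₁ * C := by gcongr
          rw [hR]
          nlinarith
    · rw [hy, hℓw, norm_smul, mul_pow, Complex.re_mul_ofReal]
      have n2 : ‖ζ * R - t‖ ^ 2 = R ^ 2 * ‖ζ‖ ^ 2 - 2 * t * (R * ζ.re) + t ^ 2 := by
        rw [Complex.sq_norm, Complex.normSq_apply, Complex.sq_norm, Complex.normSq_apply]
        simp
        ring
      have n3 : (ζ * R - t).re = R * ζ.re - t := by simp; ring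
      rw [n2, n3]
      have hre : ζ.re ≤ 1 := (Complex.re_le_norm ζ).trans hζ1.le
      have hq : ‖ζ‖ ^ 2 ≤ 1 := by nlinarith [norm_nonneg ζ]
      have htC : t * (2 * C) ≤ t₁ * (2 * C) := by gcongr
      have m1 : s * (4 * C ^ 3) ≤ d x := by
        calc s * (4 * C ^ 3) = σ * (4 * C ^ 3) * d x := by rw [hs]; ring
          _ ≤ 1 * d x := by gcongr
          _ = d x := one_mul _
      exact normal_disc_bound hC ht.le (htC.trans u1) hspos m1 hdC (norm_nonneg w) hwC hre hq
  have hxt : x - (t : ℂ) • w ∈ Ω := by simpa using hmaps (x := 0) (by simp)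
  refine ⟨hxt, ?_, ?_⟩
  · have h1 := (abs_le.1 (h.taylor x hx _ hxt)).1
    have h2 : x - (t : ℂ) • w - x = (-t : ℂ) • w := by rw [neg_smul]; abel
    rw [h2, hℓw, norm_smul, norm_neg, Complex.norm_real, Real.norm_of_nonneg ht.le,
      Complex.re_mul_ofReal] at h1
    simp only [Complex.neg_re, Complex.ofReal_re] at h1
    have h3 : C * (t * ‖w‖) ^ 2 ≤ t / 2 * ‖w‖ ^ 2 := by
      have : t * (2 * C) ≤ t₁ * (2 * C) := by gcongr
      have h4 : C * t ≤ 1 / 2 := by linarith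
      calc C * (t * ‖w‖) ^ 2 = (C * t) * (t * ‖w‖ ^ 2) := by ring
        _ ≤ 1 / 2 * (t * ‖w‖ ^ 2) := by gcongr
        _ = _ := by ring
    have h5 : g₀ ^ 2 ≤ ‖w‖ ^ 2 := by gcongr
    nlinarith
  · refine (kobayashi_le_lempert hxt hx).trans ?_
    have htR : t / R < 1 := by rw [div_lt_one hRpos]; linarith
    have hn : ‖((t / R : ℝ) : ℂ)‖ = t / R := by
      rw [Complex.norm_real, Real.norm_of_nonneg (by positivity)]
    have := lempert_le_artanh (φ := fun ζ : ℂ => (x - (t : ℂ) • w) + ζ • ((R : ℂ) • w)) (Ω := Ω)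
      (a := ((t / R : ℝ) : ℂ)) (by fun_prop) hmaps (by rwa [hn])
    have hx' : (x - (t : ℂ) • w) + ((t / R : ℝ) : ℂ) • ((R : ℂ) • w) = x := by
      rw [smul_smul, ← Complex.ofReal_mul, div_mul_cancel₀ _ hRpos.ne']; abel
    rw [hx', hn, zero_smul, add_zero] at this
    refine this.trans ?_
    unfold artanh
    have e1 : (1 + t / R) / (1 - t / R) = 1 + 2 * t / s := by
      have : R - t = s := by rw [hR]; ring
      have h0 : R - t ≠ 0 := by rw [this]; exact hspos.ne'
      rw [← this]
      field_simp
      ring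
    rw [e1]
    have : 0 ≤ Real.log (1 + 2 * t / s) := Real.log_nonneg (by
      have : 0 ≤ 2 * t / s := by positivity
      linarith)
    linarith

/-- The Kobayashi distance is bounded on the level sets of `d`. -/
theorem Controlled.kobayashi_bounded (h : Controlled Ω d ℓ ψ C r c d₀ g₀) {ε : ℝ} (hε : 0 < ε) :
    ∃ L : ℝ, 0 ≤ L ∧ ∀ x ∈ Ω, ε ≤ d x → ∀ y ∈ Ω, ε ≤ d y → kobayashi Ω x y ≤ L := by
  obtain ⟨ε₁, hε₁, hS⟩ := h.kobayashi_le_one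
  obtain ⟨o, ho⟩ := h.isConnected.nonempty
  have key : ∃ L : ℝ, ∀ x ∈ {x | x ∈ Ω ∧ ε ≤ d x}, kobayashi Ω o x ≤ L := by
    refine (h.isCompact_level ε hε).induction_on (p := fun s => ∃ L : ℝ, ∀ x ∈ s,
      kobayashi Ω o x ≤ L) ?_ ?_ ?_ ?_
    · exact ⟨0, fun x hx => absurd hx (by simp)⟩
    · rintro s t hst ⟨L, hL⟩
      exact ⟨L, fun x hx => hL x (hst hx)⟩
    · rintro s t ⟨L, hL⟩ ⟨L', hL'⟩
      refine ⟨max L L', fun x hx => ?_⟩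
      rcases hx with hx | hx
      · exact (hL x hx).trans (le_max_left _ _)
      · exact (hL' x hx).trans (le_max_right _ _)
    · rintro x ⟨hx, -⟩
      have hd := h.d_pos x hx
      refine ⟨{y | ‖y - x‖ ^ 2 < ε₁ * d x ∧ ‖ℓ x (y - x)‖ < ε₁ * d x},
        mem_nhdsWithin_of_mem_nhds ?_, kobayashi Ω o x + 1, ?_⟩
      · refine IsOpen.mem_nhds ?_ ?_
        · have c1 : Continuous fun y => ‖y - x‖ ^ 2 := by fun_prop
          have c2 : Continuous fun y => ‖ℓ x (y - x)‖ := by fun_prop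
          exact (isOpen_lt c1 continuous_const).inter (isOpen_lt c2 continuous_const)
        · simp [hε₁, hd]
      · rintro y ⟨hy1, hy2⟩
        obtain ⟨hy, hk⟩ := hS x hx y hy1.le hy2.le
        linarith [kobayashi_triangle ho hx hy]
  obtain ⟨L, hL⟩ := key
  refine ⟨|L| + |L|, by positivity, fun x hx hdx y hy hdy => ?_⟩
  have h1 := kobayashi_triangle hx ho hy
  rw [kobayashi_comm hx ho] at h1
  linarith [hL x ⟨hx, hdx⟩, hL y ⟨hy, hdy⟩, le_abs_self L]

set_option maxHeartbeats 1000000 in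
/-- An upper bound of the Kobayashi distance by an anisotropic quantity. -/
theorem Controlled.kobayashi_upper (h : Controlled Ω d ℓ ψ C r c d₀ g₀) :
    ∃ A : ℝ, 0 ≤ A ∧ ∀ x ∈ Ω, ∀ y ∈ Ω, ∀ M : ℝ, 0 < M → ‖y - x‖ ^ 2 ≤ M → ‖ℓ x (y - x)‖ ≤ M →
      kobayashi Ω x y ≤ A + Real.log (1 + M / d x) + Real.log (1 + M / d y) := by
  obtain ⟨ε₁, hε₁, hS⟩ := h.kobayashi_le_one
  obtain ⟨t₁, κ, σ, ht₁, ht₁C, hκ, hσ, hrise⟩ := h.exists_rise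
  have hC := h.one_le
  have hd₀ := h.d₀_pos
  obtain ⟨L, hL0, hL⟩ := h.kobayashi_bounded (ε := min (κ * t₁) d₀) (by positivity)
  obtain ⟨B, hB⟩ : ∃ B, B = 4 / (ε₁ * κ) := ⟨_, rfl⟩
  have hBpos : 0 < B := by rw [hB]; positivity
  have hBε : ε₁ * κ * B = 4 := by rw [hB]; field_simp
  obtain ⟨M₀, hM₀, m1, m2, m3⟩ : ∃ M₀ : ℝ, 0 < M₀ ∧ B * M₀ ≤ t₁ ∧
      3 * C ^ 2 * √M₀ ≤ ε₁ * κ / 2 ∧ (1 + C) * M₀ ≤ ε₁ * d₀ := by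
    refine ⟨min (t₁ / B) (min ((ε₁ * κ / (6 * C ^ 2)) ^ 2) (ε₁ * d₀ / (1 + C))), by positivity,
      ?_, ?_, ?_⟩
    · have := (le_div_iff₀ hBpos).1 (min_le_left (t₁ / B)
        (min ((ε₁ * κ / (6 * C ^ 2)) ^ 2) (ε₁ * d₀ / (1 + C))))
      linarith
    · have := Real.sqrt_le_sqrt ((min_le_right (t₁ / B)
        (min ((ε₁ * κ / (6 * C ^ 2)) ^ 2) (ε₁ * d₀ / (1 + C)))).trans (min_le_left _ _))
      rw [Real.sqrt_sq (by positivity)] at this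
      rw [le_div_iff₀ (by positivity)] at this
      linarith
    · have := (le_div_iff₀ (by linarith)).1 ((min_le_right (t₁ / B)
        (min ((ε₁ * κ / (6 * C ^ 2)) ^ 2) (ε₁ * d₀ / (1 + C)))).trans (min_le_right _ _))
      linarith
  set a₁ := 1 + 2 * B / σ with ha₁
  set a₂ := 1 + 2 * t₁ / (σ * M₀) with ha₂
  have ha₁1 : 1 ≤ a₁ := by
    have : 0 ≤ 2 * B / σ := by positivity
    linarith
  have ha₂1 : 1 ≤ a₂ := by
    have : 0 ≤ 2 * t₁ / (σ * M₀) := by positivity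
    linarith
  have hla₁ := Real.log_nonneg ha₁1
  have hla₂ := Real.log_nonneg ha₂1
  refine ⟨1 + L + 2 * Real.log a₁ + 2 * Real.log a₂, by positivity, ?_⟩
  intro x hx y hy M hM hn hℓ
  have hdx := h.d_pos x hx
  have hdy := h.d_pos y hy
  have lx : 0 ≤ Real.log (1 + M / d x) := Real.log_nonneg (by
    have : 0 ≤ M / d x := by positivity
    linarith)
  have ly : 0 ≤ Real.log (1 + M / d y) := Real.log_nonneg (by
    have : 0 ≤ M / d y := by positivity
    linarith)
  by_cases hMM : M ≤ M₀
  · by_cases hx0 : d₀ < d x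
    · have h1 : M ≤ ε₁ * d x := by
        have : ε₁ * d₀ ≤ ε₁ * d x := by gcongr
        nlinarith
      have := (hS x hx y (hn.trans h1) (hℓ.trans h1)).2
      linarith
    by_cases hy0 : d₀ < d y
    · have h1 : (1 + C) * M ≤ ε₁ * d y := by
        have : ε₁ * d₀ ≤ ε₁ * d y := by gcongr
        nlinarith
      rw [kobayashi_comm hx hy]
      have hn' : ‖x - y‖ ^ 2 ≤ M := by rwa [norm_sub_rev]
      have h2 : ‖ℓ y (x - y)‖ ≤ (1 + C) * M := by
        have e : ℓ y (x - y) = (ℓ y - ℓ x) (x - y) - ℓ x (y - x) := by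
          simp only [map_sub, _root_.sub_apply]; ring
        rw [e]
        refine (norm_sub_le _ _).trans ?_
        have q1 := (ℓ y - ℓ x).le_opNorm (x - y)
        have q2 := h.lipschitz y hy x hx
        rw [norm_sub_rev y x] at q2
        have q3 : ‖ℓ y - ℓ x‖ * ‖x - y‖ ≤ C * ‖x - y‖ * ‖x - y‖ := by gcongr
        have q4 : C * ‖x - y‖ * ‖x - y‖ ≤ C * M := by
          rw [mul_assoc, ← sq]; gcongr
        linarith
      have := (hS y hy x (hn'.trans (by nlinarith)) (h2.trans h1)).2
      linarith
    push Not at hx0 hy0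
    obtain ⟨t, ht⟩ : ∃ t, t = B * M := ⟨_, rfl⟩
    have htpos : 0 < t := by rw [ht]; positivity
    have htt : t ≤ t₁ := (by rw [ht]; gcongr : t ≤ B * M₀).trans m1
    have htC : t * C ≤ 1 / 2 := (by gcongr : t * C ≤ t₁ * C).trans ht₁C
    obtain ⟨hx', hdx', hkx⟩ := hrise x hx hx0 t htpos htt
    obtain ⟨hy', hdy', hky⟩ := hrise y hy hy0 t htpos htt
    set wx := repVec (ℓ x) with hwx
    set wy := repVec (ℓ y) with hwy
    set x' := x - (t : ℂ) • wx with hx'def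
    set y' := y - (t : ℂ) • wy with hy'def
    have nt : ‖(t : ℂ)‖ = t := by rw [Complex.norm_real, Real.norm_of_nonneg htpos.le]
    have nw : ‖wx - wy‖ ≤ C * ‖y - x‖ := by
      rw [hwx, hwy, norm_repVec_sub, norm_sub_rev y x]; exact h.lipschitz x hx y hy
    have hny : ‖y - x‖ ≤ √M := Real.le_sqrt_of_sq_le hn
    have esub : y' - x' = (y - x) + (t : ℂ) • (wx - wy) := by
      rw [hx'def, hy'def, smul_sub]; abel
    have n1 : ‖y' - x'‖ ≤ 2 * √M := by
      rw [esub]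
      refine (norm_add_le _ _).trans ?_
      rw [norm_smul, nt]
      have q1 : t * ‖wx - wy‖ ≤ t * C * ‖y - x‖ := by
        rw [mul_assoc]; exact mul_le_mul_of_nonneg_left nw htpos.le
      have q2 : t * C * ‖y - x‖ ≤ 1 / 2 * ‖y - x‖ := by gcongr
      linarith [norm_nonneg (y - x)]
    have hsM := Real.sq_sqrt hM.le
    have hsM0 := Real.sqrt_nonneg M
    have big : 4 * M ≤ ε₁ * d x' := by
      have : ε₁ * (κ * t) ≤ ε₁ * d x' := by gcongr
      have e : ε₁ * (κ * t) = 4 * M := by rw [ht]; linear_combination M * hBε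
      linarith
    have n2 : ‖y' - x'‖ ^ 2 ≤ ε₁ * d x' := by
      have : ‖y' - x'‖ ^ 2 ≤ (2 * √M) ^ 2 := by gcongr
      rw [mul_pow, hsM] at this
      linarith
    have n3 : ‖ℓ x' (y' - x')‖ ≤ ε₁ * d x' := by
      have e : ℓ x' (y' - x') = ℓ x (y - x) + (t : ℂ) * ℓ x (wx - wy) +
          (ℓ x' - ℓ x) (y' - x') := by
        rw [_root_.sub_apply]
        have : ℓ x (y' - x') = ℓ x (y - x) + (t : ℂ) * ℓ x (wx - wy) := by
          rw [esub, map_add, map_smul, smul_eq_mul]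
        rw [this]; ring
      have p1 : ‖(t : ℂ) * ℓ x (wx - wy)‖ ≤ t * (C * (C * √M)) := by
        rw [norm_mul, nt]
        gcongr
        refine ((ℓ x).le_opNorm _).trans ?_
        have := h.norm_le x hx
        gcongr
        exact nw.trans (by gcongr)
      have p2 : ‖(ℓ x' - ℓ x) (y' - x')‖ ≤ C * (t * C) * (2 * √M) := by
        refine ((ℓ x' - ℓ x).le_opNorm _).trans ?_
        gcongr
        refine (h.lipschitz x' hx' x hx).trans ?_
        gcongr
        rw [hx'def, sub_sub_cancel_left, norm_neg, norm_smul, nt, hwx, norm_repVec]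
        have := h.norm_le x hx
        gcongr
      rw [e]
      refine (norm_add_le _ _).trans ?_
      have p3 := norm_add_le (ℓ x (y - x)) ((t : ℂ) * ℓ x (wx - wy))
      have p4 : t * (C * (C * √M)) + C * (t * C) * (2 * √M) ≤ 2 * M := by
        have q1 : √M ≤ √M₀ := Real.sqrt_le_sqrt hMM
        have q2 : 3 * C ^ 2 * √M ≤ ε₁ * κ / 2 := (by gcongr : _ ≤ 3 * C ^ 2 * √M₀).trans m2
        calc t * (C * (C * √M)) + C * (t * C) * (2 * √M) = t * (3 * C ^ 2 * √M) := by ring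
          _ ≤ t * (ε₁ * κ / 2) := by gcongr
          _ = 2 * M := by rw [ht]; linear_combination (M / 2) * hBε
      linarith
    have hkk := (hS x' hx' y' n2 n3).2
    have tri := kobayashi_triangle hx hx' hy
    have tri' := kobayashi_triangle hx' hy' hy
    rw [kobayashi_comm hx hx'] at tri
    have lb : ∀ δ : ℝ, 0 < δ → Real.log (1 + 2 * t / (σ * δ)) ≤
        Real.log a₁ + Real.log (1 + M / δ) := by
      intro δ hδ
      refine log_one_add_le_add (by positivity) (by positivity) (by positivity) (le_of_eq ?_)
      rw [ht]; field_simp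
    linarith [lb (d x) hdx, lb (d y) hdy]
  · push Not at hMM
    have lb : ∀ δ : ℝ, 0 < δ → Real.log (1 + 2 * t₁ / (σ * δ)) ≤
        Real.log a₂ + Real.log (1 + M / δ) := by
      intro δ hδ
      refine log_one_add_le_add (by positivity) (by positivity) (by positivity) ?_
      have e : 2 * t₁ / (σ * δ) = 2 * t₁ / (σ * M₀) * (M₀ / δ) := by field_simp
      rw [e]
      gcongr
    have lift : ∀ x ∈ Ω, ∃ x' ∈ Ω, min (κ * t₁) d₀ ≤ d x' ∧
        kobayashi Ω x' x ≤ Real.log a₂ + Real.log (1 + M / d x) := by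
      intro x hx
      have hdx := h.d_pos x hx
      by_cases hx0 : d x ≤ d₀
      · obtain ⟨h1, h2, h3⟩ := hrise x hx hx0 t₁ ht₁ le_rfl
        exact ⟨_, h1, (min_le_left _ _).trans h2, h3.trans (lb _ hdx)⟩
      · push Not at hx0
        refine ⟨x, hx, (min_le_right _ _).trans hx0.le, ?_⟩
        rw [kobayashi_self hx]
        have : 0 ≤ Real.log (1 + M / d x) := Real.log_nonneg (by
          have : 0 ≤ M / d x := by positivity
          linarith)
        positivity
    obtain ⟨x', hx', hdx', hkx⟩ := lift x hx
    obtain ⟨y', hy', hdy', hky⟩ := lift y hy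
    have tri := kobayashi_triangle hx hx' hy
    have tri' := kobayashi_triangle hx' hy' hy
    rw [kobayashi_comm hx hx'] at tri
    have := hL x' hx' hdx' y' hy' hdy'
    linarith

theorem norm_sub_le_of_local {F : Type*} [SeminormedAddCommGroup F] {f : ℝ → F} {g : ℝ → ℝ}
    {a b τ : ℝ} (hτ : 0 < τ)
    (hloc : ∀ s ∈ Icc a b, ∀ t ∈ Icc a b, s ≤ t → t - s ≤ τ → ‖f t - f s‖ ≤ g t - g s) :
    ∀ s ∈ Icc a b, ∀ t ∈ Icc a b, s ≤ t → ‖f t - f s‖ ≤ g t - g s := by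
  have key : ∀ n : ℕ, ∀ s ∈ Icc a b, ∀ t ∈ Icc a b, s ≤ t → t - s ≤ n * τ →
      ‖f t - f s‖ ≤ g t - g s := by
    intro n
    induction n with
    | zero =>
      intro s hs t ht hst h
      exact hloc s hs t ht hst (by simp at h; linarith)
    | succ n ih =>
      intro s hs t ht hst h
      push_cast at h
      have hm1 : s ≤ max s (t - τ) := le_max_left _ _
      have hm2 : max s (t - τ) ≤ t := max_le hst (by linarith)
      have hm : max s (t - τ) ∈ Icc a b := ⟨hs.1.trans hm1, hm2.trans ht.2⟩
      have h1 := ih s hs _ hm hm1 (by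
        have : 0 ≤ (n : ℝ) * τ := by positivity
        rw [sub_le_iff_le_add]
        exact max_le (by linarith) (by linarith))
      have h2 := hloc _ hm t ht hm2 (by linarith [le_max_right s (t - τ)])
      have e : f t - f s = (f t - f (max s (t - τ))) + (f (max s (t - τ)) - f s) := by abel
      rw [e]
      exact (norm_add_le _ _).trans (by linarith)
  intro s hs t ht hst
  obtain ⟨n, hn⟩ := exists_nat_ge ((t - s) / τ)
  exact key n s hs t ht hst ((div_le_iff₀ hτ).1 hn)

theorem eVariationOn_Icc_le {F : Type*} [SeminormedAddCommGroup F] {f : ℝ → F} {g : ℝ → ℝ}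
    {a b : ℝ} (hab : a ≤ b) (h : ∀ s ∈ Icc a b, ∀ t ∈ Icc a b, s ≤ t → ‖f t - f s‖ ≤ g t - g s) :
    eVariationOn f (Icc a b) ≤ ENNReal.ofReal (g b - g a) := by
  have hg : MonotoneOn g (Icc a b) := fun s hs t ht hst => by
    linarith [h s hs t ht hst, norm_nonneg (f t - f s)]
  have h1 : eVariationOn f (Icc a b) ≤ eVariationOn g (Icc a b) := by
    unfold eVariationOn
    refine iSup_mono fun p => Finset.sum_le_sum fun i _ => ?_
    have := h _ (p.2.2.2 i) _ (p.2.2.2 (i + 1)) (p.2.2.1 (Nat.le_succ i))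
    rw [edist_eq_enorm_sub, edist_eq_enorm_sub, ← ofReal_norm, ← ofReal_norm]
    exact ENNReal.ofReal_le_ofReal (this.trans (le_abs_self _))
  have := hg.eVariationOn_eq ⟨le_rfl, hab⟩ ⟨hab, le_rfl⟩
  rw [inter_self] at this
  exact h1.trans this.le

theorem le_exp_decay_of_log_bound {A A₁ D T p q : ℝ} (hA₁ : 1 ≤ A₁) (hT : 0 ≤ T) (hp : 0 < p)
    (hpD : p ≤ D) (hqD : D ≤ 2 * q)
    (h : T ≤ A + Real.log (1 + A₁ * D * (1 + T) ^ 2 / p) +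
      Real.log (1 + A₁ * D * (1 + T) ^ 2 / q)) :
    p ≤ 24576 * A₁ ^ 2 * Real.exp A * D * Real.exp (-(T / 2)) := by
  have hD : 0 < D := hp.trans_le hpD
  have hq : 0 < q := by linarith
  obtain ⟨S, hS⟩ : ∃ S, S = (1 + T) ^ 2 := ⟨_, rfl⟩
  have hS1 : 1 ≤ S := by rw [hS]; nlinarith
  rw [← hS] at h
  have hAS : 1 ≤ A₁ * S := one_le_mul_of_one_le_of_one_le hA₁ hS1
  have h1 : 1 + A₁ * D * S / p ≤ 2 * (A₁ * S) * D / p := by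
    have : 1 ≤ A₁ * D * S / p := by
      rw [one_le_div hp]
      calc p ≤ 1 * D := by linarith
        _ ≤ (A₁ * S) * D := by gcongr
        _ = _ := by ring
    have e : 2 * (A₁ * S) * D / p = 2 * (A₁ * D * S / p) := by ring
    linarith
  have h2 : 1 + A₁ * D * S / q ≤ 3 * (A₁ * S) := by
    have : A₁ * D * S / q ≤ 2 * (A₁ * S) := by
      rw [div_le_iff₀ hq]
      calc A₁ * D * S = (A₁ * S) * D := by ring
        _ ≤ (A₁ * S) * (2 * q) := by gcongr
        _ = _ := by ring
    linarith
  have h3 : Real.exp T ≤ Real.exp A * (2 * (A₁ * S) * D / p) * (3 * (A₁ * S)) := by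
    calc Real.exp T ≤ Real.exp (A + Real.log (1 + A₁ * D * S / p) +
          Real.log (1 + A₁ * D * S / q)) := Real.exp_le_exp.2 h
      _ = Real.exp A * (1 + A₁ * D * S / p) * (1 + A₁ * D * S / q) := by
        rw [Real.exp_add, Real.exp_add, Real.exp_log (by positivity), Real.exp_log (by positivity)]
      _ ≤ _ := by gcongr
  have h4 : S ≤ 64 * Real.exp (T / 4) := by
    have : 1 + T ≤ 8 * Real.exp (T / 8) := by
      linarith [Real.add_one_le_exp (T / 8)]
    calc S ≤ (8 * Real.exp (T / 8)) ^ 2 := by rw [hS]; gcongr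
      _ = 64 * (Real.exp (T / 8) * Real.exp (T / 8)) := by ring
      _ = _ := by rw [← Real.exp_add]; ring_nf
  have h5 : S * S ≤ 4096 * Real.exp (T / 2) := by
    calc S * S ≤ (64 * Real.exp (T / 4)) * (64 * Real.exp (T / 4)) := by gcongr
      _ = 4096 * (Real.exp (T / 4) * Real.exp (T / 4)) := by ring
      _ = _ := by rw [← Real.exp_add]; ring_nf
  have h6 : Real.exp T * p ≤ 24576 * A₁ ^ 2 * Real.exp A * D * Real.exp (T / 2) := by
    calc Real.exp T * p ≤ Real.exp A * (2 * (A₁ * S) * D / p) * (3 * (A₁ * S)) * p := by gcongr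
      _ = 6 * A₁ ^ 2 * Real.exp A * D * (S * S) := by field_simp; ring
      _ ≤ 6 * A₁ ^ 2 * Real.exp A * D * (4096 * Real.exp (T / 2)) := by gcongr
      _ = _ := by ring
  have h7 : Real.exp T = Real.exp (T / 2) * Real.exp (T / 2) := by
    rw [← Real.exp_add]; ring_nf
  have h8 : Real.exp (-(T / 2)) * Real.exp (T / 2) = 1 := by rw [← Real.exp_add]; simp
  have h9 := Real.exp_pos (T / 2)
  refine le_of_mul_le_mul_right (a := Real.exp (T / 2) * Real.exp (T / 2)) ?_ (by positivity)
  calc p * (Real.exp (T / 2) * Real.exp (T / 2)) = Real.exp T * p := by rw [h7]; ring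
    _ ≤ _ := h6
    _ = 24576 * A₁ ^ 2 * Real.exp A * D * (Real.exp (-(T / 2)) * Real.exp (T / 2)) *
        Real.exp (T / 2) := by rw [h8]; ring
    _ = _ := by ring

/-- Exponential decay of `d` along a Kobayashi geodesic away from its highest point. -/
theorem Controlled.exists_decay (h : Controlled Ω d ℓ ψ C r c d₀ g₀) :
    ∃ τ B A₃ : ℝ, 0 < τ ∧ 1 ≤ B ∧ 0 < A₃ ∧ ∀ (a b : ℝ) (γ : ℝ → E N),
      (∀ t ∈ Icc a b, γ t ∈ Ω) →
      (∀ s ∈ Icc a b, ∀ t ∈ Icc a b, kobayashi Ω (γ s) (γ t) = |s - t|) →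
      (∀ s ∈ Icc a b, ∀ t ∈ Icc a b, s ≤ t → t - s ≤ τ →
        ‖γ t - γ s‖ ≤ B * (t - s) * √(d (γ s))) ∧
      ∀ D : ℝ, (∀ t ∈ Icc a b, d (γ t) ≤ D) → ∀ t₀ ∈ Icc a b, D ≤ 2 * d (γ t₀) →
        ∀ t ∈ Icc a b, d (γ t) ≤ A₃ * D * Real.exp (-(|t - t₀| / 2)) := by
  obtain ⟨a₁, B, ha₁, hB, hloc⟩ := h.kobayashi_estimates
  obtain ⟨A, hA, hup⟩ := h.kobayashi_upper
  have hC := h.one_le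
  set A₁ := B ^ 2 + B + C * B ^ 2 with hA₁
  have hA₁1 : 1 ≤ A₁ := by
    have : 0 ≤ C * B ^ 2 := by positivity
    nlinarith
  refine ⟨a₁ / 2, B, 24576 * A₁ ^ 2 * Real.exp A, by positivity, hB, by positivity, ?_⟩
  intro a b γ hγ hgeo
  have hlocal : ∀ s ∈ Icc a b, ∀ t ∈ Icc a b, s ≤ t → t - s ≤ a₁ / 2 →
      ‖γ t - γ s‖ ≤ B * (t - s) * √(d (γ s)) ∧ ‖ℓ (γ s) (γ t - γ s)‖ ≤ B * (t - s) * d (γ s) := by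
    intro s hs t ht hst hτ
    have hk := hgeo s hs t ht
    rw [abs_sub_comm, abs_of_nonneg (by linarith)] at hk
    have := hloc _ (hγ s hs) _ (hγ t ht) (by rw [hk]; linarith)
    rwa [hk] at this
  refine ⟨fun s hs t ht hst hτ => (hlocal s hs t ht hst hτ).1, ?_⟩
  intro D hD t₀ ht₀ hDt₀
  have hD0 : 0 < D := (h.d_pos _ (hγ _ ht₀)).trans_le (hD _ ht₀)
  have glob : ∀ s ∈ Icc a b, ∀ t ∈ Icc a b, s ≤ t → ‖γ t - γ s‖ ≤ B * √D * (t - s) := by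
    intro s hs t ht hst
    have := norm_sub_le_of_local (f := γ) (g := fun u => B * √D * u) (half_pos ha₁) ?_ s hs t ht hst
    · rwa [← mul_sub] at this
    · intro s hs t ht hst hτ
      refine (hlocal s hs t ht hst hτ).1.trans ?_
      have h1 : √(d (γ s)) ≤ √D := Real.sqrt_le_sqrt (hD s hs)
      have h2 : 0 ≤ B * (t - s) := mul_nonneg (by linarith) (by linarith)
      calc B * (t - s) * √(d (γ s)) ≤ B * (t - s) * √D := by gcongr
        _ = _ := by ring
  have globn : ∀ s ∈ Icc a b, ∀ t ∈ Icc a b, s ≤ t →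
      ‖ℓ (γ s) (γ t - γ s)‖ ≤ (B * D + C * B ^ 2 * D * (t - s)) * (t - s) := by
    intro s hs t ht hst
    have hsub : Icc s t ⊆ Icc a b := Icc_subset_Icc hs.1 ht.2
    have := norm_sub_le_of_local (f := fun u => ℓ (γ s) (γ u))
      (g := fun u => (B * D + C * B ^ 2 * D * (t - s)) * u) (a := s) (b := t) (half_pos ha₁) ?_
      s ⟨le_rfl, hst⟩ t ⟨hst, le_rfl⟩ hst
    · rwa [← mul_sub, ← map_sub] at this
    · intro u hu v hv huv hτ
      obtain ⟨e1, e2⟩ := hlocal u (hsub hu) v (hsub hv) huv hτ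
      have e3 := glob s hs u (hsub hu) hu.1
      have e4 : ℓ (γ s) (γ v) - ℓ (γ s) (γ u) =
          ℓ (γ u) (γ v - γ u) + (ℓ (γ s) - ℓ (γ u)) (γ v - γ u) := by
        simp only [map_sub, _root_.sub_apply]; ring
      have huv0 : 0 ≤ v - u := by linarith
      have hts0 : 0 ≤ t - s := by linarith
      have hDu := hD u (hsub hu)
      have e5 : ‖(ℓ (γ s) - ℓ (γ u)) (γ v - γ u)‖ ≤
          C * (B * √D * (t - s)) * (B * (v - u) * √D) := by
        refine ((ℓ (γ s) - ℓ (γ u)).le_opNorm _).trans ?_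
        gcongr
        · refine (h.lipschitz _ (hγ s hs) _ (hγ u (hsub hu))).trans ?_
          gcongr
          rw [norm_sub_rev]
          refine e3.trans ?_
          have := hu.2
          gcongr
        · refine e1.trans ?_
          gcongr
      have e6 : C * (B * √D * (t - s)) * (B * (v - u) * √D) =
          C * B ^ 2 * D * (t - s) * (v - u) := by
        have := Real.mul_self_sqrt hD0.le
        linear_combination (C * B ^ 2 * (t - s) * (v - u)) * this
      have e7 : B * (v - u) * d (γ u) ≤ B * (v - u) * D := by gcongr
      rw [e4]
      refine (norm_add_le _ _).trans ?_
      have e8 : (B * D + C * B ^ 2 * D * (t - s)) * v - (B * D + C * B ^ 2 * D * (t - s)) * u =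
          B * (v - u) * D + C * B ^ 2 * D * (t - s) * (v - u) := by ring
      rw [e8]
      linarith
  have upper : ∀ s ∈ Icc a b, ∀ t ∈ Icc a b, s ≤ t →
      t - s ≤ A + Real.log (1 + A₁ * D * (1 + (t - s)) ^ 2 / d (γ s)) +
        Real.log (1 + A₁ * D * (1 + (t - s)) ^ 2 / d (γ t)) := by
    intro s hs t ht hst
    have hk := hgeo s hs t ht
    rw [abs_sub_comm, abs_of_nonneg (by linarith)] at hk
    have hT : 0 ≤ t - s := by linarith
    conv_lhs => rw [← hk]
    refine hup _ (hγ s hs) _ (hγ t ht) _ (by positivity) ?_ ?_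
    · have e := glob s hs t ht hst
      calc ‖γ t - γ s‖ ^ 2 ≤ (B * √D * (t - s)) ^ 2 := by gcongr
        _ = B ^ 2 * D * (t - s) ^ 2 := by rw [mul_pow, mul_pow, Real.sq_sqrt hD0.le]
        _ ≤ A₁ * D * (1 + (t - s)) ^ 2 := by
          gcongr
          · rw [hA₁]
            have : 0 ≤ C * B ^ 2 := by positivity
            linarith
          · linarith
    · refine (globn s hs t ht hst).trans ?_
      obtain ⟨T, hTe⟩ : ∃ T, T = t - s := ⟨_, rfl⟩
      rw [← hTe] at hT ⊢
      have e1 : T ≤ (1 + T) ^ 2 := by nlinarith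
      have e2 : T * T ≤ (1 + T) ^ 2 := by nlinarith
      calc (B * D + C * B ^ 2 * D * T) * T = B * D * T + C * B ^ 2 * D * (T * T) := by ring
        _ ≤ B * D * (1 + T) ^ 2 + C * B ^ 2 * D * (1 + T) ^ 2 := by gcongr
        _ = (B + C * B ^ 2) * D * (1 + T) ^ 2 := by ring
        _ ≤ _ := by
          gcongr
          rw [hA₁]
          nlinarith
  intro t ht
  rcases le_total t t₀ with htt | htt
  · rw [abs_sub_comm, abs_of_nonneg (by linarith)]
    exact le_exp_decay_of_log_bound hA₁1 (by linarith) (h.d_pos _ (hγ _ ht)) (hD _ ht) hDt₀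
      (upper t ht t₀ ht₀ htt)
  · rw [abs_of_nonneg (by linarith)]
    refine le_exp_decay_of_log_bound hA₁1 (by linarith) (h.d_pos _ (hγ _ ht)) (hD _ ht) hDt₀ ?_
    have := upper t₀ ht₀ t ht htt
    linarith

theorem Controlled.eVariationOn_le (h : Controlled Ω d ℓ ψ C r c d₀ g₀) :
    ∃ A : ℝ, 0 < A ∧ ∀ (a b : ℝ) (γ : ℝ → E N), (∀ t ∈ Icc a b, γ t ∈ Ω) →
      (∀ s ∈ Icc a b, ∀ t ∈ Icc a b, kobayashi Ω (γ s) (γ t) = |s - t|) →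
      ∀ D : ℝ, (∀ t ∈ Icc a b, d (γ t) ≤ D) → ∀ t₀ ∈ Icc a b, D ≤ 2 * d (γ t₀) →
        eVariationOn γ (Icc a b) ≤ ENNReal.ofReal (A * √D) := by
  obtain ⟨τ, B, A₃, hτ, hB, hA₃, H⟩ := h.exists_decay
  refine ⟨16 * B * √A₃, by positivity, ?_⟩
  intro a b γ hγ hgeo D hD t₀ ht₀ hDt₀
  obtain ⟨hloc, hdec⟩ := H a b γ hγ hgeo
  have hD0 : 0 < D := (h.d_pos _ (hγ _ ht₀)).trans_le (hD _ ht₀)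
  obtain ⟨G, hG⟩ : ∃ G, G = 8 * B * (√A₃ * √D) := ⟨_, rfl⟩
  have hG0 : 0 ≤ G := by rw [hG]; positivity
  have loc' : ∀ s ∈ Icc a b, ∀ t ∈ Icc a b, s ≤ t → t - s ≤ τ →
      ‖γ t - γ s‖ ≤ G * Real.exp (-(|s - t₀| / 4)) * ((t - s) / 8) := by
    intro s hs t ht hst hts
    refine (hloc s hs t ht hst hts).trans ?_
    have h1 : √(d (γ s)) ≤ √A₃ * √D * Real.exp (-(|s - t₀| / 4)) := by
      refine Real.sqrt_le_iff.2 ⟨by positivity, (hdec D hD t₀ ht₀ hDt₀ s hs).trans (le_of_eq ?_)⟩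
      rw [mul_pow, mul_pow, Real.sq_sqrt hA₃.le, Real.sq_sqrt hD0.le, sq, ← Real.exp_add]
      ring_nf
    have h2 : 0 ≤ t - s := by linarith
    calc B * (t - s) * √(d (γ s)) ≤ B * (t - s) * (√A₃ * √D * Real.exp (-(|s - t₀| / 4))) := by
          gcongr
      _ = _ := by rw [hG]; ring
  have hτ' : 0 < min τ 1 := by positivity
  have right : ∀ s ∈ Icc t₀ b, ∀ t ∈ Icc t₀ b, s ≤ t →
      ‖γ t - γ s‖ ≤ -G * Real.exp (-((t - t₀) / 4)) - -G * Real.exp (-((s - t₀) / 4)) := by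
    have hsub : Icc t₀ b ⊆ Icc a b := Icc_subset_Icc_left ht₀.1
    refine norm_sub_le_of_local (g := fun t => -G * Real.exp (-((t - t₀) / 4))) hτ' ?_
    intro s hs t ht hst hts
    have h1 := loc' s (hsub hs) t (hsub ht) hst (hts.trans (min_le_left _ _))
    rw [abs_of_nonneg (by linarith [hs.1])] at h1
    refine h1.trans ?_
    have h2 : Real.exp (-((t - t₀) / 4)) =
        Real.exp (-((s - t₀) / 4)) * Real.exp (-((t - s) / 4)) := by
      rw [← Real.exp_add]; ring_nf
    have h3 : Real.exp (-((t - s) / 4)) ≤ 1 - (t - s) / 8 := by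
      have e1 := Real.add_one_le_exp ((t - s) / 4)
      have e2 : Real.exp (-((t - s) / 4)) * Real.exp ((t - s) / 4) = 1 := by
        rw [← Real.exp_add]; simp
      have e3 := hts.trans (min_le_right _ _)
      have e4 := Real.exp_pos (-((t - s) / 4))
      have e5 : Real.exp (-((t - s) / 4)) * ((t - s) / 4 + 1) ≤ 1 :=
        (mul_le_mul_of_nonneg_left e1 e4.le).trans e2.le
      have e6 : 0 ≤ t - s := by linarith
      refine le_of_mul_le_mul_right (e5.trans ?_) (by linarith : 0 < (t - s) / 4 + 1)
      nlinarith
    have h4 : 0 ≤ G * Real.exp (-((s - t₀) / 4)) := by positivity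
    have h5 := mul_le_mul_of_nonneg_left h3 h4
    simp only [h2]
    linarith
  have left : ∀ s ∈ Icc a t₀, ∀ t ∈ Icc a t₀, s ≤ t →
      ‖γ t - γ s‖ ≤ G * Real.exp ((t - t₀) / 4) - G * Real.exp ((s - t₀) / 4) := by
    have hsub : Icc a t₀ ⊆ Icc a b := Icc_subset_Icc_right ht₀.2
    refine norm_sub_le_of_local (g := fun t => G * Real.exp ((t - t₀) / 4)) hτ ?_
    intro s hs t ht hst hts
    have h1 := loc' s (hsub hs) t (hsub ht) hst hts
    rw [abs_of_nonpos (by linarith [hs.2])] at h1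
    have h2 : Real.exp ((t - t₀) / 4) =
        Real.exp ((s - t₀) / 4) * Real.exp ((t - s) / 4) := by
      rw [← Real.exp_add]; ring_nf
    have h3 := Real.add_one_le_exp ((t - s) / 4)
    have h4 : 0 ≤ G * Real.exp ((s - t₀) / 4) := by positivity
    have h5 := mul_le_mul_of_nonneg_left h3 h4
    have h6 : -(-(s - t₀) / 4) = (s - t₀) / 4 := by ring
    rw [h6] at h1
    refine h1.trans ?_
    simp only [h2]
    have h7 : 0 ≤ G * Real.exp ((s - t₀) / 4) * (t - s) := mul_nonneg h4 (by linarith)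
    linarith
  have hsplit := eVariationOn.Icc_add_Icc γ (s := univ) ht₀.1 ht₀.2 (mem_univ _)
  simp only [univ_inter] at hsplit
  rw [← hsplit]
  have hl := eVariationOn_Icc_le (f := γ) (g := fun t => G * Real.exp ((t - t₀) / 4)) ht₀.1 left
  have hr := eVariationOn_Icc_le (f := γ) (g := fun t => -G * Real.exp (-((t - t₀) / 4)))
    ht₀.2 right
  refine (add_le_add (hl.trans (ENNReal.ofReal_le_ofReal (q := G) ?_))
    (hr.trans (ENNReal.ofReal_le_ofReal (q := G) ?_))).trans ?_
  · have : 0 ≤ G * Real.exp ((a - t₀) / 4) := by positivity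
    simp
    linarith
  · have : 0 ≤ G * Real.exp (-((b - t₀) / 4)) := by positivity
    simp
    linarith
  · rw [← ENNReal.ofReal_add hG0 hG0]
    apply ENNReal.ofReal_le_ofReal
    rw [hG]
    linarith

/-- The complex-linear part (up to a factor two) of a real-linear map. -/
def complexPart {G : Type*} [AddCommGroup G] [Module ℂ G] (F : E N →ₗ[ℝ] G) : E N →ₗ[ℂ] G where
  toFun u := F u - Complex.I • F (Complex.I • u)
  map_add' u v := by
    simp only [smul_add, map_add]
    abel
  map_smul' a u := by
    have key : ∀ v : E N, F (a • v) = a.re • F v + a.im • F (Complex.I • v) := fun v => by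
      conv_lhs => rw [← Complex.re_add_im a, add_smul, mul_smul]
      rw [map_add, Complex.coe_smul, Complex.coe_smul, map_smul, map_smul]
    have hII : ∀ v : E N, Complex.I • Complex.I • v = -v := fun v => by
      rw [smul_smul, Complex.I_mul_I, neg_one_smul]
    have hII' : ∀ v : G, Complex.I • Complex.I • v = -v := fun v => by
      rw [smul_smul, Complex.I_mul_I, neg_one_smul]
    rw [smul_comm Complex.I a u, key, key, hII, map_neg]
    conv_rhs => rw [RingHom.id_apply, ← Complex.re_add_im a]
    simp only [smul_add, smul_sub, add_smul, mul_smul, Complex.coe_smul, smul_neg, hII',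
      smul_comm Complex.I a.im, smul_comm Complex.I a.re]
    abel

/-- Real-quadratic forms split into a Hermitian part and the real part of a holomorphic form. -/
theorem exists_holomorphic_quadratic (B : E N →L[ℝ] E N →L[ℝ] ℝ) :
    ∃ q : E N → ℂ, Differentiable ℂ q ∧ q 0 = 0 ∧
      ∀ v, B v v = (q v).re + (B v v + B (Complex.I • v) (Complex.I • v)) / 2 := by
  let S : E N →L[ℂ] E N →L[ℂ] ℂ := LinearMap.toContinuousLinearMap (complexPart
    ((StrongDual.extendRCLikeₗ (𝕜 := ℂ) (F := E N)).toLinearMap ∘ₗ B.toLinearMap))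
  refine ⟨fun v => (1 / 2 : ℂ) * S v v, by fun_prop, by simp, fun v => ?_⟩
  have : S v v = StrongDual.extendRCLike (𝕜 := ℂ) (B v) v -
      Complex.I * StrongDual.extendRCLike (𝕜 := ℂ) (B (Complex.I • v)) v := rfl
  change _ = ((1 / 2 : ℂ) * S v v).re + _
  rw [this, StrongDual.extendRCLike_apply, StrongDual.extendRCLike_apply]
  simp
  ring

/-- Second order Taylor expansion with Peano remainder. -/
theorem eventually_abs_taylor_two_le {ρ : E N → ℝ} {x₀ : E N} (hρ : ContDiffAt ℝ 2 ρ x₀) {ε : ℝ}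
    (hε : 0 < ε) : ∀ᶠ x in 𝓝 x₀, |ρ x - ρ x₀ - fderiv ℝ ρ x₀ (x - x₀) -
      fderiv ℝ (fderiv ℝ ρ) x₀ (x - x₀) (x - x₀) / 2| ≤ ε * ‖x - x₀‖ ^ 2 := by
  have hsymm : IsSymmSndFDerivAt ℝ ρ x₀ := hρ.isSymmSndFDerivAt (by simp)
  have h1 : ∀ᶠ x in 𝓝 x₀, DifferentiableAt ℝ ρ x := by
    filter_upwards [hρ.eventually (by simp)] with x hx using hx.differentiableAt (by simp)
  have h2 : HasFDerivAt (fderiv ℝ ρ) (fderiv ℝ (fderiv ℝ ρ) x₀) x₀ :=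
    ((hρ.fderiv_right (m := 1) (by norm_num)).differentiableAt (by simp)).hasFDerivAt
  have h3 := h2.isLittleO.def hε
  obtain ⟨s, hs, hball⟩ := Metric.eventually_nhds_iff_ball.1 (h1.and h3)
  filter_upwards [ball_mem_nhds x₀ hs] with x hx
  set B := fderiv ℝ (fderiv ℝ ρ) x₀ with hB
  have hsub : closedBall x₀ ‖x - x₀‖ ⊆ ball x₀ s :=
    closedBall_subset_ball (by rwa [← dist_eq_norm])
  have hd : ∀ y ∈ closedBall x₀ ‖x - x₀‖, HasFDerivWithinAt
      (fun y => ρ y - fderiv ℝ ρ x₀ (y - x₀) - B (y - x₀) (y - x₀) / 2)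
      (fderiv ℝ ρ y - fderiv ℝ ρ x₀ - B (y - x₀)) (closedBall x₀ ‖x - x₀‖) y := by
    intro y hy
    have e1 := (hball y (hsub hy)).1.hasFDerivAt
    have e0 : HasFDerivAt (fun y : E N => y - x₀) (ContinuousLinearMap.id ℝ (E N)) y :=
      (hasFDerivAt_id y).sub_const x₀
    have e2 := (fderiv ℝ ρ x₀).hasFDerivAt.comp y e0
    have e3 := ((B.hasFDerivAt.comp y e0).clm_apply e0).const_mul (1 / 2 : ℝ)
    refine (((e1.sub e2).sub e3).congr_fderiv ?_ |>.congr_of_eventuallyEq ?_).hasFDerivWithinAt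
    · ext v
      have h4 : B (y - x₀) v = B v (y - x₀) := hsymm (y - x₀) v
      simp only [map_sub, _root_.sub_apply] at h4
      simp
      linarith
    · refine Eventually.of_forall fun z => ?_
      simp
      ring
  have := (convex_closedBall x₀ ‖x - x₀‖).norm_image_sub_le_of_norm_hasFDerivWithin_le hd
    (C := ε * ‖x - x₀‖) (fun y hy => ((hball y (hsub hy)).2).trans (by
      have := mem_closedBall_iff_norm.1 hy
      gcongr)) (mem_closedBall_self (norm_nonneg _)) (mem_closedBall_iff_norm.2 le_rfl)
  rw [Real.norm_eq_abs] at this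
  calc _ = _ := by congr 1; simp; ring
    _ ≤ _ := this
    _ = _ := by ring

/-- Second order expansion in terms of a holomorphic function and the Levi form. -/
theorem exists_holomorphic_levi_expansion {ρ : E N → ℝ} {x₀ : E N} (hρ : ContDiffAt ℝ 2 ρ x₀) :
    ∃ P : E N → ℂ, Differentiable ℂ P ∧ P x₀ = 0 ∧ ∀ ε, 0 < ε → ∀ᶠ x in 𝓝 x₀,
      ρ x₀ + (P x).re + levi ρ x₀ (x - x₀) - ε * ‖x - x₀‖ ^ 2 ≤ ρ x := by
  obtain ⟨q, hq, hq0, hqB⟩ := exists_holomorphic_quadratic (fderiv ℝ (fderiv ℝ ρ) x₀)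
  refine ⟨fun x => StrongDual.extendRCLike (𝕜 := ℂ) (fderiv ℝ ρ x₀) (x - x₀) +
    (1 / 2 : ℂ) * q (x - x₀), by fun_prop, by simp [hq0], fun ε hε => ?_⟩
  filter_upwards [eventually_abs_taylor_two_le hρ hε] with x hx
  have h1 := hqB (x - x₀)
  have h2 : (StrongDual.extendRCLike (𝕜 := ℂ) (fderiv ℝ ρ x₀) (x - x₀)).re =
      fderiv ℝ ρ x₀ (x - x₀) := by
    simp [StrongDual.extendRCLike_apply]
  have h3 : ((1 / 2 : ℂ) * q (x - x₀)).re = (q (x - x₀)).re / 2 := by simp; ring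
  simp only [Complex.add_re, h2, h3, levi, iteratedFDeriv_two_apply]
  simp only [Matrix.cons_val_zero, Matrix.cons_val_one]
  linarith [(abs_le.1 hx).1]

/-- On a compact set, a function which is positive on the zeros of a nonnegative function becomes
positive after adding a large multiple of the latter. -/
theorem exists_pos_le_add_mul {X : Type*} [TopologicalSpace X] {S : Set X} (hS : IsCompact S)
    {L V : X → ℝ} (hL : ContinuousOn L S) (hV : ContinuousOn V S) (hV0 : ∀ s ∈ S, 0 ≤ V s)
    (hpos : ∀ s ∈ S, V s = 0 → 0 < L s) :
    ∃ A c : ℝ, 0 < A ∧ 0 < c ∧ ∀ s ∈ S, c ≤ L s + A * V s := by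
  obtain ⟨m, hm, hle⟩ := hS.exists_forall_le' (f := fun s => max (L s) (V s)) (a := (0 : ℝ))
    (hL.sup hV) (fun s hs => by
    rcases (hV0 s hs).eq_or_lt with h | h
    · exact lt_max_of_lt_left (hpos s hs h.symm)
    · exact lt_max_of_lt_right h)
  obtain ⟨M, hM⟩ := hS.exists_bound_of_continuousOn hL
  have hM0 : 0 ≤ |M| := abs_nonneg M
  refine ⟨(|M| + m) / m, m, by positivity, hm, fun s hs => ?_⟩
  have h0 : 0 < (|M| + m) / m := by positivity
  rcases le_max_iff.1 (hle s hs) with h | h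
  · have := mul_nonneg h0.le (hV0 s hs)
    linarith
  · have h1 : (|M| + m) / m * m ≤ (|M| + m) / m * V s := by gcongr
    have h2 : (|M| + m) / m * m = |M| + m := by field_simp
    have h3 := (abs_le.1 ((Real.norm_eq_abs _).symm.trans_le (hM s hs))).1
    linarith [le_abs_self M]

theorem levi_smul (ρ : E N → ℝ) (x v : E N) (t : ℝ) : levi ρ x (t • v) = t ^ 2 * levi ρ x v := by
  simp only [levi, iteratedFDeriv_two_apply, Matrix.cons_val_zero, Matrix.cons_val_one,
    smul_comm Complex.I t, map_smul, smul_apply, smul_eq_mul]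
  ring

/-- Strict positivity of the Levi form on the complex tangent space gives strict positivity of the
Levi form, up to the square of the complex differential, on a neighbourhood of the boundary. -/
theorem exists_levi_lower_bound {ρ : E N → ℝ} {U K : Set (E N)} (hU : IsOpen U)
    (hρ : ContDiffOn ℝ 2 ρ U) (hK : IsCompact K) (hKU : K ⊆ U) (hneg : ∀ x ∈ K, ρ x ≤ 0)
    (hlevi : ∀ x ∈ K, ρ x = 0 → ∀ v : E N, v ≠ 0 → fderiv ℝ ρ x v = 0 →
      fderiv ℝ ρ x (Complex.I • v) = 0 → 0 < levi ρ x v) :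
    ∃ A c : ℝ, 0 < A ∧ 0 < c ∧ ∀ x ∈ K, A * -ρ x ≤ c → ∀ v : E N, c * ‖v‖ ^ 2 ≤ levi ρ x v +
      A * ‖StrongDual.extendRCLike (𝕜 := ℂ) (fderiv ℝ ρ x) v‖ ^ 2 := by
  have hF : ContinuousOn (fderiv ℝ ρ) K := (hρ.continuousOn_fderiv_of_isOpen hU (by simp)).mono hKU
  have hG : ContinuousOn (fderiv ℝ (fderiv ℝ ρ)) K :=
    ((hρ.fderiv_of_isOpen hU (m := 1) (by norm_num)).continuousOn_fderiv_of_isOpen hU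
      (by simp)).mono hKU
  have hS : IsCompact (K ×ˢ sphere (0 : E N) 1) := hK.prod (isCompact_sphere _ _)
  have hfst : MapsTo Prod.fst (K ×ˢ sphere (0 : E N) 1) K := fun p hp => hp.1
  have hF' := hF.comp continuousOn_fst hfst
  have hG' := hG.comp continuousOn_fst hfst
  have hL : ContinuousOn (fun p : E N × E N => levi ρ p.1 p.2) (K ×ˢ sphere (0 : E N) 1) := by
    simp only [levi, iteratedFDeriv_two_apply, Matrix.cons_val_zero, Matrix.cons_val_one]
    have hI : ContinuousOn (fun p : E N × E N => Complex.I • p.2) (K ×ˢ sphere (0 : E N) 1) := by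
      fun_prop
    exact (((hG'.clm_apply continuousOn_snd).clm_apply continuousOn_snd).add
      ((hG'.clm_apply hI).clm_apply hI)).div_const _
  have hE : ContinuousOn (fun p : E N × E N =>
      StrongDual.extendRCLike (𝕜 := ℂ) (fderiv ℝ ρ p.1) p.2) (K ×ˢ sphere (0 : E N) 1) :=
    ((StrongDual.extendRCLikeL (𝕜 := ℂ) (F := E N)).continuous.comp_continuousOn hF').clm_apply
      continuousOn_snd
  have hV : ContinuousOn (fun p : E N × E N =>
      ‖StrongDual.extendRCLike (𝕜 := ℂ) (fderiv ℝ ρ p.1) p.2‖ ^ 2 + -ρ p.1)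
      (K ×ˢ sphere (0 : E N) 1) :=
    (hE.norm.pow 2).add ((hρ.continuousOn.mono hKU).comp continuousOn_fst hfst).neg
  obtain ⟨A, c, hA, hc, H⟩ := exists_pos_le_add_mul hS hL hV
    (fun p hp => add_nonneg (sq_nonneg _) (neg_nonneg.2 (hneg _ hp.1))) (fun p hp h0 => by
      have h1 := hneg _ hp.1
      have h2 := sq_nonneg ‖StrongDual.extendRCLike (𝕜 := ℂ) (fderiv ℝ ρ p.1) p.2‖
      have h3 : StrongDual.extendRCLike (𝕜 := ℂ) (fderiv ℝ ρ p.1) p.2 = 0 := by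
        rw [← norm_eq_zero, ← sq_eq_zero_iff]; linarith
      refine hlevi _ hp.1 (by linarith) _ (ne_zero_of_mem_unit_sphere ⟨p.2, hp.2⟩) ?_ ?_
      · simpa [StrongDual.extendRCLike_apply] using congrArg Complex.re h3
      · simpa [StrongDual.extendRCLike_apply] using congrArg Complex.im h3)
  refine ⟨A, c / 2, hA, by positivity, fun x hx hρx v => ?_⟩
  rcases eq_or_ne v 0 with rfl | hv
  · simp [levi, iteratedFDeriv_two_apply]
  · have hv' : 0 < ‖v‖ := norm_pos_iff.2 hv
    have h1 := H (x, ‖v‖⁻¹ • v) ⟨hx, by simp [norm_smul, hv'.ne']⟩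
    obtain ⟨f, hf⟩ : ∃ f, f = StrongDual.extendRCLike (𝕜 := ℂ) (fderiv ℝ ρ x) := ⟨_, rfl⟩
    simp only [levi_smul, ← hf] at h1 ⊢
    have h2 : ‖f (‖v‖⁻¹ • v)‖ ^ 2 = ‖v‖⁻¹ ^ 2 * ‖f v‖ ^ 2 := by
      rw [← Complex.coe_smul, map_smul, norm_smul, mul_pow]
      simp
    rw [h2] at h1
    have h3 : c / 2 ≤ ‖v‖⁻¹ ^ 2 * (levi ρ x v + A * ‖f v‖ ^ 2) := by linarith
    calc c / 2 * ‖v‖ ^ 2 ≤ ‖v‖⁻¹ ^ 2 * (levi ρ x v + A * ‖f v‖ ^ 2) * ‖v‖ ^ 2 := by gcongr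
      _ = _ := by field_simp

/-- If the Levi form of `ρ` is positive up to the square of the complex differential, then
`ρ + 2 A ρ ^ 2` has a strict holomorphic support where `ρ` is small. -/
theorem exists_support_of_levi_lower_bound {ρ : E N → ℝ} {x₀ : E N} (hρ : ContDiffAt ℝ 2 ρ x₀)
    {A c : ℝ} (hA : 0 < A) (hc : 0 < c) (h0 : ρ x₀ ≤ 0) (hA0 : 8 * (A * -ρ x₀) ≤ 1)
    (hlevi : ∀ v : E N, c * ‖v‖ ^ 2 ≤ levi ρ x₀ v +
      A * ‖StrongDual.extendRCLike (𝕜 := ℂ) (fderiv ℝ ρ x₀) v‖ ^ 2) :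
    ∃ P : E N → ℂ, Differentiable ℂ P ∧ P x₀ = 0 ∧ ∀ᶠ x in 𝓝 x₀,
      ρ x₀ + 2 * A * ρ x₀ ^ 2 + (P x).re + c / 4 * ‖x - x₀‖ ^ 2 ≤ ρ x + 2 * A * ρ x ^ 2 := by
  obtain ⟨p, hp, hp0, hpρ⟩ := exists_holomorphic_levi_expansion hρ
  obtain ⟨f, hf⟩ : ∃ f, f = StrongDual.extendRCLike (𝕜 := ℂ) (fderiv ℝ ρ x₀) := ⟨_, rfl⟩
  have hfre : ∀ v, (f v).re = fderiv ℝ ρ x₀ v := fun v => by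
    simp [hf, StrongDual.extendRCLike_apply]
  rw [← hf] at hlevi
  obtain ⟨s, hs⟩ : ∃ s : ℝ, s = 1 + 4 * A * ρ x₀ := ⟨_, rfl⟩
  refine ⟨fun x => (s : ℂ) * p x + (A : ℂ) * f (x - x₀) ^ 2, by fun_prop, by simp [hp0], ?_⟩
  obtain ⟨M, hM⟩ : ∃ M, M = ‖fderiv ℝ ρ x₀‖ := ⟨_, rfl⟩
  have hM0 : 0 ≤ M := hM ▸ norm_nonneg _
  have hε : 0 < c / (32 * A * (M + 1)) := by positivity
  have hd := (hρ.differentiableAt (by simp)).hasFDerivAt.isLittleO.def hε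
  filter_upwards [hd, hpρ (c / 8) (by positivity)] with x hx hpx
  have hL := hlevi (x - x₀)
  have hre : (f (x - x₀)).re = fderiv ℝ ρ x₀ (x - x₀) := hfre _
  have hMv : |fderiv ℝ ρ x₀ (x - x₀)| ≤ M * ‖x - x₀‖ :=
    hM ▸ (fderiv ℝ ρ x₀).le_opNorm (x - x₀)
  have hsq : ‖f (x - x₀)‖ ^ 2 = (f (x - x₀)).re ^ 2 + (f (x - x₀)).im ^ 2 := by
    rw [Complex.sq_norm, Complex.normSq_apply]; ring
  have hP : ((s : ℂ) * p x + (A : ℂ) * f (x - x₀) ^ 2).re =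
      s * (p x).re + A * ((f (x - x₀)).re ^ 2 - (f (x - x₀)).im ^ 2) := by
    simp [sq]
  rw [hP]
  rw [hre] at hsq ⊢
  rw [Real.norm_eq_abs] at hx
  obtain ⟨n, hn⟩ : ∃ n, n = ‖x - x₀‖ := ⟨_, rfl⟩
  obtain ⟨F, hF⟩ : ∃ F, F = fderiv ℝ ρ x₀ (x - x₀) := ⟨_, rfl⟩
  obtain ⟨Δ, hΔ⟩ : ∃ Δ, Δ = ρ x - ρ x₀ := ⟨_, rfl⟩
  have hn0 : 0 ≤ n := hn ▸ norm_nonneg _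
  rw [← hn] at hx hMv hpx hL ⊢
  rw [← hF, ← hΔ] at hx
  rw [← hF] at hMv hsq ⊢
  have hcross : |(Δ - F) * F| ≤ c / (32 * A) * n ^ 2 := by
    rw [abs_mul]
    calc |Δ - F| * |F| ≤ c / (32 * A * (M + 1)) * n * ((M + 1) * n) := by
          gcongr
          linarith
      _ = _ := by field_simp
  have hcross' : -(c / 32 * n ^ 2) ≤ A * ((Δ - F) * F) := by
    have h1 := mul_le_mul_of_nonneg_left (abs_le.1 hcross).1 hA.le
    have h2 : A * -(c / (32 * A) * n ^ 2) = -(c / 32 * n ^ 2) := by field_simp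
    linarith
  have hs1 : s ≤ 1 := by rw [hs]; nlinarith
  have hs2 : 1 / 2 ≤ s := by rw [hs]; linarith
  have e1 : A * F ^ 2 + 2 * (A * ((Δ - F) * F)) ≤ A * Δ ^ 2 := by
    have := mul_nonneg hA.le (sq_nonneg (Δ - F))
    linarith
  have e2 : s * ((p x).re + levi ρ x₀ (x - x₀) - c / 8 * n ^ 2) ≤ s * Δ :=
    mul_le_mul_of_nonneg_left (by linarith) (by linarith)
  have e3 : s * (c * n ^ 2) ≤ s * (levi ρ x₀ (x - x₀) + A * ‖f (x - x₀)‖ ^ 2) :=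
    mul_le_mul_of_nonneg_left hL (by linarith)
  have e4 : 0 ≤ (1 - s) * (A * ‖f (x - x₀)‖ ^ 2) :=
    mul_nonneg (by linarith) (by positivity)
  have e5 : 0 ≤ c * n ^ 2 := by positivity
  have e6 : 0 ≤ (s - 1 / 2) * (c * n ^ 2) := mul_nonneg (by linarith) e5
  have e7 : A * ‖f (x - x₀)‖ ^ 2 = A * (F ^ 2 + (f (x - x₀)).im ^ 2) := by rw [hsq]
  have e8 : ρ x + 2 * A * ρ x ^ 2 - (ρ x₀ + 2 * A * ρ x₀ ^ 2) = s * Δ + 2 * (A * Δ ^ 2) := by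
    rw [hs, hΔ]; ring
  linarith

theorem exists_support_norm_sq (x₀ : E N) (η R : ℝ) :
    ∃ P : E N → ℂ, Differentiable ℂ P ∧ P x₀ = 0 ∧ ∀ x,
      η * (‖x‖ ^ 2 - R) = η * (‖x₀‖ ^ 2 - R) + (P x).re + η * ‖x - x₀‖ ^ 2 := by
  refine ⟨fun x => (2 * η : ℂ) * innerSL ℂ x₀ (x - x₀), by fun_prop, by simp, fun x => ?_⟩
  have h1 := norm_sub_sq_expand x x₀ 0
  simp only [sub_zero] at h1
  have h2 : ((2 * η : ℂ) * innerSL ℂ x₀ (x - x₀)).re = 2 * η * (inner ℂ x₀ (x - x₀)).re := by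
    rw [innerSL_apply_apply, show (2 * η : ℂ) = ((2 * η : ℝ) : ℂ) by push_cast; rfl,
      Complex.re_ofReal_mul]
  rw [h2, h1]
  ring

/-- A bounded strictly plurisubharmonic exhaustion bounded below by a strictly plurisubharmonic
defining function. -/
theorem exists_strictPshOn {ρ : E N → ℝ} {Ω : Set (E N)} (hΩ : IsOpen Ω)
    (hbd : Bornology.IsBounded Ω)
    (hρ : ContDiffOn ℝ 2 ρ Ω) (hneg : ∀ x ∈ Ω, ρ x < 0) {A c : ℝ} (hA : 0 < A) (hc : 0 < c)
    (hlevi : ∀ x ∈ Ω, A * -ρ x ≤ c → ∀ v : E N, c * ‖v‖ ^ 2 ≤ levi ρ x v +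
      A * ‖StrongDual.extendRCLike (𝕜 := ℂ) (fderiv ℝ ρ x) v‖ ^ 2) :
    ∃ (ψ : E N → ℝ) (c' : ℝ), 0 < c' ∧ StrictPshOn Ω ψ c' ∧ ContinuousOn ψ Ω ∧
      (∀ x ∈ Ω, ψ x ≤ 0) ∧ ∀ x ∈ Ω, ρ x ≤ ψ x := by
  obtain ⟨R, hR, hRΩ⟩ := hbd.exists_pos_norm_le
  obtain ⟨m₀, hm₀, hm1, hm2⟩ : ∃ m₀ : ℝ, 0 < m₀ ∧ A * m₀ ≤ c ∧ 8 * (A * m₀) ≤ 1 := by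
    refine ⟨min c (1 / 8) / A, by positivity, ?_, ?_⟩
    · rw [mul_div_cancel₀ _ hA.ne']; exact min_le_left _ _
    · rw [mul_div_cancel₀ _ hA.ne']; linarith [min_le_right c (1 / 8)]
  obtain ⟨η, hη0, hη⟩ : ∃ η : ℝ, 0 < η ∧ η * R ^ 2 = 3 * m₀ / 4 :=
    ⟨3 * m₀ / (4 * R ^ 2), by positivity, by field_simp⟩
  have hρc := hρ.continuousOn
  obtain ⟨u, hu⟩ : ∃ u : E N → ℝ, u = fun x => -min (-ρ x) m₀ + 2 * A * min (-ρ x) m₀ ^ 2 :=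
    ⟨_, rfl⟩
  have hbound : ∀ x ∈ Ω, ρ x ≤ u x ∧ u x ≤ 0 := by
    intro x hx
    have h0 : 0 < min (-ρ x) m₀ := lt_min (by linarith [hneg x hx]) hm₀
    have h1 := min_le_left (-ρ x) m₀
    have h2 := min_le_right (-ρ x) m₀
    rw [hu]
    simp only
    obtain ⟨m, hm⟩ : ∃ m, m = min (-ρ x) m₀ := ⟨_, rfl⟩
    rw [← hm] at h0 h1 h2 ⊢
    have h3 : A * m ≤ A * m₀ := by gcongr
    have h4 : m * (A * m) ≤ m * (1 / 8) := by gcongr; linarith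
    have h5 : 0 ≤ m * (A * m) := by positivity
    constructor <;> linarith
  refine ⟨fun x => max (u x) (η * (‖x‖ ^ 2 - R ^ 2)), min (c / 4) η, by positivity, ?_, ?_, ?_, ?_⟩
  · intro x₀ hx₀
    have second : u x₀ ≤ η * (‖x₀‖ ^ 2 - R ^ 2) → ∃ P : E N → ℂ, Differentiable ℂ P ∧ P x₀ = 0 ∧
        ∀ᶠ x in 𝓝 x₀, max (u x₀) (η * (‖x₀‖ ^ 2 - R ^ 2)) + (P x).re +
          min (c / 4) η * ‖x - x₀‖ ^ 2 ≤ max (u x) (η * (‖x‖ ^ 2 - R ^ 2)) := by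
      intro hle
      obtain ⟨P, hP, hP0, hPx⟩ := exists_support_norm_sq x₀ η (R ^ 2)
      refine ⟨P, hP, hP0, Eventually.of_forall fun x => ?_⟩
      rw [max_eq_right hle]
      refine le_max_of_le_right ?_
      rw [hPx x]
      have := mul_le_mul_of_nonneg_right (min_le_right (c / 4) η) (sq_nonneg ‖x - x₀‖)
      linarith
    rcases le_total (u x₀) (η * (‖x₀‖ ^ 2 - R ^ 2)) with hle | hle
    · exact second hle
    · rcases lt_or_ge (-ρ x₀) m₀ with hlt | hge
      · have hAρ : A * -ρ x₀ ≤ A * m₀ := by gcongr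
        obtain ⟨P, hP, hP0, hPx⟩ := exists_support_of_levi_lower_bound
          (hρ.contDiffAt (hΩ.mem_nhds hx₀)) hA hc (hneg _ hx₀).le (by linarith)
          (hlevi x₀ hx₀ (by linarith))
        refine ⟨P, hP, hP0, ?_⟩
        have hev : ∀ᶠ x in 𝓝 x₀, -ρ x < m₀ :=
          (hρc.continuousAt (hΩ.mem_nhds hx₀)).neg.eventually_lt continuousAt_const hlt
        have hux : ∀ x, -ρ x < m₀ → u x = ρ x + 2 * A * ρ x ^ 2 := fun x hx => by
          rw [hu]
          simp only [min_eq_left hx.le]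
          ring
        filter_upwards [hPx, hev] with x h1 h2
        rw [max_eq_left hle, hux x₀ hlt]
        refine le_max_of_le_left ?_
        rw [hux x h2]
        have := mul_le_mul_of_nonneg_right (min_le_left (c / 4) η) (sq_nonneg ‖x - x₀‖)
        linarith
      · refine second ?_
        rw [hu]
        simp only [min_eq_right hge]
        have h1 : 0 ≤ η * ‖x₀‖ ^ 2 := by positivity
        have h2 : m₀ * (A * m₀) ≤ m₀ * (1 / 8) := by gcongr; linarith
        linarith
  · rw [hu]
    have hmin : ContinuousOn (fun x => min (-ρ x) m₀) Ω := hρc.neg.inf continuousOn_const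
    have h1 : ContinuousOn (fun x => -min (-ρ x) m₀ + 2 * A * min (-ρ x) m₀ ^ 2) Ω := by fun_prop
    have h2 : ContinuousOn (fun x : E N => η * (‖x‖ ^ 2 - R ^ 2)) Ω := by fun_prop
    exact h1.sup h2
  · intro x hx
    refine max_le (hbound x hx).2 (mul_nonpos_of_nonneg_of_nonpos hη0.le ?_)
    have := hRΩ x hx
    have : ‖x‖ ^ 2 ≤ R ^ 2 := by gcongr
    linarith
  · exact fun x hx => (hbound x hx).1.trans (le_max_left _ _)

/-- First order Taylor estimates on uniform neighbourhoods of a compact set. -/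
theorem exists_uniform_taylor {ρ : E N → ℝ} {U K : Set (E N)} (hU : IsOpen U)
    (hρ : ContDiffOn ℝ 2 ρ U) (hK : IsCompact K) (hKU : K ⊆ U) :
    ∃ r M : ℝ, 0 < r ∧ 0 ≤ M ∧ (∀ x ∈ K, |ρ x| ≤ M ∧ ‖fderiv ℝ ρ x‖ ≤ M) ∧
      ∀ x ∈ K, ∀ y, ‖y - x‖ ≤ r → y ∈ U ∧ |ρ y - ρ x| ≤ M * ‖y - x‖ ∧
        ‖fderiv ℝ ρ y - fderiv ℝ ρ x‖ ≤ M * ‖y - x‖ ∧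
        |ρ y - ρ x - fderiv ℝ ρ x (y - x)| ≤ M * ‖y - x‖ ^ 2 := by
  obtain ⟨r, hr, hrU⟩ := hK.exists_cthickening_subset_open hU hKU
  have hK' : IsCompact (cthickening r K) := hK.cthickening
  have hdF := hρ.fderiv_of_isOpen hU (m := 1) (by norm_num)
  have hF : ContinuousOn (fderiv ℝ ρ) U := hρ.continuousOn_fderiv_of_isOpen hU (by simp)
  have hG : ContinuousOn (fderiv ℝ (fderiv ℝ ρ)) U := hdF.continuousOn_fderiv_of_isOpen hU (by simp)
  obtain ⟨M₀, hM₀⟩ := hK'.exists_bound_of_continuousOn (hρ.continuousOn.mono hrU)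
  obtain ⟨M₁, hM₁⟩ := hK'.exists_bound_of_continuousOn (hF.mono hrU)
  obtain ⟨M₂, hM₂⟩ := hK'.exists_bound_of_continuousOn
    (f := fderiv ℝ (fderiv ℝ ρ)) (hG.mono hrU)
  have hKr : K ⊆ cthickening r K := self_subset_cthickening K
  have hball : ∀ x ∈ K, ∀ s ≤ r, closedBall x s ⊆ cthickening r K := fun x hx s hs =>
    (closedBall_subset_closedBall hs).trans (closedBall_subset_cthickening hx r)
  have hle : |M₀| ≤ |M₀| + |M₁| + |M₂| ∧ |M₁| ≤ |M₀| + |M₁| + |M₂| ∧ |M₂| ≤ |M₀| + |M₁| + |M₂| := by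
    refine ⟨?_, ?_, ?_⟩ <;> linarith [abs_nonneg M₀, abs_nonneg M₁, abs_nonneg M₂]
  refine ⟨r, |M₀| + |M₁| + |M₂|, hr, by positivity, fun x hx => ⟨?_, ?_⟩, fun x hx y hy => ?_⟩
  · exact (hM₀ x (hKr hx)).trans ((le_abs_self _).trans hle.1)
  · exact (hM₁ x (hKr hx)).trans ((le_abs_self _).trans hle.2.1)
  have hsub := hball x hx ‖y - x‖ hy
  have hconv := convex_closedBall x ‖y - x‖
  have hxm : x ∈ closedBall x ‖y - x‖ := mem_closedBall_self (norm_nonneg _)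
  have hym : y ∈ closedBall x ‖y - x‖ := mem_closedBall_iff_norm.2 le_rfl
  have hd : ∀ z ∈ closedBall x ‖y - x‖, HasFDerivWithinAt ρ (fderiv ℝ ρ z)
      (closedBall x ‖y - x‖) z := fun z hz =>
    ((hρ.contDiffAt (hU.mem_nhds (hrU (hsub hz)))).differentiableAt
      (by simp)).hasFDerivAt.hasFDerivWithinAt
  have hd2 : ∀ z ∈ closedBall x ‖y - x‖, HasFDerivWithinAt (fderiv ℝ ρ) (fderiv ℝ (fderiv ℝ ρ) z)
      (closedBall x ‖y - x‖) z := fun z hz =>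
    ((hdF.contDiffAt (hU.mem_nhds (hrU (hsub hz)))).differentiableAt
      (by simp)).hasFDerivAt.hasFDerivWithinAt
  have hlip : ∀ z ∈ closedBall x ‖y - x‖,
      ‖fderiv ℝ ρ z - fderiv ℝ ρ x‖ ≤ (|M₀| + |M₁| + |M₂|) * ‖z - x‖ := fun z hz =>
    hconv.norm_image_sub_le_of_norm_hasFDerivWithin_le hd2
      (fun w hw => (hM₂ w (hsub hw)).trans ((le_abs_self _).trans hle.2.2)) hxm hz
  refine ⟨hrU (hsub hym), ?_, hlip y hym, ?_⟩
  · exact hconv.norm_image_sub_le_of_norm_hasFDerivWithin_le hd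
      (fun w hw => (hM₁ w (hsub hw)).trans ((le_abs_self _).trans hle.2.1)) hxm hym
  · have := hconv.norm_image_sub_le_of_norm_hasFDerivWithin_le' hd (φ := fderiv ℝ ρ x)
      (C := (|M₀| + |M₁| + |M₂|) * ‖y - x‖) (fun z hz => (hlip z hz).trans (by
        have := mem_closedBall_iff_norm.1 hz
        gcongr)) hxm hym
    rw [Real.norm_eq_abs] at this
    linarith

/-- Strongly pseudoconvex domains are controlled by their defining functions. -/
theorem IsStronglyPseudoconvexDomain.exists_controlled {α : ℝ}
    (hΩ : IsStronglyPseudoconvexDomain 2 α Ω) :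
    ∃ (d : E N → ℝ) (ℓ : E N → E N →L[ℂ] ℂ) (ψ : E N → ℝ) (C r c d₀ g₀ : ℝ),
      Controlled Ω d ℓ ψ C r c d₀ g₀ ∧ ∀ x ∈ Ω, ∀ p ∈ frontier Ω, d x ≤ C * ‖p - x‖ := by
  obtain ⟨hopen, hconn, hbd, U, ρ, hU, hKU, ⟨hρ, -⟩, hΩρ, hgrad, hlevi⟩ := hΩ
  have hρ : ContDiffOn ℝ 2 ρ U := hρ
  have hK : IsCompact (closure Ω) := hbd.isCompact_closure
  have hneg : ∀ x ∈ Ω, ρ x < 0 := fun x hx => by rw [hΩρ] at hx; exact hx.2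
  have hmem : ∀ x ∈ U, ρ x < 0 → x ∈ Ω := fun x h1 h2 => by rw [hΩρ]; exact ⟨h1, h2⟩
  have hΩK : Ω ⊆ closure Ω := subset_closure
  have hρK : ContinuousOn ρ (closure Ω) := hρ.continuousOn.mono hKU
  have hle : ∀ x ∈ closure Ω, ρ x ≤ 0 := fun x hx =>
    closure_minimal (s := Ω) (t := closure Ω ∩ ρ ⁻¹' Iic 0) (fun y hy => ⟨hΩK hy, (hneg y hy).le⟩)
      (hρK.preimage_isClosed_of_isClosed isClosed_closure isClosed_Iic) hx |>.2
  have hfr : ∀ x ∈ closure Ω, ρ x = 0 → x ∈ frontier Ω := fun x hx h0 =>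
    hopen.frontier_eq ▸ ⟨hx, fun h => (hneg x h).ne h0⟩
  have hfr0 : ∀ x ∈ frontier Ω, ρ x = 0 := fun x hx => by
    rw [hopen.frontier_eq] at hx
    exact le_antisymm (hle x hx.1) (not_lt.1 fun h => hx.2 (hmem x (hKU hx.1) h))
  obtain ⟨A, c, hA, hc, hlow⟩ := exists_levi_lower_bound hU hρ hK hKU hle
    (fun x hx h0 => hlevi x (hfr x hx h0))
  obtain ⟨ψ, c', hc', hψ, hψc, hψ0, hψρ⟩ := exists_strictPshOn hopen hbd (hρ.mono (hΩK.trans hKU))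
    hneg hA hc (fun x hx => hlow x (hΩK hx))
  obtain ⟨r, M, hr, hM, hb, htay⟩ := exists_uniform_taylor hU hρ hK hKU
  obtain ⟨g, hg, hgle⟩ := hK.exists_forall_le' (f := fun x => ‖fderiv ℝ ρ x‖ + -ρ x) (a := (0 : ℝ))
    ((hρ.continuousOn_fderiv_of_isOpen hU (by simp)).mono hKU |>.norm.add hρK.neg) (fun x hx => by
      rcases (hle x hx).eq_or_lt with h | h
      · rw [h, neg_zero, add_zero]
        exact norm_pos_iff.2 (hgrad x (hfr x hx h))
      · have := norm_nonneg (fderiv ℝ ρ x)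
        linarith)
  have hre : ∀ x v, (StrongDual.extendRCLike (𝕜 := ℂ) (fderiv ℝ ρ x) v).re = fderiv ℝ ρ x v :=
    fun x v => by simp [StrongDual.extendRCLike_apply]
  obtain ⟨C, hC⟩ : ∃ C, C = 1 + M + 2 * M / r + 2 * M / r ^ 2 := ⟨_, rfl⟩
  have hMr : 0 ≤ 2 * M / r := by positivity
  have hMr2 : 0 ≤ 2 * M / r ^ 2 := by positivity
  have hfar : ∀ t, r < t → 2 * M ≤ 2 * M / r * t ∧ 2 * M ≤ 2 * M / r ^ 2 * t ^ 2 := by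
    intro t ht
    constructor
    · calc 2 * M = 2 * M / r * r := by field_simp
        _ ≤ _ := by gcongr
    · calc 2 * M = 2 * M / r ^ 2 * r ^ 2 := by field_simp
        _ ≤ _ := by gcongr
  have hCM : M ≤ C := by linarith
  refine ⟨fun x => -ρ x, fun x => StrongDual.extendRCLike (𝕜 := ℂ) (fderiv ℝ ρ x), ψ, C, r, c',
    g / 2, g / 2, ⟨by linarith, hr, hc', by positivity, by positivity, hopen, hconn,
      fun x hx => neg_pos.2 (hneg x hx), fun x hx => ?_, ?_, ?_, ?_, ?_, ?_, ?_, hψ, hψc, hψ0, ?_⟩,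
    ?_⟩
  · linarith [(abs_le.1 (hb x (hΩK hx)).1).1]
  · intro x hx y hy hlt
    obtain ⟨h1, -, -, h2⟩ := htay x (hΩK hx) y hy
    refine hmem y h1 ?_
    rw [hre] at hlt
    have := mul_le_mul_of_nonneg_right hCM (sq_nonneg ‖y - x‖)
    linarith [(abs_le.1 h2).2]
  · intro x hx y hy
    simp only [hre]
    rw [show -ρ y - -ρ x + fderiv ℝ ρ x (y - x) = -(ρ y - ρ x - fderiv ℝ ρ x (y - x)) by ring,
      abs_neg]
    rcases le_or_gt ‖y - x‖ r with h | h
    · exact (htay x (hΩK hx) y h).2.2.2.trans (by gcongr)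
    · have h1 := abs_le.1 (hb x (hΩK hx)).1
      have h2 := abs_le.1 (hb y (hΩK hy)).1
      obtain ⟨t, ht⟩ : ∃ t, t = ‖y - x‖ := ⟨_, rfl⟩
      have h3 : |fderiv ℝ ρ x (y - x)| ≤ M * ‖y - x‖ :=
        (fderiv ℝ ρ x).le_of_opNorm_le (hb x (hΩK hx)).2 (y - x)
      have h3' := abs_le.1 h3
      rw [← ht] at h h3' ⊢
      have ht0 : 0 < t := hr.trans h
      obtain ⟨h4, h5⟩ := hfar t h
      have h6 : M * t ≤ 2 * M / r * t ^ 2 := by nlinarith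
      have h7 : 0 ≤ (1 + M) * t ^ 2 := by positivity
      rw [hC, abs_le]
      constructor <;> linarith
  · intro x hx y hy
    have e : StrongDual.extendRCLike (𝕜 := ℂ) (fderiv ℝ ρ x) -
        StrongDual.extendRCLike (𝕜 := ℂ) (fderiv ℝ ρ y) =
        StrongDual.extendRCLike (𝕜 := ℂ) (fderiv ℝ ρ x - fderiv ℝ ρ y) :=
      (map_sub (StrongDual.extendRCLikeₗ (𝕜 := ℂ) (F := E N)) _ _).symm
    rw [e, StrongDual.norm_extendRCLike]
    rcases le_or_gt ‖x - y‖ r with h | h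
    · exact (htay y (hΩK hy) x h).2.2.1.trans (by gcongr)
    · refine (norm_sub_le _ _).trans ?_
      have h1 := (hb x (hΩK hx)).2
      have h2 := (hb y (hΩK hy)).2
      obtain ⟨h4, -⟩ := hfar _ h
      have h6 : 2 * M / r * ‖x - y‖ ≤ C * ‖x - y‖ := by gcongr; linarith
      linarith
  · intro x hx
    rw [StrongDual.norm_extendRCLike]
    exact (hb x (hΩK hx)).2.trans hCM
  · intro x hx hxd
    rw [StrongDual.norm_extendRCLike]
    have := hgle x (hΩK hx)
    linarith
  · intro ε hε
    have : {x | x ∈ Ω ∧ ε ≤ -ρ x} = closure Ω ∩ ρ ⁻¹' Iic (-ε) := by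
      ext x
      constructor
      · exact fun h => ⟨hΩK h.1, by simpa using le_neg.1 h.2⟩
      · intro h
        have h2 : ρ x ≤ -ε := h.2
        exact ⟨hmem x (hKU h.1) (by linarith), by linarith⟩
    rw [this]
    exact hK.of_isClosed_subset (hρK.preimage_isClosed_of_isClosed isClosed_closure isClosed_Iic)
      inter_subset_left
  · intro x hx
    simpa using hψρ x hx
  · intro x hx p hp
    rcases le_or_gt ‖p - x‖ r with h | h
    · have h1 := (htay x (hΩK hx) p h).2.1
      rw [hfr0 p hp, zero_sub, abs_neg] at h1
      have h2 : M * ‖p - x‖ ≤ C * ‖p - x‖ := by gcongr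
      linarith [neg_abs_le (ρ x)]
    · have h1 := (abs_le.1 (hb x (hΩK hx)).1).1
      obtain ⟨h4, -⟩ := hfar _ h
      have h6 : 2 * M / r * ‖p - x‖ ≤ C * ‖p - x‖ := by gcongr; linarith
      linarith

theorem le_mul_bdist_of_le {Ω : Set (E N)} {D C : ℝ} {x : E N} (hne : (frontier Ω).Nonempty)
    (h : ∀ p ∈ frontier Ω, D ≤ C * ‖p - x‖) : D ≤ C * bdist Ω x := by
  obtain ⟨p, hp, hpx⟩ := isClosed_frontier.exists_infDist_eq_dist hne x
  rw [bdist, hpx, dist_comm, dist_eq_norm]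
  exact h p hp

theorem bddAbove_bdist_image {Ω : Set (E N)} (hbd : Bornology.IsBounded Ω) :
    BddAbove (bdist Ω '' Ω) :=
  ((Metric.lipschitz_infDist_pt (frontier Ω)).isBounded_image hbd).bddAbove

theorem frontier_nonempty_of_isBounded [Nontrivial (E N)] {Ω : Set (E N)}
    (hbd : Bornology.IsBounded Ω) (hne : Ω.Nonempty) : (frontier Ω).Nonempty :=
  nonempty_frontier_iff.2 ⟨hne, fun h => NormedSpace.unbounded_univ ℝ (E N) (h ▸ hbd)⟩

/-- For real Kobayashi geodesics, the square root of the maximal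
boundary distance dominates the Euclidean length. -/
theorem stmt3 {N : ℕ} {α : ℝ} (hα : α ∈ Set.Ioc (0:ℝ) 1)
    (Ω : Set (E N)) (hΩ : IsStronglyPseudoconvexDomain 2 α Ω) :
    ∃ c : ℝ, 0 < c ∧ ∀ (a b : ℝ) (γ : ℝ → E N) (z w : E N), z ∈ Ω → w ∈ Ω →
      a ≤ b → γ a = z → γ b = w → (∀ t ∈ Set.Icc a b, γ t ∈ Ω) →
      (∀ s ∈ Set.Icc a b, ∀ t ∈ Set.Icc a b, kobayashi Ω (γ s) (γ t) = |s - t|) →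
      c * (eVariationOn γ (Set.Icc a b)).toReal ≤
        Real.sqrt (sSup (bdist Ω '' (γ '' Set.Icc a b))) := by
  rcases subsingleton_or_nontrivial (E N) with hE | hE
  · refine ⟨1, one_pos, fun a b γ z w _ _ _ _ _ _ _ => ?_⟩
    rw [eVariationOn.constant_on (f := γ) (Set.subsingleton_of_subsingleton)]
    simp
  obtain ⟨d, ℓ, ψ, C, r, c, d₀, g₀, h, hd⟩ := hΩ.exists_controlled
  obtain ⟨A, hA, hvar⟩ := h.eVariationOn_le
  have hC : 0 < C := one_pos.trans_le h.one_le
  have hbd : Bornology.IsBounded Ω := hΩ.2.2.1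
  refine ⟨(A * √C)⁻¹, by positivity, fun a b γ z w hz hw hab hγa hγb hγ hgeo => ?_⟩
  have ha : a ∈ Icc a b := ⟨le_rfl, hab⟩
  have hbdd : BddAbove (bdist Ω '' (γ '' Icc a b)) :=
    (bddAbove_bdist_image hbd).mono (image_mono (image_subset_iff.2 hγ))
  obtain ⟨S, hS⟩ : ∃ S, S = sSup (bdist Ω '' (γ '' Icc a b)) := ⟨_, rfl⟩
  obtain ⟨D, hD⟩ : ∃ D, D = sSup ((fun t => d (γ t)) '' Icc a b) := ⟨_, rfl⟩
  have hdS : ∀ t ∈ Icc a b, d (γ t) ≤ C * S := fun t ht => by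
    refine (le_mul_bdist_of_le (frontier_nonempty_of_isBounded hbd ⟨z, hz⟩)
      (hd _ (hγ t ht))).trans ?_
    rw [hS]
    gcongr
    exact le_csSup hbdd ⟨γ t, ⟨t, ht, rfl⟩, rfl⟩
  have hdbdd : BddAbove ((fun t => d (γ t)) '' Icc a b) :=
    ⟨C * S, forall_mem_image.2 hdS⟩
  have hdD : ∀ t ∈ Icc a b, d (γ t) ≤ D := fun t ht => hD ▸ le_csSup hdbdd ⟨t, ht, rfl⟩
  have hDS : D ≤ C * S := hD ▸ csSup_le ⟨_, a, ha, rfl⟩ (forall_mem_image.2 hdS)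
  have hD0 : 0 < D := (h.d_pos _ (hγ a ha)).trans_le (hdD a ha)
  obtain ⟨-, ⟨t₀, ht₀, rfl⟩, hlt⟩ := exists_lt_of_lt_csSup (s := (fun t => d (γ t)) '' Icc a b)
    ⟨_, a, ha, rfl⟩ (by rw [← hD]; exact half_lt_self hD0)
  have hv := ENNReal.toReal_le_of_le_ofReal (by positivity)
    (hvar a b γ hγ hgeo D hdD t₀ ht₀ (by linarith))
  rw [← hS]
  calc (A * √C)⁻¹ * (eVariationOn γ (Icc a b)).toReal ≤ (A * √C)⁻¹ * (A * √(C * S)) := by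
        gcongr
        exact hv.trans (by gcongr)
    _ = √S := by
        rw [Real.sqrt_mul hC.le]
        field_simp

end InvDist
end
end

section
/- Let Ω ⊂ ℂ^N be a bounded domain with C^{1,1}-smooth boundary. Then there exists a constant C ≥ 1 such that for all z, w ∈ Ω: A_Ω(z,w) ≤ C·A_Ω(w,z); that is, the function A_Ω is symmetric up to a multiplicative constant. -/
open Metric Set Filter Topology MeasureTheory

noncomputable section

namespace InvDist

variable {N : ℕ}

section Normals

open scoped RealInnerProductSpace

variable {F : Type*} [NormedAddCommGroup F] [InnerProductSpace ℝ F] {Ω : Set F}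

/-- The distance from a point of an open set to its frontier is at most the distance to any point
outside the set. -/
lemma infDist_frontier_le_dist (hΩ : IsOpen Ω) {z y : F} (hz : z ∈ Ω) (hy : y ∉ Ω) :
    infDist z (frontier Ω) ≤ dist z y := by
  obtain ⟨x, hx, hxf⟩ : ∃ x ∈ segment ℝ z y, x ∈ frontier Ω := by
    by_contra! h
    have hcover : segment ℝ z y ⊆ Ω ∪ (closure Ω)ᶜ := fun x hx => by
      by_contra hn
      simp only [mem_union, mem_compl_iff, not_or, not_not] at hn
      exact h x hx (by rw [hΩ.frontier_eq]; exact ⟨hn.2, hn.1⟩)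
    have hyc : y ∈ (closure Ω)ᶜ :=
      (hcover (right_mem_segment ℝ z y)).resolve_left hy
    obtain ⟨x, -, hx, hx'⟩ := (convex_segment z y).isPreconnected Ω (closure Ω)ᶜ hΩ
      isClosed_closure.isOpen_compl hcover ⟨z, left_mem_segment ℝ z y, hz⟩
      ⟨y, right_mem_segment ℝ z y, hyc⟩
    exact hx' (subset_closure hx)
  have := dist_add_dist_of_mem_segment hx
  linarith [infDist_le_dist_of_mem (x := z) hxf, dist_nonneg (x := x) (y := y)]

/-- The unit vector `η` points out of `Ω` at the boundary point `q`, and the ball of radius `δ`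
inside `Ω` with centre `q - δ • η` touches the boundary at `q`. -/
structure HasInnerBall (Ω : Set F) (q η : F) (δ : ℝ) : Prop where
  pos : 0 < δ
  norm_eq : ‖η‖ = 1
  mem_frontier : q ∈ frontier Ω
  ball_subset : ball (q - δ • η) δ ⊆ Ω

lemma hasInnerBall_of_dist_eq_infDist (hΩ : IsOpen Ω) {w q : F} (hw : w ∈ Ω)
    (hq : q ∈ frontier Ω) (hd : dist w q = infDist w (frontier Ω)) :
    HasInnerBall Ω q ((infDist w (frontier Ω))⁻¹ • (q - w)) (infDist w (frontier Ω)) := by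
  have hqΩ : q ∉ Ω := fun h => by
    rw [hΩ.frontier_eq] at hq
    exact hq.2 h
  have hpos : 0 < infDist w (frontier Ω) := by
    rw [← hd, dist_pos]
    rintro rfl
    exact hqΩ hw
  refine ⟨hpos, ?_, hq, fun y hy => ?_⟩
  · rw [norm_smul, norm_inv, Real.norm_of_nonneg hpos.le, ← dist_eq_norm, dist_comm, hd,
      inv_mul_cancel₀ hpos.ne']
  · rw [smul_inv_smul₀ hpos.ne', sub_sub_cancel, mem_ball, dist_comm] at hy
    by_contra hn
    exact absurd (infDist_frontier_le_dist hΩ hw hn) hy.not_ge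

lemma HasInnerBall.eventually_mem {q η : F} {δ : ℝ} (h : HasInnerBall Ω q η δ) {v : F}
    (hv : ⟪η, v⟫ < 0) : ∀ᶠ t : ℝ in 𝓝[>] 0, q + t • v ∈ ball (q - δ • η) δ := by
  have hlim : Tendsto (fun t : ℝ => t * ‖v‖ ^ 2 + 2 * δ * ⟪η, v⟫) (𝓝[>] 0)
      (𝓝 (0 * ‖v‖ ^ 2 + 2 * δ * ⟪η, v⟫)) :=
    Tendsto.mono_left (Continuous.tendsto (by fun_prop) 0) nhdsWithin_le_nhds
  have hneg : 0 * ‖v‖ ^ 2 + 2 * δ * ⟪η, v⟫ < 0 := by nlinarith [h.pos]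
  filter_upwards [hlim.eventually_lt_const hneg, self_mem_nhdsWithin] with t ht htpos
  rw [mem_ball, dist_eq_norm, show q + t • v - (q - δ • η) = t • v + δ • η by abel]
  refine lt_of_pow_lt_pow_left₀ 2 h.pos.le ?_
  rw [norm_add_sq_real, inner_smul_left, inner_smul_right, norm_smul, norm_smul, h.norm_eq,
    real_inner_comm]
  simp only [mul_pow, Real.norm_eq_abs, sq_abs, conj_trivial]
  have : t * (t * ‖v‖ ^ 2 + 2 * δ * ⟪η, v⟫) < 0 := mul_neg_of_pos_of_neg htpos ht
  linarith

/-- An exterior ball of radius `r` at `q` bounds the boundary distance from above. -/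
lemma HasInnerBall.infDist_le (hΩ : IsOpen Ω) {q η : F} {δ r : ℝ} (h : HasInnerBall Ω q η δ)
    (hr : 0 < r) (hext : ∀ x ∈ closedBall (q + r • η) r, x ∉ Ω) {z : F} (hz : z ∈ Ω) :
    infDist z (frontier Ω) ≤
      δ - ⟪η, z - (q - δ • η)⟫ + (2 * r)⁻¹ * ‖z - (q - δ • η)‖ ^ 2 := by
  set v := z - (q - δ • η) with hv
  have hδ := h.pos
  have hzc : r < ‖z - (q + r • η)‖ := by
    by_contra! hn
    exact hext z (by rwa [mem_closedBall, dist_eq_norm]) hz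
  have hD : 0 < ‖z - (q + r • η)‖ := hr.trans hzc
  have hupper : infDist z (frontier Ω) ≤ ‖z - (q + r • η)‖ - r := by
    set D := ‖z - (q + r • η)‖
    refine (infDist_frontier_le_dist hΩ hz
      (hext ((q + r • η) + (r / D) • (z - (q + r • η))) ?_)).trans_eq ?_
    · rw [mem_closedBall, dist_eq_norm, add_sub_cancel_left, norm_smul,
        Real.norm_of_nonneg (by positivity)]
      exact (div_mul_cancel₀ r hD.ne').le
    · rw [dist_eq_norm, show z - ((q + r • η) + (r / D) • (z - (q + r • η))) =
        (1 - r / D) • (z - (q + r • η)) by rw [sub_smul, one_smul]; abel, norm_smul,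
        Real.norm_of_nonneg (by rw [sub_nonneg, div_le_one hD]; exact hzc.le), sub_mul, one_mul]
      congr 1
      exact div_mul_cancel₀ r hD.ne'
  have hsq : ‖z - (q + r • η)‖ ^ 2 = ‖v‖ ^ 2 - 2 * (δ + r) * ⟪η, v⟫ + (δ + r) ^ 2 := by
    rw [show z - (q + r • η) = v - (δ + r) • η by rw [hv, add_smul]; abel, norm_sub_sq_real,
      inner_smul_right, norm_smul, h.norm_eq, Real.norm_of_nonneg (by positivity),
      real_inner_comm]
    ring
  have hle : ‖z - (q + r • η)‖ ≤ (δ + r) - ⟪η, v⟫ + (2 * (δ + r))⁻¹ * ‖v‖ ^ 2 := by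
    have hA : 0 < δ + r := by positivity
    have e : ‖z - (q + r • η)‖ ^ 2 =
        (δ + r) ^ 2 + 2 * (δ + r) * ((2 * (δ + r))⁻¹ * ‖v‖ ^ 2 - ⟪η, v⟫) := by
      rw [hsq]
      field_simp
      ring
    set s := (2 * (δ + r))⁻¹ * ‖v‖ ^ 2 - ⟪η, v⟫
    have hs : 0 ≤ (δ + r) + 2 * s := by
      refine nonneg_of_mul_nonneg_right (a := δ + r) ?_ hA
      nlinarith [sq_nonneg ‖z - (q + r • η)‖]
    have : ‖z - (q + r • η)‖ ≤ (δ + r) + s :=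
      le_of_sq_le_sq (by nlinarith [sq_nonneg s]) (by linarith)
    linarith
  have hinv : (2 * (δ + r))⁻¹ * ‖v‖ ^ 2 ≤ (2 * r)⁻¹ * ‖v‖ ^ 2 := by
    gcongr
    linarith
  linarith

variable [CompleteSpace F]

/-- At a boundary point where `Ω` is locally the sublevel set `{ρ < 0}`, the gradient of `ρ` is a
nonnegative multiple of the normal of any touching inner ball. -/
lemma HasInnerBall.gradient_eq (hΩ : IsOpen Ω) {q η : F} {δ : ℝ} (h : HasInnerBall Ω q η δ)
    {ρ : F → ℝ} (hρ : DifferentiableAt ℝ ρ q) (hiff : ∀ᶠ x in 𝓝 q, x ∈ Ω ↔ ρ x < 0) :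
    gradient ρ q = ‖gradient ρ q‖ • η := by
  set g := gradient ρ q with hg
  have hqΩ : q ∉ Ω := fun hmem => by
    have := h.mem_frontier
    rw [hΩ.frontier_eq] at this
    exact this.2 hmem
  have hq0 : 0 ≤ ρ q := not_lt.1 fun hlt => hqΩ (hiff.self_of_nhds.2 hlt)
  have key : ∀ v : F, ⟪η, v⟫ < 0 → ⟪g, v⟫ ≤ 0 := fun v hv => by
    have hmax : IsLocalMaxOn ρ (ball (q - δ • η) δ) q := by
      filter_upwards [nhdsWithin_le_nhds hiff, self_mem_nhdsWithin] with x hx hxb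
      exact ((hx.1 (h.ball_subset hxb)).le).trans hq0
    have := hmax.hasFDerivWithinAt_nonpos hρ.hasFDerivAt.hasFDerivWithinAt
      (mem_posTangentConeAt_of_frequently_mem (h.eventually_mem hv).frequently)
    rwa [hg, gradient, InnerProductSpace.toDual_symm_apply]
  have hηη : ⟪η, η⟫ = 1 := by rw [real_inner_self_eq_norm_sq, h.norm_eq, one_pow]
  have h1 : 0 ≤ ⟪g, η⟫ := by
    have := key (-η) (by rw [inner_neg_right, hηη]; norm_num)
    rw [inner_neg_right] at this
    linarith
  have h2 : ‖g‖ ^ 2 ≤ ⟪g, η⟫ ^ 2 := by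
    refine le_of_forall_pos_le_add fun e he => ?_
    have hpos : 0 < e / (⟪g, η⟫ + 1) := by positivity
    have := key (g - (⟪g, η⟫ + e / (⟪g, η⟫ + 1)) • η) (by
      rw [inner_sub_right, inner_smul_right, hηη, real_inner_comm]
      linarith)
    rw [inner_sub_right, inner_smul_right, real_inner_self_eq_norm_sq] at this
    have hle : e / (⟪g, η⟫ + 1) * ⟪g, η⟫ ≤ e := by
      rw [div_mul_eq_mul_div, div_le_iff₀ (by positivity)]
      nlinarith
    nlinarith
  have h3 : ‖g‖ ≤ ⟪g, η⟫ := le_of_sq_le_sq h2 h1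
  have h4 : ‖g - ‖g‖ • η‖ ^ 2 ≤ 0 := by
    rw [norm_sub_sq_real, inner_smul_right, norm_smul, h.norm_eq]
    simp only [norm_norm, mul_one]
    nlinarith [norm_nonneg g]
  have h5 : ‖g - ‖g‖ • η‖ = 0 := by
    have := sq_nonneg ‖g - ‖g‖ • η‖
    exact pow_eq_zero_iff two_ne_zero |>.1 (le_antisymm h4 this)
  exact sub_eq_zero.1 (norm_eq_zero.1 h5)

/-- `ρ` is a `C^{1,1}` defining function of `Ω` on the ball of radius `ε` about `p`, with gradient
bounded below by `c` and with Lipschitz constant `M`. -/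
structure IsLocalDefining (Ω : Set F) (ρ : F → ℝ) (p : F) (ε c M : ℝ) : Prop where
  pos_c : 0 < c
  nonneg_M : 0 ≤ M
  differentiableAt : ∀ x ∈ ball p ε, DifferentiableAt ℝ ρ x
  lipschitz : ∀ x ∈ ball p ε, ∀ y ∈ ball p ε, ‖fderiv ℝ ρ x - fderiv ℝ ρ y‖ ≤ M * ‖x - y‖
  lower : ∀ x ∈ ball p ε, c ≤ ‖fderiv ℝ ρ x‖
  mem_iff : ∀ x ∈ ball p ε, (x ∈ Ω ↔ ρ x < 0)

namespace IsLocalDefining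

variable {ρ : F → ℝ} {p q η : F} {ε c M δ : ℝ}

lemma gradient_eq (hL : IsLocalDefining Ω ρ p ε c M) (hΩ : IsOpen Ω)
    (h : HasInnerBall Ω q η δ) (hq : q ∈ ball p ε) :
    gradient ρ q = ‖fderiv ℝ ρ q‖ • η := by
  have := h.gradient_eq hΩ (hL.differentiableAt q hq)
    (by filter_upwards [isOpen_ball.mem_nhds hq] with x hx using hL.mem_iff x hx)
  rwa [show ‖gradient ρ q‖ = ‖fderiv ℝ ρ q‖ from LinearIsometryEquiv.norm_map _ _] at this

lemma norm_normal_sub_le (hL : IsLocalDefining Ω ρ p ε c M) (hΩ : IsOpen Ω)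
    (h : HasInnerBall Ω q η δ) (hq : q ∈ ball p ε) {q' η' : F} {δ' : ℝ}
    (h' : HasInnerBall Ω q' η' δ') (hq' : q' ∈ ball p ε) :
    c * ‖η - η'‖ ≤ 2 * M * ‖q - q'‖ := by
  have hlip := hL.lipschitz q hq q' hq'
  have hgrad : ‖gradient ρ q - gradient ρ q'‖ ≤ M * ‖q - q'‖ := by
    refine le_of_eq_of_le ?_ hlip
    rw [gradient, gradient, ← map_sub, LinearIsometryEquiv.norm_map]
  rw [hL.gradient_eq hΩ h hq, hL.gradient_eq hΩ h' hq'] at hgrad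
  have hc := hL.lower q hq
  have habs := abs_norm_sub_norm_le (fderiv ℝ ρ q') (fderiv ℝ ρ q)
  rw [norm_sub_rev] at habs
  set a := ‖fderiv ℝ ρ q‖
  set b := ‖fderiv ℝ ρ q'‖
  have hsplit : a • (η - η') = (a • η - b • η') + (b - a) • η' := by
    rw [smul_sub, sub_smul]; abel
  have := norm_add_le (a • η - b • η') ((b - a) • η')
  rw [← hsplit, norm_smul, norm_smul, h'.norm_eq, mul_one, Real.norm_eq_abs, Real.norm_eq_abs,
    abs_of_nonneg (hL.pos_c.le.trans hc)] at this
  have hmul := mul_le_mul_of_nonneg_right hc (norm_nonneg (η - η'))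
  linarith

/-- Points lying outside a suitable paraboloid at `q` do not belong to `Ω`. -/
lemma notMem_of_le_inner (hL : IsLocalDefining Ω ρ p ε c M) (hΩ : IsOpen Ω)
    (h : HasInnerBall Ω q η δ) (hq : q ∈ ball p ε) {x : F} (hx : x ∈ ball p ε)
    (hxq : M * ‖x - q‖ ^ 2 ≤ c * ⟪η, x - q⟫) : x ∉ Ω := by
  have hqΩ : q ∉ Ω := fun hmem => by
    have := h.mem_frontier
    rw [hΩ.frontier_eq] at this
    exact this.2 hmem
  have hq0 : 0 ≤ ρ q := not_lt.1 fun hlt => hqΩ ((hL.mem_iff q hq).2 hlt)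
  have hseg : segment ℝ q x ⊆ ball p ε := (convex_ball p ε).segment_subset hq hx
  have htaylor := (convex_segment q x).norm_image_sub_le_of_norm_fderiv_le' (𝕜 := ℝ)
    (f := ρ) (φ := fderiv ℝ ρ q) (C := M * ‖x - q‖)
    (fun y hy => hL.differentiableAt y (hseg hy))
    (fun y hy => (hL.lipschitz y (hseg hy) q hq).trans (by
      refine mul_le_mul_of_nonneg_left ?_ hL.nonneg_M
      have := dist_add_dist_of_mem_segment hy
      rw [← dist_eq_norm, ← dist_eq_norm, dist_comm y q, dist_comm x q]
      linarith [dist_nonneg (x := y) (y := x)]))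
    (left_mem_segment ℝ q x) (right_mem_segment ℝ q x)
  have hder : fderiv ℝ ρ q (x - q) = ‖fderiv ℝ ρ q‖ * ⟪η, x - q⟫ := by
    rw [← InnerProductSpace.toDual_symm_apply, ← gradient, hL.gradient_eq hΩ h hq,
      inner_smul_left, conj_trivial]
  rw [Real.norm_eq_abs, abs_le, hder] at htaylor
  have hin : 0 ≤ ⟪η, x - q⟫ := by
    have : 0 ≤ c * ⟪η, x - q⟫ := le_trans (by have := hL.nonneg_M; positivity) hxq
    exact nonneg_of_mul_nonneg_right this hL.pos_c
  have hc := mul_le_mul_of_nonneg_right (hL.lower q hq) hin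
  rw [hL.mem_iff x hx, not_lt]
  nlinarith [htaylor.1]

/-- Exterior balls of uniform size. -/
lemma closedBall_disjoint (hL : IsLocalDefining Ω ρ p ε c M) (hΩ : IsOpen Ω)
    (h : HasInnerBall Ω q η δ) {r : ℝ} (hr : 0 < r) (hrε : 4 * r < ε) (hrM : 2 * r * M ≤ c)
    (hq : q ∈ ball p (ε / 2)) {x : F} (hx : x ∈ closedBall (q + r • η) r) : x ∉ Ω := by
  have hxr : ‖(x - q) - r • η‖ ≤ r := by
    rwa [mem_closedBall, dist_eq_norm, ← sub_sub] at hx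
  have hsq := pow_le_pow_left₀ (norm_nonneg _) hxr 2
  rw [norm_sub_sq_real, inner_smul_right, norm_smul, h.norm_eq, Real.norm_of_nonneg hr.le,
    real_inner_comm] at hsq
  have hsq' : ‖x - q‖ ^ 2 ≤ 2 * r * ⟪η, x - q⟫ := by linarith
  have hin : 0 ≤ ⟪η, x - q⟫ :=
    nonneg_of_mul_nonneg_right ((sq_nonneg _).trans hsq') (by positivity)
  rw [mem_ball] at hq
  have hxq : ‖x - q‖ ≤ 2 * r := by
    have h1 := norm_add_le ((x - q) - r • η) (r • η)
    rw [sub_add_cancel, norm_smul, h.norm_eq, Real.norm_of_nonneg hr.le] at h1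
    linarith
  refine hL.notMem_of_le_inner hΩ h (mem_ball.2 (by linarith)) (mem_ball.2 ?_) ?_
  · have := dist_triangle x q p
    rw [dist_eq_norm x q] at this
    linarith
  · calc M * ‖x - q‖ ^ 2 ≤ M * (2 * r * ⟪η, x - q⟫) :=
          mul_le_mul_of_nonneg_left hsq' hL.nonneg_M
      _ = 2 * r * M * ⟪η, x - q⟫ := by ring
      _ ≤ c * ⟪η, x - q⟫ := mul_le_mul_of_nonneg_right hrM hin

end IsLocalDefining

/-- On a compact `C^{1,1}` boundary, unit normals are Lipschitz and boundary distances satisfy a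
uniform second-order upper bound. -/
lemma exists_uniform_normal_bounds (hΩ : IsOpen Ω) (hcomp : IsCompact (frontier Ω))
    (hloc : ∀ p ∈ frontier Ω, ∃ ρ : F → ℝ, ∃ ε c M : ℝ, 0 < ε ∧ IsLocalDefining Ω ρ p ε c M) :
    ∃ K : ℝ, 0 ≤ K ∧ ∀ q ∈ frontier Ω, ∀ (η : F) (δ : ℝ), HasInnerBall Ω q η δ →
      (∀ (q' η' : F) (δ' : ℝ), HasInnerBall Ω q' η' δ' → ‖η - η'‖ ≤ K * ‖q - q'‖) ∧
      ∀ z ∈ Ω, infDist z (frontier Ω) ≤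
        δ - ⟪η, z - (q - δ • η)⟫ + K * ‖z - (q - δ • η)‖ ^ 2 := by
  refine hcomp.induction_on (p := fun S => ∃ K : ℝ, 0 ≤ K ∧ ∀ q ∈ S, ∀ (η : F) (δ : ℝ),
      HasInnerBall Ω q η δ →
      (∀ (q' η' : F) (δ' : ℝ), HasInnerBall Ω q' η' δ' → ‖η - η'‖ ≤ K * ‖q - q'‖) ∧
      ∀ z ∈ Ω, infDist z (frontier Ω) ≤
        δ - ⟪η, z - (q - δ • η)⟫ + K * ‖z - (q - δ • η)‖ ^ 2) ?_ ?_ ?_ ?_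
  · exact ⟨0, le_rfl, fun q hq => hq.elim⟩
  · rintro S T hST ⟨K, hK, h⟩
    exact ⟨K, hK, fun q hq => h q (hST hq)⟩
  · rintro S T ⟨K, hK, h⟩ ⟨L, hL, h'⟩
    refine ⟨max K L, hK.trans (le_max_left _ _), fun q hq η δ hb => ?_⟩
    rcases hq with hq | hq
    · refine ⟨fun q' η' δ' hb' => ((h q hq η δ hb).1 q' η' δ' hb').trans ?_,
        fun z hz => ((h q hq η δ hb).2 z hz).trans ?_⟩
      · gcongr; exact le_max_left _ _
      · gcongr; exact le_max_left _ _
    · refine ⟨fun q' η' δ' hb' => ((h' q hq η δ hb).1 q' η' δ' hb').trans ?_,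
        fun z hz => ((h' q hq η δ hb).2 z hz).trans ?_⟩
      · gcongr; exact le_max_right _ _
      · gcongr; exact le_max_right _ _
  · intro p hp
    obtain ⟨ρ, ε, c, M, hε, hL⟩ := hloc p hp
    have hc := hL.pos_c
    have hM := hL.nonneg_M
    obtain ⟨r, hr, hrε, hrM⟩ : ∃ r : ℝ, 0 < r ∧ 4 * r < ε ∧ 2 * r * M ≤ c := by
      refine ⟨min (ε / 8) (c / (2 * (M + 1))), by positivity, ?_, ?_⟩
      · linarith [min_le_left (ε / 8) (c / (2 * (M + 1)))]
      · have h1 := min_le_right (ε / 8) (c / (2 * (M + 1)))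
        rw [le_div_iff₀ (by positivity)] at h1
        have h2 : 0 < min (ε / 8) (c / (2 * (M + 1))) := by positivity
        linarith
    refine ⟨ball p (ε / 2), mem_nhdsWithin_of_mem_nhds (ball_mem_nhds p (by positivity)),
      2 * M / c + 4 / ε + (2 * r)⁻¹, by positivity, fun q hq η δ hb => ⟨?_, fun z hz => ?_⟩⟩
    · intro q' η' δ' hb'
      have hn := norm_nonneg (q - q')
      have hqε : q ∈ ball p ε := ball_subset_ball (by linarith) hq
      have hle : ‖η - η'‖ ≤ 2 * M / c * ‖q - q'‖ ∨ ‖η - η'‖ ≤ 4 / ε * ‖q - q'‖ := by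
        by_cases hq' : q' ∈ ball p ε
        · left
          have := hL.norm_normal_sub_le hΩ hb hqε hb' hq'
          rw [div_mul_eq_mul_div, le_div_iff₀ hc]
          linarith
        · right
          have h2 : ‖η - η'‖ ≤ 2 := by
            have := norm_sub_le η η'
            rw [hb.norm_eq, hb'.norm_eq] at this
            linarith
          have h3 : ε / 2 ≤ ‖q - q'‖ := by
            rw [mem_ball] at hq hq'
            have := dist_triangle q' q p
            rw [dist_comm q' q, dist_eq_norm q q'] at this
            linarith
          rw [div_mul_eq_mul_div, le_div_iff₀ hε]
          nlinarith
      have p1 : 0 ≤ 2 * M / c * ‖q - q'‖ := by positivity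
      have p2 : 0 ≤ 4 / ε * ‖q - q'‖ := by positivity
      have p3 : 0 ≤ (2 * r)⁻¹ * ‖q - q'‖ := by positivity
      rw [add_mul, add_mul]
      rcases hle with h | h <;> linarith
    · refine (hb.infDist_le hΩ hr
        (fun x hx => hL.closedBall_disjoint hΩ hb hr hrε hrM hq hx) hz).trans ?_
      gcongr
      have p1 : 0 ≤ 2 * M / c := by positivity
      have p2 : 0 ≤ 4 / ε := by positivity
      linarith

end Normals

lemma herm_eq_inner (a b : E N) : herm a b = inner ℂ b a := by
  simp [herm, PiLp.inner_apply]

lemma real_inner_eq_re_herm (a b : E N) : (inner ℝ b a : ℝ) = (herm a b).re := by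
  simp [herm, PiLp.inner_apply, Complex.inner]

/-- Near each boundary point of a `C^{1,1}` domain there is a local defining function. -/
lemma IsC11Domain.exists_isLocalDefining {Ω : Set (E N)} (hΩ : IsC11Domain Ω) {p : E N}
    (hp : p ∈ frontier Ω) :
    ∃ ρ : E N → ℝ, ∃ ε c M : ℝ, 0 < ε ∧ IsLocalDefining Ω ρ p ε c M := by
  obtain ⟨U, ρ, hU, hpU, ⟨hdiff, M, hM⟩, hiff, hne⟩ := hΩ.2.2.2 p hp
  have hpos : 0 < ‖fderiv ℝ ρ p‖ := norm_pos_iff.2 (hne p ⟨hpU, hp⟩)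
  have hcont : ContinuousAt (fun x => ‖fderiv ℝ ρ x‖) p :=
    ((hdiff.continuousOn_fderiv_of_isOpen hU (by simp)).continuousAt
      (hU.mem_nhds hpU)).norm
  have hev : ∀ᶠ x in 𝓝 p, x ∈ U ∧ ‖fderiv ℝ ρ p‖ / 2 < ‖fderiv ℝ ρ x‖ :=
    (hU.eventually_mem hpU).and (hcont.eventually_const_lt (half_lt_self hpos))
  obtain ⟨ε, hε, hball⟩ := Metric.mem_nhds_iff.1 hev
  refine ⟨ρ, ε, ‖fderiv ℝ ρ p‖ / 2, max M 0, hε, half_pos hpos, le_max_right _ _,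
    fun x hx => ?_, fun x hx y hy => ?_, fun x hx => (hball hx).2.le,
    fun x hx => hiff x (hball hx).1⟩
  · exact (hdiff.differentiableOn (by simp)).differentiableAt (hU.mem_nhds (hball hx).1)
  · have h := hM x (hball hx).1 y (hball hy).1
    rw [Real.rpow_one] at h
    have hle : ‖fderiv ℝ ρ x - fderiv ℝ ρ y‖ ≤
        ‖iteratedFDeriv ℝ 1 ρ x - iteratedFDeriv ℝ 1 ρ y‖ :=
      ContinuousLinearMap.opNorm_le_bound _ (norm_nonneg _) fun v => by
        simpa [iteratedFDeriv_one_apply] using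
          (iteratedFDeriv ℝ 1 ρ x - iteratedFDeriv ℝ 1 ρ y).le_opNorm fun _ => v
    exact (hle.trans h).trans (by gcongr; exact le_max_left _ _)

/-- The numerical comparison behind the quasi-symmetry of `Afun`, with `a` and `b` the square roots
of the two boundary distances. -/
lemma numerator_le {m n d e a b K S : ℝ} (hn : 0 ≤ n) (hd : 0 ≤ d) (ha : 0 ≤ a) (hb : 0 ≤ b)
    (hK : 0 ≤ K) (hdist : a ^ 2 ≤ b ^ 2 + n + K * d ^ 2) (hm : m ≤ n + d * e)
    (he : e ≤ K * (d + a ^ 2 + b ^ 2)) (haS : a ≤ S) (hbS : b ≤ S) :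
    m + d ^ 2 + d * a ≤ (3 + K + K * (1 + S * (3 + K))) * (n + d ^ 2 + d * b) := by
  have hS : 0 ≤ S := ha.trans haS
  have hdb : 0 ≤ d * b := by positivity
  have hd2 : 0 ≤ d ^ 2 := by positivity
  set X := n + d ^ 2 + d * b with hX
  have hX0 : 0 ≤ X := by positivity
  have hda : d * a ≤ (2 + K) * X := by
    refine le_of_sq_le_sq ?_ (by positivity)
    have h1 : (d * b) ^ 2 ≤ X ^ 2 := pow_le_pow_left₀ hdb (by linarith) 2
    have h2 : d ^ 2 * n ≤ X ^ 2 := by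
      rw [sq X]; exact mul_le_mul (by linarith) (by linarith) hn hX0
    have h3 : d ^ 2 * d ^ 2 ≤ X ^ 2 := by
      rw [sq X]; exact mul_le_mul (by linarith) (by linarith) hd2 hX0
    calc (d * a) ^ 2 = d ^ 2 * a ^ 2 := by ring
      _ ≤ d ^ 2 * (b ^ 2 + n + K * d ^ 2) := by gcongr
      _ = (d * b) ^ 2 + d ^ 2 * n + K * (d ^ 2 * d ^ 2) := by ring
      _ ≤ X ^ 2 + X ^ 2 + K * X ^ 2 := by gcongr
      _ = (2 + K) * X ^ 2 := by ring
      _ ≤ (2 + K) * ((2 + K) * X ^ 2) := by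
          nlinarith [mul_nonneg hK (sq_nonneg X), sq_nonneg X,
            mul_nonneg (add_nonneg zero_le_two hK) (sq_nonneg X),
            mul_nonneg hK (mul_nonneg (add_nonneg zero_le_two hK) (sq_nonneg X))]
      _ = ((2 + K) * X) ^ 2 := by ring
  have hde : d * e ≤ K * (X + S * ((2 + K) * X) + S * X) := by
    calc d * e ≤ d * (K * (d + a ^ 2 + b ^ 2)) := by gcongr
      _ = K * (d ^ 2 + a * (d * a) + b * (d * b)) := by ring
      _ ≤ K * (X + S * ((2 + K) * X) + S * X) := by
          gcongr
          · linarith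
          · linarith
  calc m + d ^ 2 + d * a ≤ (n + d * e) + d ^ 2 + d * a := by gcongr
    _ ≤ X + K * (X + S * ((2 + K) * X) + S * X) + (2 + K) * X := by linarith
    _ = (3 + K + K * (1 + S * (3 + K))) * X := by ring

/-- `A_Ω` is symmetric up to a multiplicative constant on bounded
domains with `C^{1,1}`-smooth boundary. -/
theorem stmt7 {N : ℕ} (Ω : Set (E N)) (hΩ : IsC11Domain Ω)
    (π : E N → E N) (hπ : IsClosestPointSelection Ω π) :
    ∃ C : ℝ, 1 ≤ C ∧ ∀ z ∈ Ω, ∀ w ∈ Ω, Afun Ω π z w ≤ C * Afun Ω π w z := by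
  obtain ⟨hopen, -, hbdd, -⟩ := id hΩ
  have hcomp : IsCompact (frontier Ω) :=
    hbdd.isCompact_closure.of_isClosed_subset isClosed_frontier frontier_subset_closure
  obtain ⟨K, hK, hbound⟩ := exists_uniform_normal_bounds hopen hcomp
    fun p hp => hΩ.exists_isLocalDefining hp
  obtain ⟨R, hR⟩ := hbdd.closure.exists_norm_le
  set η : E N → E N := fun z => (bdist Ω z)⁻¹ • (π z - z) with hη
  have hball : ∀ z ∈ Ω, HasInnerBall Ω (π z) (η z) (bdist Ω z) := fun z hz =>
    hasInnerBall_of_dist_eq_infDist hopen hz (hπ z hz).1 (hπ z hz).2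
  have hcenter : ∀ z ∈ Ω, π z - bdist Ω z • η z = z := fun z hz => by
    rw [hη, smul_inv_smul₀ (hball z hz).pos.ne', sub_sub_cancel]
  have hncomp : ∀ z ∈ Ω, ∀ v, ncomp Ω π z v = ‖herm v (η z)‖ := fun z hz v => by
    have hpos := (hball z hz).pos
    have : herm v (η z) = ((bdist Ω z)⁻¹ : ℝ) * herm v (π z - z) := by
      simp only [herm, hη, Finset.mul_sum]
      refine Finset.sum_congr rfl fun j _ => ?_
      simp [Complex.real_smul]
      ring
    rw [this, norm_mul, Complex.norm_real, Real.norm_of_nonneg (by positivity), ncomp,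
      div_eq_inv_mul]
  have hsize : ∀ z ∈ Ω, √(bdist Ω z) ≤ √(2 * R) := fun z hz => by
    refine Real.sqrt_le_sqrt ?_
    rw [← (hπ z hz).2, dist_eq_norm]
    linarith [norm_sub_le z (π z), hR z (subset_closure hz),
      hR (π z) (frontier_subset_closure (hπ z hz).1)]
  have hS := Real.sqrt_nonneg (2 * R)
  refine ⟨3 + K + K * (1 + √(2 * R) * (3 + K)), ?_, fun z hz w hw => ?_⟩
  · have : 0 ≤ K * (1 + √(2 * R) * (3 + K)) := by positivity
    linarith
  have hz0 := (hball z hz).pos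
  have hw0 := (hball w hw).pos
  obtain ⟨hlip, hdist⟩ := hbound (π w) (hπ w hw).1 (η w) (bdist Ω w) (hball w hw)
  have hdist := hdist z hz
  rw [hcenter w hw] at hdist
  have hlip := hlip (π z) (η z) (bdist Ω z) (hball z hz)
  have hnum : ncomp Ω π z (z - w) + ‖z - w‖ ^ 2 + ‖z - w‖ * √(bdist Ω z) ≤
      (3 + K + K * (1 + √(2 * R) * (3 + K))) *
        (ncomp Ω π w (w - z) + ‖z - w‖ ^ 2 + ‖z - w‖ * √(bdist Ω w)) := by
    refine numerator_le (e := ‖η w - η z‖) ?_ (norm_nonneg _) (Real.sqrt_nonneg _)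
      (Real.sqrt_nonneg _) hK ?_ ?_ ?_ (hsize z hz) (hsize w hw)
    · rw [hncomp w hw]
      exact norm_nonneg _
    · rw [Real.sq_sqrt hz0.le, Real.sq_sqrt hw0.le, hncomp w hw]
      have hre : -(inner ℝ (η w) (z - w) : ℝ) ≤ ‖herm (w - z) (η w)‖ := by
        rw [← inner_neg_right, neg_sub, real_inner_eq_re_herm]
        exact Complex.re_le_norm _
      change infDist z (frontier Ω) ≤ _
      linarith
    · rw [hncomp z hz, hncomp w hw, herm_eq_inner, herm_eq_inner, ← neg_sub z w,
        inner_neg_right, norm_neg]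
      have hsplit : inner ℂ (η z) (z - w) =
          inner ℂ (η w) (z - w) - inner ℂ (η w - η z) (z - w) := by
        rw [inner_sub_left]; ring
      have hcs := norm_inner_le_norm (𝕜 := ℂ) (η w - η z) (z - w)
      rw [hsplit]
      have := norm_sub_le (inner ℂ (η w) (z - w)) (inner ℂ (η w - η z) (z - w))
      linarith
    · rw [Real.sq_sqrt hz0.le, Real.sq_sqrt hw0.le]
      refine hlip.trans (mul_le_mul_of_nonneg_left ?_ hK)
      rw [← (hπ z hz).2, ← (hπ w hw).2, ← dist_eq_norm, ← dist_eq_norm]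
      have h1 := dist_triangle4 (π w) w z (π z)
      rw [dist_comm (π w) w, dist_comm w z] at h1
      linarith
  rw [Afun, Afun, norm_sub_rev w z, mul_comm √(bdist Ω w), ← mul_div_assoc]
  exact div_le_div_of_nonneg_right hnum (by positivity)

end InvDist
end
end
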